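/- Let p, q ≥ 1, n = p+q, and let λ, μ be weakly decreasing real n-sequences satisfying the regularity condition λ(p) > λ(p+1) and μ(p) > μ(p+1). Then the following two subsets of ℝ^n are equal: (i) the set of weakly decreasing sequences ν = (ν(1) ≥ … ≥ ν(n)) such that there exist g, h ∈ U(p,q) with D_ν = g D_λ g^{-1} + h D_μ h^{-1}; (ii) the set of sequences ν with ν(1) ≥ … ≥ ν(p) and ν(p+1) ≥ … ≥ ν(n) such that there exist u_1, u_2 ∈ U(p), v_1, v_2 ∈ U(q) and Y ∈ M_{p×q}(ℂ) with D_ν = (u_1 ⊕ v_1) D_λ (u_1 ⊕ v_1)^* + (u_2 ⊕ v_2) D_μ (u_2 ⊕ v_2)^* + (Y Y^* ⊕ (−Y^* Y)). (That is, P(λ,μ) = Kir(O_λ × O_μ × p^+).) -/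

import Mathlib

open Matrix

noncomputable section

/-- The standard flag subspace `span(e_1, …, e_j)` of `ℂ^n` (with 0-indexed coordinates,
this is the space of vectors vanishing on all coordinates `≥ j`). -/
def stdFlag (n j : ℕ) : Submodule ℂ (Fin n → ℂ) where
  carrier := {f | ∀ i : Fin n, j ≤ (i : ℕ) → f i = 0}
  add_mem' := by
    intro a b ha hb i hi
    simp only [Pi.add_apply, ha i hi, hb i hi, add_zero]
  zero_mem' := by intro i _; rfl
  smul_mem' := by
    intro c f hf i hi
    simp only [Pi.smul_apply, hf i hi, smul_zero]

/-- A quiver given by source and target maps has no oriented cycles. -/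
def NoCycles {V A : Type} (src tgt : A → V) : Prop :=
  ∀ (k : ℕ) (f : Fin (k + 1) → A),
    (∀ i : Fin k, tgt (f i.castSucc) = src (f i.succ)) →
    tgt (f (Fin.last k)) ≠ src (f 0)

/-- `α ≤_Q n` : every representation of the quiver on the spaces `ℂ^{n_x}` has a
subrepresentation of dimension vector `α`. -/
def HasSubrepOfDim {V A : Type} (src tgt : A → V) (n : V → ℕ) (α : V → ℕ) : Prop :=
  ∀ r : ∀ a : A, (Fin (n (src a)) → ℂ) →ₗ[ℂ] (Fin (n (tgt a)) → ℂ),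
    ∃ S : ∀ x : V, Submodule ℂ (Fin (n x) → ℂ),
      (∀ x : V, Module.finrank ℂ (S x) = α x) ∧
      (∀ a : A, (S (src a)).map (r a) ≤ S (tgt a))

/-- A family `K = (K_x)` of subsets `K_x ⊆ {1,…,n_x}` is `Q`-intersecting for `n` if every
representation of the quiver on the `ℂ^{n_x}` admits a subrepresentation `S` lying in the
Schubert variety indexed by `K` (w.r.t. the standard flags). -/
def IsQIntersecting {V A : Type} (src tgt : A → V) (n : V → ℕ)
    (K : ∀ x : V, Finset (Fin (n x))) : Prop :=
  ∀ r : ∀ a : A, (Fin (n (src a)) → ℂ) →ₗ[ℂ] (Fin (n (tgt a)) → ℂ),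
    ∃ S : ∀ x : V, Submodule ℂ (Fin (n x) → ℂ),
      (∀ x : V, Module.finrank ℂ (S x) = (K x).card) ∧
      (∀ x : V, ∀ j : Fin (K x).card,
        (j : ℕ) + 1 ≤ Module.finrank ℂ
          ((S x ⊓ stdFlag (n x) ((((K x).orderIsoOfFin rfl j : Fin (n x)) : ℕ) + 1) :
            Submodule ℂ (Fin (n x) → ℂ)))) ∧
      (∀ a : A, (S (src a)).map (r a) ≤ S (tgt a))

/-- The expected dimension `edim_{Q,B}(K, n)`. -/
def edimQB {V A : Type} [Fintype V] [Fintype A] (src tgt : A → V) (n : V → ℕ)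
    (K : ∀ x : V, Finset (Fin (n x))) : ℤ :=
  (∑ x : V, ∑ j : Fin (K x).card,
      (((((K x).orderIsoOfFin rfl j : Fin (n x)) : ℕ) : ℤ) - ((j : ℕ) : ℤ))) -
  ∑ a : A, ((K (src a)).card : ℤ) * ((n (tgt a) : ℤ) - ((K (tgt a)).card : ℤ))

/-- Composition `K ∘ L` of a family of subsets with a family of subsets of the index sets. -/
def composeFam {V : Type} {n : V → ℕ} (K : ∀ x : V, Finset (Fin (n x)))
    (L : ∀ x : V, Finset (Fin (K x).card)) : ∀ x : V, Finset (Fin (n x)) :=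
  fun x => (L x).image (fun j => ((K x).orderIsoOfFin rfl j : Fin (n x)))

/-- The moment map for the action of `∏_x U(n_x)` on the representation space of the quiver,
`μ_x(r) = Σ_{b : y→x} r_b r_b^* − Σ_{a : x→y} r_a^* r_a`. -/
def momentMap {V A : Type} [Fintype A] [DecidableEq V] (src tgt : A → V) (n : V → ℕ)
    (r : ∀ a : A, Matrix (Fin (n (tgt a))) (Fin (n (src a))) ℂ) (x : V) :
    Matrix (Fin (n x)) (Fin (n x)) ℂ :=
  (∑ a : A, if h : tgt a = x then
      Matrix.reindex (finCongr (congrArg n h)) (finCongr (congrArg n h)) (r a * (r a)ᴴ)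
    else 0) -
  (∑ a : A, if h : src a = x then
      Matrix.reindex (finCongr (congrArg n h)) (finCongr (congrArg n h)) ((r a)ᴴ * r a)
    else 0)

/-! ### The quiver `Q_{3,3}` with vertices `1,…,6` and arrows `1→3, 2→3, 4→3, 4→5, 4→6`
(0-indexed: `0→2, 1→2, 3→2, 3→4, 3→5`). -/

def q33src : Fin 5 → Fin 6 := ![0, 1, 3, 3, 3]

def q33tgt : Fin 5 → Fin 6 := ![2, 2, 2, 4, 5]

/-- The dimension vector `[p,p,p,q,q,q]` for `Q_{3,3}`. -/
def n33 (p q : ℕ) : Fin 6 → ℕ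
  | ⟨0, _⟩ => p
  | ⟨1, _⟩ => p
  | ⟨2, _⟩ => p
  | ⟨3, _⟩ => q
  | ⟨4, _⟩ => q
  | ⟨5, _⟩ => q

/-- A family of subsets for `Q_{3,3}` built from three subsets of `{1,…,p}` (vertices 1,2,3)
and three subsets of `{1,…,q}` (vertices 4,5,6). -/
def fam6 (p q : ℕ) (K : Fin 3 → Finset (Fin p)) (L : Fin 3 → Finset (Fin q)) :
    ∀ x : Fin 6, Finset (Fin (n33 p q x))
  | ⟨0, _⟩ => K 0
  | ⟨1, _⟩ => K 1
  | ⟨2, _⟩ => K 2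
  | ⟨3, _⟩ => L 0
  | ⟨4, _⟩ => L 1
  | ⟨5, _⟩ => L 2

/-! ### The pseudo-unitary group `U(p,q)` -/

/-- The matrix `η = diag(I_p, −I_q)`. -/
def etaMat (p q : ℕ) : Matrix (Fin (p + q)) (Fin (p + q)) ℂ :=
  Matrix.diagonal fun i => if (i : ℕ) < p then 1 else -1

/-- Membership in `U(p,q) = {g : gᴴ η g = η}`. -/
def InUpq (p q : ℕ) (g : Matrix (Fin (p + q)) (Fin (p + q)) ℂ) : Prop :=
  gᴴ * etaMat p q * g = etaMat p q

/-- The central element `Z = diag(q I_p, −p I_q)`. -/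
def Zmat (p q : ℕ) : Matrix (Fin (p + q)) (Fin (p + q)) ℂ :=
  Matrix.diagonal fun i => if (i : ℕ) < p then (q : ℂ) else -(p : ℂ)

/-- The complex diagonal matrix with entries a real sequence. -/
def Dmat {n : ℕ} (A : Fin n → ℝ) : Matrix (Fin n) (Fin n) ℂ :=
  Matrix.diagonal fun i => (A i : ℂ)

/-- The block-diagonal matrix `u ⊕ v`. -/
def blockDiag {p q : ℕ} (u : Matrix (Fin p) (Fin p) ℂ) (v : Matrix (Fin q) (Fin q) ℂ) :
    Matrix (Fin (p + q)) (Fin (p + q)) ℂ :=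
  Matrix.reindex finSumFinEquiv finSumFinEquiv (Matrix.fromBlocks u 0 0 v)

end

noncomputable section

open scoped ComplexOrder

section LogDet

variable {n : Type*} [Fintype n] [DecidableEq n]

/-- Spectral decomposition of a Hermitian matrix in unbundled form. -/
theorem Matrix.IsHermitian.exists_diagonalization {A : Matrix n n ℂ} (hA : A.IsHermitian) :
    ∃ (W : Matrix n n ℂ) (d : n → ℝ), Wᴴ * W = 1 ∧ W * Wᴴ = 1 ∧
      A = W * diagonal (fun i => (d i : ℂ)) * Wᴴ := by
  refine ⟨hA.eigenvectorUnitary, hA.eigenvalues, ?_, ?_, ?_⟩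
  · exact Unitary.coe_star_mul_self hA.eigenvectorUnitary
  · exact Unitary.coe_mul_star_self hA.eigenvectorUnitary
  · conv_lhs => rw [hA.spectral_theorem, Unitary.conjStarAlgAut_apply]
    rfl

theorem Matrix.PosDef.exists_diagonalization {A : Matrix n n ℂ} (hA : A.PosDef) :
    ∃ (W : Matrix n n ℂ) (d : n → ℝ), Wᴴ * W = 1 ∧ W * Wᴴ = 1 ∧ (∀ i, 0 < d i) ∧
      A = W * diagonal (fun i => (d i : ℂ)) * Wᴴ := by
  obtain ⟨W, d, h1, h2, h3⟩ := hA.isHermitian.exists_diagonalization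
  refine ⟨W, d, h1, h2, fun i => ?_, h3⟩
  have h4 : (diagonal (fun i => (d i : ℂ))).PosDef := by
    have h5 : diagonal (fun i => (d i : ℂ)) = Wᴴ * A * W := by
      rw [h3]
      calc _ = 1 * diagonal (fun i => (d i : ℂ)) * 1 := by simp
        _ = (Wᴴ * W) * diagonal (fun i => (d i : ℂ)) * (Wᴴ * W) := by rw [h1]
        _ = _ := by simp only [Matrix.mul_assoc]
    rw [h5]
    exact hA.conjTranspose_mul_mul_same
      (Function.LeftInverse.injective (g := Wᴴ.mulVec) fun x => by simp [h1])
  simpa using h4.diag_pos (i := i)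

theorem Matrix.PosDef.exists_conjTranspose_mul_self {A : Matrix n n ℂ} (hA : A.PosDef) :
    ∃ S : Matrix n n ℂ, IsUnit S.det ∧ A = Sᴴ * S := by
  obtain ⟨W, d, h1, h2, hd, h3⟩ := hA.exists_diagonalization
  have hS : A = (diagonal (fun i => (Real.sqrt (d i) : ℂ)) * Wᴴ)ᴴ *
      (diagonal (fun i => (Real.sqrt (d i) : ℂ)) * Wᴴ) := by
    rw [conjTranspose_mul, conjTranspose_conjTranspose, diagonal_conjTranspose, h3]
    simp only [Matrix.mul_assoc]
    rw [← Matrix.mul_assoc (diagonal _) (diagonal _) Wᴴ, diagonal_mul_diagonal]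
    congr! 4 with i
    simp [← Complex.ofReal_mul, Real.mul_self_sqrt (hd i).le]
  refine ⟨_, ?_, hS⟩
  have := hA.isUnit
  rw [hS, isUnit_iff_isUnit_det, det_mul] at this
  exact isUnit_of_mul_isUnit_right this

/-- The real part of the trace. -/
def rtr {n : Type*} [Fintype n] (A : Matrix n n ℂ) : ℝ := A.trace.re

theorem rtr_add {n : Type*} [Fintype n] (A B : Matrix n n ℂ) : rtr (A + B) = rtr A + rtr B := by
    simp [rtr]

end LogDet

section LogDetEstimates

variable {n : Type*} [Fintype n] [DecidableEq n]

theorem Matrix.PosDef.isUnit_det {A : Matrix n n ℂ} (hA : A.PosDef) : IsUnit A.det :=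
  (isUnit_iff_isUnit_det A).1 hA.isUnit

theorem Matrix.PosDef.det_re_pos {A : Matrix n n ℂ} (hA : A.PosDef) : 0 < A.det.re :=
  (Complex.pos_iff.1 hA.det_pos).1

theorem Matrix.PosDef.ofReal_det_re {A : Matrix n n ℂ} (hA : A.PosDef) :
    (A.det.re : ℂ) = A.det :=
  Complex.ext rfl (by simpa using (Complex.pos_iff.1 hA.det_pos).2)

theorem Matrix.mulVec_injective_of_isUnit_det {S : Matrix n n ℂ} (hS : IsUnit S.det) :
    Function.Injective S.mulVec :=
  Matrix.mulVec_injective_of_isUnit ((isUnit_iff_isUnit_det S).2 hS)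

theorem Matrix.PosDef.conj {A S : Matrix n n ℂ} (hA : A.PosDef) (hS : IsUnit S.det) :
    (Sᴴ * A * S).PosDef :=
  hA.conjTranspose_mul_mul_same (mulVec_injective_of_isUnit_det hS)

theorem log_det_le_sum_diag {A : Matrix n n ℂ} (hA : A.PosDef) :
    Real.log A.det.re ≤ ∑ i, ((A i i).re - 1) := by
  have h1 : A.det.re = ∏ i, hA.isHermitian.eigenvalues i := by
    rw [hA.isHermitian.det_eq_prod_eigenvalues]
    norm_cast
  have h2 : ∑ i, (A i i).re = ∑ i, hA.isHermitian.eigenvalues i := by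
    have := congrArg Complex.re hA.isHermitian.trace_eq_sum_eigenvalues
    simpa [Matrix.trace] using this
  rw [Finset.sum_sub_distrib, h2, ← Finset.sum_sub_distrib, h1,
    Real.log_prod (fun i _ => (hA.eigenvalues_pos i).ne')]
  exact Finset.sum_le_sum fun i _ => Real.log_le_sub_one_of_pos (hA.eigenvalues_pos i)

theorem log_det_conj {A S : Matrix n n ℂ} (hA : A.PosDef) (hS : IsUnit S.det) :
    Real.log (Sᴴ * A * S).det.re = Real.log A.det.re + Real.log (Sᴴ * S).det.re := by
  have h1 : (Sᴴ * S).PosDef := by simpa using PosDef.one.conj hS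
  rw [← Real.log_mul hA.det_re_pos.ne' h1.det_re_pos.ne']
  congr 1
  have : (Sᴴ * A * S).det = A.det * (Sᴴ * S).det := by simp only [det_mul]; ring
  rw [this, ← hA.ofReal_det_re, ← h1.ofReal_det_re, ← Complex.ofReal_mul]
  simp

theorem log_det_mono {A B : Matrix n n ℂ} (hA : A.PosDef) (hB : B.PosDef)
    (hAB : (B - A).PosSemidef) : Real.log A.det.re ≤ Real.log B.det.re := by
  obtain ⟨S, hS, rfl⟩ := hB.exists_conjTranspose_mul_self
  have hS' : IsUnit (S⁻¹).det := by simpa using hS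
  have e1 : S⁻¹ * S = 1 := nonsing_inv_mul S hS
  have e2 : S * S⁻¹ = 1 := mul_nonsing_inv S hS
  have e3 : (S⁻¹)ᴴ * Sᴴ = 1 := by rw [← conjTranspose_mul, e2, conjTranspose_one]
  have e4 : Sᴴ * (S⁻¹)ᴴ = 1 := by rw [← conjTranspose_mul, e1, conjTranspose_one]
  set Q := (S⁻¹)ᴴ * A * S⁻¹ with hQ
  have hQp : Q.PosDef := hA.conj hS'
  have hA2 : A = Sᴴ * Q * S := by
    rw [hQ]
    calc A = 1 * A * 1 := by simp
      _ = (Sᴴ * (S⁻¹)ᴴ) * A * (S⁻¹ * S) := by rw [e1, e4]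
      _ = _ := by simp only [Matrix.mul_assoc]
  rw [hA2, log_det_conj hQp hS]
  have h1 : (1 - Q).PosSemidef := by
    have : 1 - Q = (S⁻¹)ᴴ * (Sᴴ * S - A) * S⁻¹ := by
      rw [Matrix.mul_sub, Matrix.sub_mul, ← hQ, ← Matrix.mul_assoc, e3, Matrix.one_mul, e2]
    rw [this]
    exact hAB.conjTranspose_mul_mul_same _
  have h2 : ∑ i, ((Q i i).re - 1) ≤ 0 := by
    refine Finset.sum_nonpos fun i _ => ?_
    have := (Complex.le_def.1 (h1.diag_nonneg (i := i))).1
    simp at this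
    linarith
  linarith [log_det_le_sum_diag hQp]

end LogDetEstimates

section LeadingMinors

variable {m : ℕ}

/-- The `k`-th leading principal block. -/
def leadBlock (P : Matrix (Fin m) (Fin m) ℂ) (k : ℕ) :
    Matrix {i : Fin m // i.val < k} {i : Fin m // i.val < k} ℂ :=
  P.submatrix Subtype.val Subtype.val

/-- The logarithm of the `k`-th leading principal minor. -/
def logMinor (P : Matrix (Fin m) (Fin m) ℂ) (k : ℕ) : ℝ :=
  Real.log (leadBlock P k).det.re

/-- The weighted sum of logarithms of ratios of consecutive leading principal minors. -/
def flagLog (w : Fin m → ℝ) (P : Matrix (Fin m) (Fin m) ℂ) : ℝ :=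
  ∑ i, w i * (logMinor P (i + 1) - logMinor P i)

theorem abel_nonneg : ∀ {m : ℕ} {w : Fin m → ℝ} (_ : Antitone w) (_ : ∀ i, 0 ≤ w i)
    {y : ℕ → ℝ} (_ : y 0 = 0) (_ : ∀ k, 0 ≤ y k),
    0 ≤ ∑ i : Fin m, w i * (y (i + 1) - y i)
  | 0, _, _, _, _, _, _ => by simp
  | m + 1, w, hw, hw0, y, hy0, hy => by
    suffices h : ∀ (m : ℕ) (w : Fin (m + 1) → ℝ), Antitone w →
        w (Fin.last m) * y (m + 1) ≤ ∑ i : Fin (m + 1), w i * (y (i + 1) - y i) from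
      (mul_nonneg (hw0 _) (hy _)).trans (h m w hw)
    intro m
    induction m with
    | zero => intro w _; simp [hy0]
    | succ m ih =>
      intro w hw
      rw [Fin.sum_univ_castSucc]
      have h1 := ih (fun i => w i.castSucc) fun i j hij => hw (by simpa using hij)
      have h2 : w (Fin.last (m + 1)) ≤ w (Fin.last m).castSucc := hw (Fin.le_last _)
      have h3 := mul_le_mul_of_nonneg_right h2 (hy (m + 1))
      simp only [Fin.val_castSucc, Fin.val_last] at *
      nlinarith

theorem logMinor_zero (P : Matrix (Fin m) (Fin m) ℂ) : logMinor P 0 = 0 := by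
  have : IsEmpty {i : Fin m // i.val < 0} := ⟨fun i => absurd i.2 (by simp)⟩
  simp [logMinor]

theorem sum_lead_succ (c : Fin m → ℝ) (i : Fin m) :
    ∑ j : {j : Fin m // j.val < i.val + 1}, c j = (∑ j : {j : Fin m // j.val < i.val}, c j) + c i
      := by
  rw [← Finset.sum_subtype (Finset.univ.filter fun j : Fin m => j.val < i.val + 1) (by simp) c,
    ← Finset.sum_subtype (Finset.univ.filter fun j : Fin m => j.val < i.val) (by simp) c]
  have : (Finset.univ.filter fun j : Fin m => j.val < i.val + 1) =
      insert i (Finset.univ.filter fun j : Fin m => j.val < i.val) := by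
    ext j
    simp [Fin.ext_iff]
    omega
  rw [this, Finset.sum_insert (by simp), add_comm]

theorem sum_lead_zero (c : Fin m → ℝ) : ∑ j : {j : Fin m // j.val < 0}, c j = 0 := by
  have : IsEmpty {i : Fin m // i.val < 0} := ⟨fun i => absurd i.2 (by simp)⟩
  simp

theorem flagLog_le_add {w : Fin m → ℝ} (hw : Antitone w) (hw0 : ∀ i, 0 ≤ w i)
    {P Q : Matrix (Fin m) (Fin m) ℂ} (c : Fin m → ℝ)
    (h : ∀ k, logMinor P k ≤ logMinor Q k + ∑ j : {j : Fin m // j.val < k}, c j) :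
    flagLog w P ≤ flagLog w Q + ∑ i, w i * c i := by
  have := abel_nonneg hw hw0
    (y := fun k => logMinor Q k + (∑ j : {j : Fin m // j.val < k}, c j) - logMinor P k)
    (by simp [logMinor_zero, sum_lead_zero]) fun k => by linarith [h k]
  simp only [sum_lead_succ] at this
  rw [← sub_nonneg, flagLog, flagLog, ← Finset.sum_add_distrib, ← Finset.sum_sub_distrib]
  refine this.trans (le_of_eq (Finset.sum_congr rfl fun i _ => ?_))
  ring

theorem flagLog_le_sum {w : Fin m → ℝ} (hw : Antitone w) (hw0 : ∀ i, 0 ≤ w i)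
    {P : Matrix (Fin m) (Fin m) ℂ} (c : Fin m → ℝ)
    (h : ∀ k, logMinor P k ≤ ∑ j : {j : Fin m // j.val < k}, c j) :
    flagLog w P ≤ ∑ i, w i * c i := by
  have := flagLog_le_add hw hw0 (P := P) (Q := 1) c (fun k => by
    simpa [logMinor, leadBlock, submatrix_one _ Subtype.val_injective] using h k)
  simpa [flagLog, logMinor, leadBlock, submatrix_one _ Subtype.val_injective] using this

theorem sum_le_flagLog {w : Fin m → ℝ} (hw : Antitone w) (hw0 : ∀ i, 0 ≤ w i)
    {P : Matrix (Fin m) (Fin m) ℂ} (c : Fin m → ℝ)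
    (h : ∀ k, ∑ j : {j : Fin m // j.val < k}, c j ≤ logMinor P k) :
    ∑ i, w i * c i ≤ flagLog w P := by
  have := flagLog_le_add hw hw0 (P := 1) (Q := P) (-c) (fun k => by
    simpa [logMinor, leadBlock, submatrix_one _ Subtype.val_injective] using h k)
  simp [flagLog, logMinor, leadBlock, submatrix_one _ Subtype.val_injective] at this
  simpa [flagLog, logMinor, leadBlock] using this

theorem Matrix.PosDef.leadBlock {P : Matrix (Fin m) (Fin m) ℂ} (hP : P.PosDef) (k : ℕ) :
    (leadBlock P k).PosDef :=
  hP.submatrix Subtype.val_injective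

theorem flagLog_mono {w : Fin m → ℝ} (hw : Antitone w) (hw0 : ∀ i, 0 ≤ w i)
    {P Q : Matrix (Fin m) (Fin m) ℂ} (hP : P.PosDef) (hQ : Q.PosDef) (h : (Q - P).PosSemidef) :
    flagLog w P ≤ flagLog w Q := by
  have := flagLog_le_add hw hw0 (P := P) (Q := Q) 0 fun k => by
    simpa [logMinor] using log_det_mono (hP.leadBlock k) (hQ.leadBlock k) (h.submatrix Subtype.val)
  simpa using this

theorem flagLog_le_diag {w : Fin m → ℝ} (hw : Antitone w) (hw0 : ∀ i, 0 ≤ w i)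
    {P : Matrix (Fin m) (Fin m) ℂ} (hP : P.PosDef) :
    flagLog w P ≤ ∑ i, w i * ((P i i).re - 1) :=
  flagLog_le_sum hw hw0 _ fun k => log_det_le_sum_diag (hP.leadBlock k)

theorem leadBlock_mul_of_upper {P R : Matrix (Fin m) (Fin m) ℂ}
    (hR : ∀ i j, j < i → R i j = 0) (k : ℕ) :
    leadBlock (P * R) k = leadBlock P k * leadBlock R k := by
  ext i j
  simp only [leadBlock, submatrix_apply, mul_apply]
  symm
  rw [← Finset.sum_subtype (Finset.univ.filter fun l : Fin m => l.val < k) (by simp)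
    (fun l => P i l * R l j)]
  refine Finset.sum_subset (Finset.filter_subset _ _) fun l _ hl => ?_
  rw [hR l j, mul_zero]
  have := j.2
  simp at hl
  exact Fin.lt_def.2 (by omega)

theorem leadBlock_conjTranspose (P : Matrix (Fin m) (Fin m) ℂ) (k : ℕ) :
    leadBlock Pᴴ k = (leadBlock P k)ᴴ := rfl

theorem leadBlock_conj_of_upper {P R : Matrix (Fin m) (Fin m) ℂ}
    (hR : ∀ i j, j < i → R i j = 0) (k : ℕ) :
    leadBlock (Rᴴ * P * R) k = (leadBlock R k)ᴴ * leadBlock P k * leadBlock R k := by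
  rw [leadBlock_mul_of_upper hR]
  congr 1
  rw [← conjTranspose_conjTranspose (Rᴴ * P), leadBlock_conjTranspose, conjTranspose_mul,
    conjTranspose_conjTranspose, leadBlock_mul_of_upper hR, conjTranspose_mul,
    leadBlock_conjTranspose, conjTranspose_conjTranspose]

theorem isUnit_det_leadBlock_of_upper {R : Matrix (Fin m) (Fin m) ℂ}
    (hR : ∀ i j, j < i → R i j = 0) (hu : IsUnit R.det) (k : ℕ) :
    IsUnit (leadBlock R k).det := by
  rw [det_of_isUpperTriangular (M := R) (fun i j h => hR i j h), isUnit_iff_ne_zero,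
    Finset.prod_ne_zero_iff] at hu
  rw [det_of_isUpperTriangular (M := leadBlock R k) (fun i j h => hR _ _ h), isUnit_iff_ne_zero,
    Finset.prod_ne_zero_iff]
  exact fun i _ => hu i.1 (Finset.mem_univ _)

theorem logMinor_conj {P R : Matrix (Fin m) (Fin m) ℂ} (hP : P.PosDef)
    (hR : ∀ i j, j < i → R i j = 0) (hu : IsUnit R.det) (k : ℕ) :
    logMinor (Rᴴ * P * R) k = logMinor P k + logMinor (Rᴴ * R) k := by
  have h := leadBlock_conj_of_upper (P := 1) hR k
  rw [Matrix.mul_one] at h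
  have h1 : leadBlock (1 : Matrix (Fin m) (Fin m) ℂ) k = 1 :=
    submatrix_one _ Subtype.val_injective
  rw [h1, Matrix.mul_one] at h
  rw [logMinor, logMinor, logMinor, leadBlock_conj_of_upper hR, h]
  exact log_det_conj (hP.leadBlock k) (isUnit_det_leadBlock_of_upper hR hu k)

theorem flagLog_conj (w : Fin m → ℝ) {P R : Matrix (Fin m) (Fin m) ℂ} (hP : P.PosDef)
    (hR : ∀ i j, j < i → R i j = 0) (hu : IsUnit R.det) :
    flagLog w (Rᴴ * P * R) = flagLog w P + flagLog w (Rᴴ * R) := by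
  simp only [flagLog, logMinor_conj hP hR hu, ← Finset.sum_add_distrib]
  exact Finset.sum_congr rfl fun i _ => by ring

theorem flagLog_smul (w : Fin m → ℝ) {P : Matrix (Fin m) (Fin m) ℂ} (hP : P.PosDef)
    {c : ℝ} (hc : 0 < c) :
    flagLog w ((c : ℂ) • P) = flagLog w P + (∑ i, w i) * Real.log c := by
  have h : ∀ k, logMinor ((c : ℂ) • P) k =
      logMinor P k + ∑ _j : {j : Fin m // j.val < k}, Real.log c := by
    intro k
    have : leadBlock ((c : ℂ) • P) k = (c : ℂ) • leadBlock P k := rfl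
    rw [logMinor, this, det_smul, ← Complex.ofReal_pow, Complex.re_ofReal_mul,
      Real.log_mul (pow_pos hc _).ne' (hP.leadBlock k).det_re_pos.ne', Real.log_pow, logMinor]
    simp [add_comm]
  simp only [flagLog, h, sum_lead_succ (fun _ => Real.log c), Finset.sum_mul,
    ← Finset.sum_add_distrib]
  exact Finset.sum_congr rfl fun i _ => by ring

end LeadingMinors

section Trace

variable {n N : Type*} [Fintype n] [Fintype N]

theorem rtr_sub (A B : Matrix n n ℂ) : rtr (A - B) = rtr A - rtr B := by simp [rtr]

theorem rtr_neg (A : Matrix n n ℂ) : rtr (-A) = -rtr A := by simp [rtr]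

theorem rtr_mul_comm (A : Matrix n N ℂ) (B : Matrix N n ℂ) : rtr (A * B) = rtr (B * A) := by
  rw [rtr, trace_mul_comm, rtr]

theorem rtr_smul (c : ℝ) (A : Matrix n n ℂ) : rtr ((c : ℂ) • A) = c * rtr A := by
  simp [rtr, trace_smul]

theorem rtr_eq_sum (A : Matrix n n ℂ) : rtr A = ∑ i, (A i i).re := by simp [rtr, trace]

variable [DecidableEq n] [DecidableEq N]

theorem rtr_mul_frame (M : Matrix N N ℂ) (U : Matrix N n ℂ) (w : n → ℝ) :
    rtr (M * (U * diagonal (fun i => (w i : ℂ)) * Uᴴ)) = ∑ i, w i * ((Uᴴ * M * U) i i).re := by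
  rw [← Matrix.mul_assoc, rtr_mul_comm, ← Matrix.mul_assoc, ← Matrix.mul_assoc, rtr_eq_sum]
  refine Finset.sum_congr rfl fun i _ => ?_
  rw [mul_diagonal, mul_comm, Complex.re_ofReal_mul]

theorem rtr_mul_frame_nonneg {M : Matrix N N ℂ} (hM : M.PosSemidef) (U : Matrix N n ℂ)
    {w : n → ℝ} (hw : ∀ i, 0 ≤ w i) :
    0 ≤ rtr (M * (U * diagonal (fun i => (w i : ℂ)) * Uᴴ)) := by
  rw [rtr_mul_frame]
  exact Finset.sum_nonneg fun i _ => mul_nonneg (hw i)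
    (Complex.le_def.1 ((hM.conjTranspose_mul_mul_same U).diag_nonneg (i := i))).1

theorem conj_diagonal_apply_re (T : Matrix N n ℂ) (c : N → ℝ) (i : n) :
    ((Tᴴ * diagonal (fun j => (c j : ℂ)) * T) i i).re = ∑ j, Complex.normSq (T j i) * c j := by
  rw [mul_apply, Complex.re_sum]
  refine Finset.sum_congr rfl fun j _ => ?_
  rw [mul_diagonal, conjTranspose_apply, mul_right_comm, Complex.star_def,
    ← Complex.normSq_eq_conj_mul_self, ← Complex.ofReal_mul, Complex.ofReal_re]

theorem sum_normSq_of_isometry {T : Matrix N n ℂ} (hT : Tᴴ * T = 1) (i : n) :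
    ∑ j, Complex.normSq (T j i) = 1 := by
  have := conj_diagonal_apply_re T (fun _ => 1) i
  simp [hT] at this
  exact this.symm

theorem Matrix.PosDef.isometry_conj {M : Matrix N N ℂ} (hM : M.PosDef) {U : Matrix N n ℂ}
    (hU : Uᴴ * U = 1) : (Uᴴ * M * U).PosDef :=
  hM.conjTranspose_mul_mul_same
    (Function.LeftInverse.injective (g := Uᴴ.mulVec) fun x => by simp [hU])

theorem posDef_diagonal_ofReal {d : n → ℝ} (hd : ∀ i, 0 < d i) :
    (diagonal (fun i => (d i : ℂ))).PosDef :=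
  PosDef.diagonal fun i => by simpa using hd i

end Trace

section Peierls

variable {N : Type*} [Fintype N] [DecidableEq N]

theorem sum_log_le_log_det {n : Type*} [Fintype n] [DecidableEq n] {S : Matrix N n ℂ}
    (hS : Sᴴ * S = 1) {θ : N → ℝ} (hθ : ∀ j, 0 < θ j) :
    ∑ i, ∑ j, Complex.normSq (S j i) * Real.log (θ j) ≤
      Real.log (Sᴴ * diagonal (fun j => (θ j : ℂ)) * S).det.re := by
  obtain ⟨Q, a, hQ1, hQ2, ha, hA⟩ :=
    ((posDef_diagonal_ofReal hθ).isometry_conj hS).exists_diagonalization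
  have hT : (S * Q)ᴴ * (S * Q) = 1 := by
    rw [conjTranspose_mul, Matrix.mul_assoc, ← Matrix.mul_assoc Sᴴ, hS, Matrix.one_mul, hQ1]
  have hdet : (Sᴴ * diagonal (fun j => (θ j : ℂ)) * S).det.re = ∏ i, a i := by
    rw [hA, det_mul, det_mul, mul_right_comm, ← det_mul, hQ2, det_one, one_mul, det_diagonal]
    norm_cast
  have ha' : ∀ i, ∑ j, Complex.normSq ((S * Q) j i) * θ j = a i := by
    intro i
    rw [← conj_diagonal_apply_re]
    have : (S * Q)ᴴ * diagonal (fun j => (θ j : ℂ)) * (S * Q) =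
        diagonal (fun i => (a i : ℂ)) := by
      calc _ = Qᴴ * (Sᴴ * diagonal (fun j => (θ j : ℂ)) * S) * Q := by
            simp only [conjTranspose_mul, Matrix.mul_assoc]
        _ = (Qᴴ * Q) * diagonal (fun i => (a i : ℂ)) * (Qᴴ * Q) := by
            rw [hA]; simp only [Matrix.mul_assoc]
        _ = _ := by rw [hQ1, Matrix.one_mul, Matrix.mul_one]
    rw [this]
    simp
  rw [hdet, Real.log_prod fun i _ => (ha i).ne']
  have hrow : ∀ (S : Matrix N n ℂ), ∑ i, ∑ j, Complex.normSq (S j i) * Real.log (θ j) =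
      ∑ j, ((S * Sᴴ) j j).re * Real.log (θ j) := by
    intro S
    rw [Finset.sum_comm]
    refine Finset.sum_congr rfl fun j _ => ?_
    rw [← Finset.sum_mul, mul_apply, Complex.re_sum]
    congr 1
    exact Finset.sum_congr rfl fun i _ => by
      rw [conjTranspose_apply, Complex.star_def, Complex.mul_conj, Complex.ofReal_re]
  have hSQ : S * Sᴴ = (S * Q) * (S * Q)ᴴ := by
    rw [conjTranspose_mul, Matrix.mul_assoc, ← Matrix.mul_assoc Q, hQ2, Matrix.one_mul]
  rw [hrow, hSQ, ← hrow]
  refine Finset.sum_le_sum fun i _ => ?_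
  rw [← ha' i]
  have := strictConcaveOn_log_Ioi.concaveOn.le_map_sum (t := Finset.univ)
    (w := fun j => Complex.normSq ((S * Q) j i)) (p := θ)
    (fun j _ => Complex.normSq_nonneg _) (sum_normSq_of_isometry hT i) (fun j _ => hθ j)
  simpa using this

variable {m : ℕ}

theorem peierls {w : Fin m → ℝ} (hw : Antitone w) (hw0 : ∀ i, 0 ≤ w i) {S : Matrix N (Fin m) ℂ}
    (hS : Sᴴ * S = 1) {W : Matrix N N ℂ} (hW : W * Wᴴ = 1) {θ : N → ℝ} (hθ : ∀ j, 0 < θ j) :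
    rtr (W * diagonal (fun j => (Real.log (θ j) : ℂ)) * Wᴴ *
        (S * diagonal (fun i => (w i : ℂ)) * Sᴴ)) ≤
      flagLog w (Sᴴ * (W * diagonal (fun j => (θ j : ℂ)) * Wᴴ) * S) := by
  have hT : (Wᴴ * S)ᴴ * (Wᴴ * S) = 1 := by
    rw [conjTranspose_mul, conjTranspose_conjTranspose, Matrix.mul_assoc, ← Matrix.mul_assoc W,
      hW, Matrix.one_mul, hS]
  have hc : ∀ c : N → ℝ, Sᴴ * (W * diagonal (fun j => (c j : ℂ)) * Wᴴ) * S =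
      (Wᴴ * S)ᴴ * diagonal (fun j => (c j : ℂ)) * (Wᴴ * S) := by
    intro c
    simp only [conjTranspose_mul, conjTranspose_conjTranspose, Matrix.mul_assoc]
  rw [rtr_mul_frame, hc, hc θ]
  simp only [conj_diagonal_apply_re]
  refine sum_le_flagLog hw hw0 _ fun k => ?_
  have hk : ((Wᴴ * S).submatrix id (Subtype.val : {i : Fin m // i.val < k} → Fin m))ᴴ *
      (Wᴴ * S).submatrix id (Subtype.val : {i : Fin m // i.val < k} → Fin m) = 1 := by
    rw [conjTranspose_submatrix, ← submatrix_mul _ _ _ id _ Function.bijective_id, hT,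
      submatrix_one _ Subtype.val_injective]
  refine (sum_log_le_log_det hk hθ).trans (le_of_eq ?_)
  rw [logMinor, leadBlock, submatrix_mul _ _ _ id _ Function.bijective_id,
    submatrix_mul _ _ _ id _ Function.bijective_id]
  rfl

theorem inv_of_diagonalization {W : Matrix N N ℂ} (hW : Wᴴ * W = 1) (hW' : W * Wᴴ = 1) {θ : N → ℝ}
    (hθ : ∀ j, θ j ≠ 0) :
    (W * diagonal (fun j => (θ j : ℂ)) * Wᴴ)⁻¹ =
      W * diagonal (fun j => (((θ j)⁻¹ : ℝ) : ℂ)) * Wᴴ := by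
  refine inv_eq_right_inv ?_
  calc _ = W * (diagonal (fun j => (θ j : ℂ)) * (Wᴴ * W) *
        diagonal (fun j => (((θ j)⁻¹ : ℝ) : ℂ))) * Wᴴ := by simp only [Matrix.mul_assoc]
    _ = 1 := by
      rw [hW, Matrix.mul_one, diagonal_mul_diagonal]
      have : (fun j => (θ j : ℂ) * (((θ j)⁻¹ : ℝ) : ℂ)) = fun _ => 1 := by
        ext j
        rw [← Complex.ofReal_mul, mul_inv_cancel₀ (hθ j), Complex.ofReal_one]
      rw [this, diagonal_one, Matrix.mul_one, hW']

theorem peierls_inv {w : Fin m → ℝ} (hw : Antitone w) (hw0 : ∀ i, 0 ≤ w i)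
    {S : Matrix N (Fin m) ℂ} (hS : Sᴴ * S = 1) {W : Matrix N N ℂ} (hW' : Wᴴ * W = 1)
    (hW : W * Wᴴ = 1) {θ : N → ℝ} (hθ : ∀ j, 0 < θ j) :
    -rtr (W * diagonal (fun j => (Real.log (θ j) : ℂ)) * Wᴴ *
        (S * diagonal (fun i => (w i : ℂ)) * Sᴴ)) ≤
      flagLog w (Sᴴ * (W * diagonal (fun j => (θ j : ℂ)) * Wᴴ)⁻¹ * S) := by
  rw [inv_of_diagonalization hW' hW fun j => (hθ j).ne']
  refine le_trans (le_of_eq ?_) (peierls hw hw0 hS hW fun j => inv_pos.2 (hθ j))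
  rw [← rtr_neg]
  have : diagonal (fun j => (Real.log ((θ j)⁻¹) : ℂ)) =
      -diagonal (fun j => (Real.log (θ j) : ℂ)) := by
    ext i j
    by_cases h : i = j <;> simp [h, Real.log_inv]
  simp only [this, Matrix.mul_neg, Matrix.neg_mul]

end Peierls

section Frames

variable {N : Type*} [Fintype N] [DecidableEq N] {m : ℕ}

theorem Matrix.PosDef.exists_upper {P : Matrix (Fin m) (Fin m) ℂ} (hP : P.PosDef) :
    ∃ R : Matrix (Fin m) (Fin m) ℂ, (∀ i j, j < i → R i j = 0) ∧ IsUnit R.det ∧ P = Rᴴ * R := by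
  have hu : IsUnit (LDL.lowerInv hP).det :=
    (isUnit_iff_isUnit_det _).1 (isUnit_of_invertible _)
  have hd : (LDL.diag hP).PosDef := by
    rw [LDL.diag_eq_lowerInv_conj]
    have := hP.conj (S := (LDL.lowerInv hP)ᴴ) (by simpa [det_conjTranspose] using hu)
    simpa using this
  have hd' : ∀ i, 0 < LDL.diagEntries hP i := fun i => by
    simpa [LDL.diag] using hd.diag_pos (i := i)
  set s : Fin m → ℝ := fun i => Real.sqrt (LDL.diagEntries hP i).re
  have hs : ∀ i, 0 < s i := fun i => Real.sqrt_pos.2 (Complex.pos_iff.1 (hd' i)).1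
  have hss : diagonal (fun i => (s i : ℂ)) * diagonal (fun i => (s i : ℂ)) = LDL.diag hP := by
    rw [diagonal_mul_diagonal, LDL.diag]
    congr 1
    ext i
    rw [← Complex.ofReal_mul, Real.mul_self_sqrt (Complex.pos_iff.1 (hd' i)).1.le]
    exact Complex.ext rfl (by simpa using (Complex.pos_iff.1 (hd' i)).2)
  have hlow : ∀ i j, i < j → LDL.lower hP i j = 0 := by
    have h1 : (LDL.lowerInv hP).BlockTriangular OrderDual.toDual := fun i j h =>
      LDL.lowerInv_triangular hP (by simpa using h)
    have h2 := blockTriangular_inv_of_blockTriangular h1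
    exact fun i j h => h2 (by simpa using h)
  have hlu : IsUnit (LDL.lower hP).det := by
    rw [LDL.lower]
    exact (isUnit_nonsing_inv_det_iff).2 hu
  refine ⟨diagonal (fun i => (s i : ℂ)) * (LDL.lower hP)ᴴ, fun i j h => ?_, ?_, ?_⟩
  · rw [diagonal_mul, conjTranspose_apply, hlow j i h, star_zero, mul_zero]
  · rw [det_mul, det_diagonal, det_conjTranspose]
    refine IsUnit.mul (isUnit_iff_ne_zero.2 (Finset.prod_ne_zero_iff.2 fun i _ => ?_)) hlu.star
    exact_mod_cast (hs i).ne'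
  · rw [conjTranspose_mul, conjTranspose_conjTranspose, diagonal_conjTranspose]
    have : (star fun i => (s i : ℂ)) = fun i => (s i : ℂ) := by ext i; simp
    rw [this, Matrix.mul_assoc, ← Matrix.mul_assoc (diagonal _), hss, ← Matrix.mul_assoc,
      LDL.lower_conj_diag]

theorem exists_isometry_mul_upper {A : Matrix N (Fin m) ℂ} (hA : (Aᴴ * A).PosDef) :
    ∃ (U : Matrix N (Fin m) ℂ) (R : Matrix (Fin m) (Fin m) ℂ), (∀ i j, j < i → R i j = 0) ∧
      IsUnit R.det ∧ Uᴴ * U = 1 ∧ A = U * R := by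
  obtain ⟨R, hR, hu, h⟩ := hA.exists_upper
  have hu' : IsUnit (Rᴴ).det := by simpa [det_conjTranspose] using hu
  refine ⟨A * R⁻¹, R, hR, hu, ?_, ?_⟩
  · rw [conjTranspose_mul, Matrix.mul_assoc, ← Matrix.mul_assoc Aᴴ, h, Matrix.mul_assoc,
      mul_nonsing_inv _ hu, Matrix.mul_one, conjTranspose_nonsing_inv, nonsing_inv_mul _ hu']
  · rw [Matrix.mul_assoc, nonsing_inv_mul _ hu, Matrix.mul_one]

theorem flagLog_conj_frame_le {w : Fin m → ℝ} (hw : Antitone w) (hw0 : ∀ i, 0 ≤ w i)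
    {U : Matrix N (Fin m) ℂ} {R : Matrix (Fin m) (Fin m) ℂ} (hR : ∀ i j, j < i → R i j = 0)
    (hu : IsUnit R.det) (hU : Uᴴ * U = 1) {M : Matrix N N ℂ} (hM : M.PosDef) :
    flagLog w ((U * R)ᴴ * M * (U * R)) ≤ flagLog w ((U * R)ᴴ * (U * R)) +
      rtr ((M - 1) * (U * diagonal (fun i => (w i : ℂ)) * Uᴴ)) := by
  have h1 : (U * R)ᴴ * M * (U * R) = Rᴴ * (Uᴴ * M * U) * R := by
    simp only [conjTranspose_mul, Matrix.mul_assoc]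
  have h2 : (U * R)ᴴ * (U * R) = Rᴴ * R := by
    rw [conjTranspose_mul, Matrix.mul_assoc, ← Matrix.mul_assoc Uᴴ, hU, Matrix.one_mul]
  have h3 := flagLog_le_diag hw hw0 (hM.isometry_conj hU)
  rw [h1, h2, flagLog_conj w (hM.isometry_conj hU) hR hu, rtr_mul_frame]
  have h4 : Uᴴ * (M - 1) * U = Uᴴ * M * U - 1 := by
    rw [Matrix.mul_sub, Matrix.sub_mul, Matrix.mul_one, hU]
  simp only [h4, Matrix.sub_apply, one_apply_eq, Complex.sub_re, Complex.one_re]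
  linarith

end Frames

section Perturbation

variable {N : Type*} [Fintype N] [DecidableEq N]

theorem rtr_sq_of_diagonalization {W : Matrix N N ℂ} (hW : Wᴴ * W = 1) (d : N → ℝ) :
    rtr ((W * diagonal (fun i => (d i : ℂ)) * Wᴴ) * (W * diagonal (fun i => (d i : ℂ)) * Wᴴ)) =
      ∑ i, d i ^ 2 := by
  have : (W * diagonal (fun i => (d i : ℂ)) * Wᴴ) * (W * diagonal (fun i => (d i : ℂ)) * Wᴴ) =
      W * (diagonal (fun i => (d i : ℂ)) * (Wᴴ * W) * diagonal (fun i => (d i : ℂ)) * Wᴴ) := by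
    simp only [Matrix.mul_assoc]
  rw [this, rtr_mul_comm, hW, Matrix.mul_one, Matrix.mul_assoc, hW, Matrix.mul_one,
    diagonal_mul_diagonal, rtr_eq_sum]
  simp [pow_two]

theorem rtr_sq_nonneg {ξ : Matrix N N ℂ} (hξ : ξ.IsHermitian) : 0 ≤ rtr (ξ * ξ) := by
  obtain ⟨W, d, h1, h2, rfl⟩ := hξ.exists_diagonalization
  rw [rtr_sq_of_diagonalization h1]
  positivity

theorem one_add_perturbation {ξ : Matrix N N ℂ} (hξ : ξ.IsHermitian) (ht : rtr (ξ * ξ) ≤ 1 / 4) :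
    (1 + ξ).PosDef ∧ ((2 * rtr (ξ * ξ) : ℝ) • (1 : Matrix N N ℂ) - ξ -
      ((1 + ξ)⁻¹ - 1)).PosSemidef := by
  obtain ⟨W, d, h1, h2, rfl⟩ := hξ.exists_diagonalization
  rw [rtr_sq_of_diagonalization h1] at ht ⊢
  set t := ∑ i, d i ^ 2 with htdef
  have hd : ∀ i, d i ^ 2 ≤ t := fun i =>
    Finset.single_le_sum (f := fun i => d i ^ 2) (fun _ _ => sq_nonneg _) (Finset.mem_univ i)
  have hd' : ∀ i, -(1 / 2) ≤ d i := fun i => by nlinarith [hd i]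
  have e : ∀ (x y : N → ℝ), W * diagonal (fun i => (x i : ℂ)) * Wᴴ +
      W * diagonal (fun i => (y i : ℂ)) * Wᴴ = W * diagonal (fun i => ((x i + y i : ℝ) : ℂ)) * Wᴴ
        := by
    intro x y
    rw [← Matrix.add_mul, ← Matrix.mul_add, diagonal_add]
    simp
  have e' : ∀ (x y : N → ℝ), W * diagonal (fun i => (x i : ℂ)) * Wᴴ -
      W * diagonal (fun i => (y i : ℂ)) * Wᴴ = W * diagonal (fun i => ((x i - y i : ℝ) : ℂ)) * Wᴴ
        := by
    intro x y
    rw [← Matrix.sub_mul, ← Matrix.mul_sub, diagonal_sub]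
    simp
  have e1 : (1 : Matrix N N ℂ) = W * diagonal (fun i => ((1 : ℝ) : ℂ)) * Wᴴ := by simp [h2]
  have e2 : (2 * t : ℝ) • (1 : Matrix N N ℂ) = W * diagonal (fun i => ((2 * t : ℝ) : ℂ)) * Wᴴ := by
    have : diagonal (fun _ : N => ((2 * t : ℝ) : ℂ)) = (2 * t : ℝ) • (1 : Matrix N N ℂ) := by
      ext i j
      by_cases h : i = j <;> simp [h]
    rw [this, Matrix.mul_smul, Matrix.smul_mul, Matrix.mul_one, h2]
  have e3 : 1 + W * diagonal (fun i => (d i : ℂ)) * Wᴴ =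
      W * diagonal (fun i => ((1 + d i : ℝ) : ℂ)) * Wᴴ := by
    conv_lhs => rw [e1]
    exact e (fun _ => 1) d
  have hpos : ∀ i, 0 < 1 + d i := fun i => by linarith [hd' i]
  constructor
  · rw [e3]
    have := (posDef_diagonal_ofReal hpos).isometry_conj (U := Wᴴ) (by simpa using h2)
    simpa using this
  · rw [e3, inv_of_diagonalization h1 h2 fun i => (hpos i).ne', e2]
    conv in (1 : Matrix N N ℂ) => rw [e1]
    rw [e' (fun i => (1 + d i)⁻¹) (fun _ => 1), e' (fun _ => 2 * t) d,
      e' (fun i => 2 * t - d i) (fun i => (1 + d i)⁻¹ - 1)]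
    have : (diagonal (fun i => ((2 * t - d i - ((1 + d i)⁻¹ - 1) : ℝ) : ℂ))).PosSemidef := by
      refine PosSemidef.diagonal fun i => ?_
      rw [Pi.zero_apply, Complex.zero_le_real]
      have h3 : (1 + d i)⁻¹ ≤ 1 - d i + 2 * d i ^ 2 := by
        rw [inv_le_iff_one_le_mul₀ (hpos i)]
        nlinarith [mul_nonneg (sq_nonneg (d i)) (by linarith [hd' i] : (0 : ℝ) ≤ 1 + 2 * d i)]
      linarith [hd i]
    simpa using this.conjTranspose_mul_mul_same Wᴴ

theorem descent {M : Matrix N N ℂ} (hM : M.IsHermitian) {C δ : ℝ} (hC : 0 ≤ C)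
    (hδ : 4 * δ * (2 + 2 * C) ≤ 1)
    (h : ∀ ξ : Matrix N N ℂ, ξ.IsHermitian → rtr (ξ * ξ) ≤ 1 / 4 →
      -δ ≤ rtr (ξ * M) + C * rtr (ξ * ξ)) :
    rtr (M * M) ≤ 4 * δ * (2 + 2 * C) := by
  have hf := rtr_sq_nonneg hM
  set f := rtr (M * M) with hfd
  set s := 1 / ((2 + 2 * C) * (1 + f)) with hs
  have hs0 : 0 < s := by positivity
  have hs1 : s * ((2 + 2 * C) * (1 + f)) = 1 := by rw [hs]; field_simp
  have e1 : rtr (((-s : ℝ) : ℂ) • M * ((-s : ℝ) : ℂ) • M) = s ^ 2 * f := by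
    rw [Matrix.smul_mul, Matrix.mul_smul, rtr_smul, rtr_smul]
    ring
  have e2 : rtr (((-s : ℝ) : ℂ) • M * M) = -s * f := by
    rw [Matrix.smul_mul, rtr_smul]
  have hsf : s * (1 + f) ≤ 1 / 2 := by nlinarith [mul_nonneg hs0.le hf, mul_nonneg hC (mul_nonneg
    hs0.le (by linarith : 0 ≤ 1 + f))]
  have hs2 : s ≤ 1 / 2 := by nlinarith [mul_nonneg hs0.le hf]
  have hCs : C * s ≤ 1 / 2 := by nlinarith [mul_nonneg hC (mul_nonneg hs0.le hf)]
  have := h (((-s : ℝ) : ℂ) • M) (by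
    rw [Matrix.IsHermitian, conjTranspose_smul, hM.eq, Complex.star_def, Complex.conj_ofReal])
    (by rw [e1]; nlinarith [mul_nonneg hs0.le hf])
  rw [e1, e2] at this
  have h1 : s * f ≤ 2 * δ := by nlinarith [mul_nonneg hs0.le hf]
  have h2 : f ≤ 2 * δ * ((2 + 2 * C) * (1 + f)) := by
    have := mul_le_mul_of_nonneg_right h1 (by positivity : 0 ≤ (2 + 2 * C) * (1 + f))
    nlinarith
  nlinarith

variable {m : ℕ} {w : Fin m → ℝ} {U : Matrix N (Fin m) ℂ} {R : Matrix (Fin m) (Fin m) ℂ}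
  {ξ : Matrix N N ℂ}

theorem flagLog_perturb (hw : Antitone w) (hw0 : ∀ i, 0 ≤ w i) (hR : ∀ i j, j < i → R i j = 0)
    (hu : IsUnit R.det) (hU : Uᴴ * U = 1) (hξ : ξ.IsHermitian) (ht : rtr (ξ * ξ) ≤ 1 / 4) :
    flagLog w ((U * R)ᴴ * (1 + ξ) * (U * R)) ≤ flagLog w ((U * R)ᴴ * (U * R)) +
      rtr (ξ * (U * diagonal (fun i => (w i : ℂ)) * Uᴴ)) := by
  have := flagLog_conj_frame_le hw hw0 hR hu hU (one_add_perturbation hξ ht).1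
  simpa using this

theorem flagLog_perturb_inv (hw : Antitone w) (hw0 : ∀ i, 0 ≤ w i)
    (hR : ∀ i j, j < i → R i j = 0)
    (hu : IsUnit R.det) (hU : Uᴴ * U = 1) (hξ : ξ.IsHermitian) (ht : rtr (ξ * ξ) ≤ 1 / 4) :
    flagLog w ((U * R)ᴴ * (1 + ξ)⁻¹ * (U * R)) ≤ flagLog w ((U * R)ᴴ * (U * R)) -
      rtr (ξ * (U * diagonal (fun i => (w i : ℂ)) * Uᴴ)) + 2 * (∑ i, w i) * rtr (ξ * ξ) := by
  have h0 := flagLog_conj_frame_le hw hw0 hR hu hU (one_add_perturbation hξ ht).1.inv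
  have h1 := rtr_mul_frame_nonneg (one_add_perturbation hξ ht).2 U hw0
  have h2 : rtr (((2 * rtr (ξ * ξ) : ℝ) • (1 : Matrix N N ℂ)) *
      (U * diagonal (fun i => (w i : ℂ)) * Uᴴ)) = 2 * (∑ i, w i) * rtr (ξ * ξ) := by
    rw [rtr_mul_frame, Matrix.mul_smul, Matrix.smul_mul, Matrix.mul_one, hU, Finset.mul_sum,
      Finset.sum_mul]
    refine Finset.sum_congr rfl fun i _ => ?_
    simp
    ring
  rw [Matrix.sub_mul, Matrix.sub_mul, rtr_sub, rtr_sub, h2] at h1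
  linarith

end Perturbation

section Compactness

theorem exists_approx_min {X : Type*} (P : X → Prop) (hP : ∃ x, P x) (J : X → ℝ) {C : ℝ}
    (hC : ∀ x, P x → C ≤ J x) {δ : ℝ} (hδ : 0 < δ) : ∃ x, P x ∧ ∀ y, P y → J x ≤ J y + δ := by
  have hb : BddBelow (J '' {x | P x}) := ⟨C, by rintro _ ⟨x, hx, rfl⟩; exact hC x hx⟩
  obtain ⟨x₀, hx₀⟩ := hP
  obtain ⟨_, ⟨x, hx, rfl⟩, hlt⟩ := exists_lt_of_csInf_lt (s := J '' {x | P x}) ⟨_, x₀, hx₀, rfl⟩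
    (lt_add_of_pos_right (sInf (J '' {x | P x})) hδ)
  exact ⟨x, hx, fun y hy => hlt.le.trans (by linarith [csInf_le hb ⟨y, hy, rfl⟩])⟩

theorem IsCompact.exists_le_zero {X : Type*} [TopologicalSpace X] {K : Set X} (hK : IsCompact K)
    {f : X → ℝ} (hf : Continuous f) (h : ∀ ε > 0, ∃ x ∈ K, f x ≤ ε) : ∃ x ∈ K, f x ≤ 0 := by
  obtain ⟨x₀, hx₀, -⟩ := h 1 one_pos
  obtain ⟨x, hx, hmin⟩ := hK.exists_isMinOn ⟨x₀, hx₀⟩ hf.continuousOn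
  refine ⟨x, hx, le_of_forall_pos_le_add fun ε hε => ?_⟩
  obtain ⟨y, hy, hle⟩ := h ε hε
  linarith [show f x ≤ f y from hmin hy]

variable {n N : Type*} [Fintype n] [Fintype N]

theorem rtr_conjTranspose_mul_self (A : Matrix N n ℂ) :
    rtr (Aᴴ * A) = ∑ i, ∑ j, Complex.normSq (A j i) := by
  rw [rtr_eq_sum]
  refine Finset.sum_congr rfl fun i _ => ?_
  rw [mul_apply, Complex.re_sum]
  refine Finset.sum_congr rfl fun j _ => ?_
  rw [conjTranspose_apply, Complex.star_def, ← Complex.normSq_eq_conj_mul_self, Complex.ofReal_re]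

theorem normSq_le_rtr (A : Matrix N n ℂ) (i : N) (j : n) :
    Complex.normSq (A i j) ≤ rtr (Aᴴ * A) := by
  rw [rtr_conjTranspose_mul_self]
  refine le_trans ?_ (Finset.single_le_sum (f := fun j => ∑ i, Complex.normSq (A i j))
    (fun _ _ => Finset.sum_nonneg fun _ _ => Complex.normSq_nonneg _) (Finset.mem_univ j))
  exact Finset.single_le_sum (f := fun i => Complex.normSq (A i j))
    (fun _ _ => Complex.normSq_nonneg _) (Finset.mem_univ i)

theorem rtr_conjTranspose_mul_self_nonneg (A : Matrix N n ℂ) : 0 ≤ rtr (Aᴴ * A) := by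
  rw [rtr_conjTranspose_mul_self]
  exact Finset.sum_nonneg fun _ _ => Finset.sum_nonneg fun _ _ => Complex.normSq_nonneg _

theorem eq_zero_of_rtr_nonpos {A : Matrix N n ℂ} (h : rtr (Aᴴ * A) ≤ 0) : A = 0 := by
  ext i j
  exact Complex.normSq_eq_zero.1 (((normSq_le_rtr A i j).trans h).antisymm
    (Complex.normSq_nonneg _))

theorem continuous_rtr : Continuous (rtr : Matrix n n ℂ → ℝ) :=
  Complex.continuous_re.comp continuous_id.matrix_trace

theorem isCompact_rtr_le (B : ℝ) : IsCompact {A : Matrix N n ℂ | rtr (Aᴴ * A) ≤ B} := by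
  have h : IsCompact (Set.univ.pi fun _ : N => Set.univ.pi fun _ : n =>
      Metric.closedBall (0 : ℂ) (Real.sqrt B)) :=
    isCompact_univ_pi fun _ => isCompact_univ_pi fun _ => isCompact_closedBall _ _
  refine h.of_isClosed_subset (isClosed_le ?_ continuous_const) fun A hA i _ j _ => ?_
  · exact continuous_rtr.comp (continuous_id.matrix_conjTranspose.matrix_mul continuous_id)
  · rw [mem_closedBall_zero_iff]
    refine Real.le_sqrt_of_sq_le ?_
    rw [← Complex.normSq_eq_norm_sq]
    exact (normSq_le_rtr A i j).trans hA

theorem isCompact_isometry [DecidableEq n] : IsCompact {U : Matrix N n ℂ | Uᴴ * U = 1} := by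
  refine (isCompact_rtr_le (rtr (1 : Matrix n n ℂ))).of_isClosed_subset
    (isClosed_eq (continuous_id.matrix_conjTranspose.matrix_mul continuous_id) continuous_const)
    fun U hU => ?_
  rw [Set.mem_ofPred_eq, show Uᴴ * U = 1 from hU]

theorem rtr_le_of_isHermitian [DecidableEq n] {M : Matrix n n ℂ} (hM : M.IsHermitian) :
    rtr M ≤ Fintype.card n + rtr (M * M) := by
  have h := rtr_conjTranspose_mul_self_nonneg (M - 1)
  rw [conjTranspose_sub, hM.eq, conjTranspose_one] at h
  have e : (M - 1) * (M - 1) = M * M - M - M + 1 := by noncomm_ring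
  have h1 : rtr (1 : Matrix n n ℂ) = Fintype.card n := by simp [rtr]
  rw [e, rtr_add, rtr_sub, rtr_sub, h1] at h
  have h2 := rtr_sq_nonneg hM
  have h3 : (0 : ℝ) ≤ Fintype.card n := by positivity
  linarith

end Compactness

section CompactSide

/-- The real diagonal matrix `diag w` conjugated by `U`. -/
def frameMat {n N : Type*} [Fintype n] [DecidableEq n] (U : Matrix N n ℂ) (w : n → ℝ) :
    Matrix N N ℂ :=
  U * diagonal (fun i => (w i : ℂ)) * Uᴴ

theorem frameMat_isHermitian {n N : Type*} [Fintype n] [DecidableEq n] (U : Matrix N n ℂ)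
    (w : n → ℝ) : (frameMat U w).IsHermitian := by
  have : (star fun i => (w i : ℂ)) = fun i => (w i : ℂ) := by ext i; simp
  rw [IsHermitian, frameMat, conjTranspose_mul, conjTranspose_mul, conjTranspose_conjTranspose,
    diagonal_conjTranspose, this, Matrix.mul_assoc]

theorem continuous_frameMat {n N : Type*} [Fintype n] [DecidableEq n] (w : n → ℝ) :
    Continuous fun U : Matrix N n ℂ => frameMat U w :=
  (continuous_id.matrix_mul continuous_const).matrix_mul continuous_id.matrix_conjTranspose

theorem rtr_frameMat {n N : Type*} [Fintype n] [DecidableEq n] [Fintype N] [DecidableEq N]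
    {U : Matrix N n ℂ} (hU : Uᴴ * U = 1) (w : n → ℝ) :
    rtr (frameMat U w) = ∑ i, w i := by
  have := rtr_mul_frame 1 U w
  simpa [hU, frameMat] using this

variable {m : ℕ} {a b c : Fin m → ℝ}

/-- The logarithmic potential attached to three weights on a space of matrices of size `m`. -/
def triplePot (a b c : Fin m → ℝ) (f₁ f₂ : Matrix (Fin m) (Fin m) ℂ)
    (α : Matrix (Fin m) (Fin m) ℂ) : ℝ :=
  flagLog a (f₁ᴴ * α * f₁) + flagLog b (f₂ᴴ * α * f₂) + flagLog c α⁻¹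

theorem posDef_conjTranspose_mul_self {n : Type*} [Fintype n] [DecidableEq n] {s : Matrix n n ℂ}
    (hs : IsUnit s.det) : (sᴴ * s).PosDef := by
  simpa using PosDef.one.conj hs

theorem exists_frames_of_approx_min (ha : Antitone a) (hb : Antitone b) (hc : Antitone c)
    (ha0 : ∀ i, 0 ≤ a i) (hb0 : ∀ i, 0 ≤ b i) (hc0 : ∀ i, 0 ≤ c i)
    {f₁ f₂ : Matrix (Fin m) (Fin m) ℂ} (hf₁ : IsUnit f₁.det) (hf₂ : IsUnit f₂.det)
    {Q : Matrix (Fin m) (Fin m) ℂ} (hQ : Q.IsHermitian) {δ : ℝ}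
    (hδ : 4 * δ * (2 + 2 * (2 * ∑ i, c i)) ≤ 1) {s : Matrix (Fin m) (Fin m) ℂ} (hs : IsUnit s.det)
    (hmin : ∀ α : Matrix (Fin m) (Fin m) ℂ, α.PosDef →
      triplePot a b c f₁ f₂ (sᴴ * s) + rtr (sᴴ * s * Q) ≤
        triplePot a b c f₁ f₂ α + rtr (α * Q) + δ) :
    ∃ U₁ U₂ U₃ : Matrix (Fin m) (Fin m) ℂ, U₁ᴴ * U₁ = 1 ∧ U₂ᴴ * U₂ = 1 ∧ U₃ᴴ * U₃ = 1 ∧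
      rtr ((frameMat U₁ a + frameMat U₂ b + s * Q * sᴴ - frameMat U₃ c)ᴴ *
        (frameMat U₁ a + frameMat U₂ b + s * Q * sᴴ - frameMat U₃ c)) ≤
        4 * δ * (2 + 2 * (2 * ∑ i, c i)) := by
  have hs' : IsUnit ((s⁻¹)ᴴ).det := by
    rw [det_conjTranspose]; exact ((isUnit_nonsing_inv_det_iff).2 hs).star
  have hu : ∀ {f : Matrix (Fin m) (Fin m) ℂ}, IsUnit f.det → IsUnit (s * f).det := fun h => by
    rw [det_mul]; exact hs.mul h
  obtain ⟨U₁, R₁, hR₁, hu₁, hU₁, e₁⟩ :=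
    exists_isometry_mul_upper (posDef_conjTranspose_mul_self (hu hf₁))
  obtain ⟨U₂, R₂, hR₂, hu₂, hU₂, e₂⟩ :=
    exists_isometry_mul_upper (posDef_conjTranspose_mul_self (hu hf₂))
  obtain ⟨U₃, R₃, hR₃, hu₃, hU₃, e₃⟩ :=
    exists_isometry_mul_upper (posDef_conjTranspose_mul_self hs')
  refine ⟨U₁, U₂, U₃, hU₁, hU₂, hU₃, ?_⟩
  have hM : (frameMat U₁ a + frameMat U₂ b + s * Q * sᴴ - frameMat U₃ c).IsHermitian :=
    (((frameMat_isHermitian U₁ a).add (frameMat_isHermitian U₂ b)).add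
      (isHermitian_mul_mul_conjTranspose s hQ)).sub (frameMat_isHermitian U₃ c)
  rw [hM.eq]
  refine descent hM (by have := Finset.sum_nonneg fun i (_ : i ∈ Finset.univ) => hc0 i
                        positivity) hδ fun ξ hξ ht => ?_
  have hp := (one_add_perturbation hξ ht).1
  have h0 := hmin (sᴴ * (1 + ξ) * s) (hp.conj hs)
  have hinv : ∀ X : Matrix (Fin m) (Fin m) ℂ, (sᴴ * X * s)⁻¹ = ((s⁻¹)ᴴ)ᴴ * X⁻¹ * (s⁻¹)ᴴ := by
    intro X
    rw [Matrix.mul_inv_rev, Matrix.mul_inv_rev, conjTranspose_conjTranspose,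
      conjTranspose_nonsing_inv,
      Matrix.mul_assoc]
  have k₁ := flagLog_perturb ha ha0 hR₁ hu₁ hU₁ hξ ht
  have k₂ := flagLog_perturb hb hb0 hR₂ hu₂ hU₂ hξ ht
  have k₃ := flagLog_perturb_inv hc hc0 hR₃ hu₃ hU₃ hξ ht
  rw [← e₁] at k₁
  rw [← e₂] at k₂
  rw [← e₃] at k₃
  have g₁ : ∀ f X : Matrix (Fin m) (Fin m) ℂ, fᴴ * (sᴴ * X * s) * f = (s * f)ᴴ * X * (s * f) := by
    intro f X
    simp only [conjTranspose_mul, Matrix.mul_assoc]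
  have g₂ : ∀ f : Matrix (Fin m) (Fin m) ℂ, fᴴ * (sᴴ * s) * f = (s * f)ᴴ * (s * f) := by
    intro f
    simp only [conjTranspose_mul, Matrix.mul_assoc]
  have g₃ : (sᴴ * s)⁻¹ = ((s⁻¹)ᴴ)ᴴ * (s⁻¹)ᴴ := by simpa using hinv 1
  have g₄ : rtr (sᴴ * (1 + ξ) * s * Q) = rtr (sᴴ * s * Q) + rtr (ξ * (s * Q * sᴴ)) := by
    rw [show ξ * (s * Q * sᴴ) = (ξ * s * Q) * sᴴ by simp only [Matrix.mul_assoc],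
      rtr_mul_comm (ξ * s * Q), ← rtr_add]
    simp only [Matrix.mul_add, Matrix.add_mul, Matrix.mul_one, Matrix.mul_assoc]
  simp only [triplePot, g₁, g₂, hinv, g₃, g₄] at h0
  simp only [frameMat, Matrix.mul_add, Matrix.mul_sub, rtr_add, rtr_sub]
  linarith

end CompactSide

section CompactEquation

variable {p q : ℕ} {lp mp np : Fin p → ℝ} {lm mm nm : Fin q → ℝ}

theorem exists_approx_compact_of_bounded (hlp : Antitone lp) (hmp : Antitone mp)
    (hnp : Antitone np) (hlm : Antitone lm) (hmm : Antitone mm) (hnm : Antitone nm)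
    (hlp0 : ∀ i, 0 ≤ lp i) (hmp0 : ∀ i, 0 ≤ mp i) (hnp0 : ∀ i, 0 ≤ np i)
    (hlm0 : ∀ i, 0 ≤ lm i) (hmm0 : ∀ i, 0 ≤ mm i) (hnm0 : ∀ i, 0 ≤ nm i)
    {f₁ f₂ : Matrix (Fin p) (Fin p) ℂ} {f₁' f₂' : Matrix (Fin q) (Fin q) ℂ}
    (hf₁ : IsUnit f₁.det) (hf₂ : IsUnit f₂.det) (hf₁' : IsUnit f₁'.det) (hf₂' : IsUnit f₂'.det)
    (Y : Matrix (Fin p) (Fin q) ℂ) (C : ℝ)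
    (hC : ∀ (α : Matrix (Fin p) (Fin p) ℂ) (γ : Matrix (Fin q) (Fin q) ℂ), α.PosDef → γ.PosDef →
      C ≤ triplePot lp mp np f₁ f₂ α + triplePot lm mm nm f₁' f₂' γ + rtr (α * (Y * γ * Yᴴ)))
    {ε : ℝ} (hε : 0 < ε) :
    ∃ (U₁ U₂ U₃ : Matrix (Fin p) (Fin p) ℂ) (V₁ V₂ V₃ : Matrix (Fin q) (Fin q) ℂ)
      (z : Matrix (Fin q) (Fin p) ℂ), U₁ᴴ * U₁ = 1 ∧ U₂ᴴ * U₂ = 1 ∧ U₃ᴴ * U₃ = 1 ∧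
      V₁ᴴ * V₁ = 1 ∧ V₂ᴴ * V₂ = 1 ∧ V₃ᴴ * V₃ = 1 ∧
      rtr ((frameMat U₁ lp + frameMat U₂ mp + zᴴ * z - frameMat U₃ np)ᴴ *
        (frameMat U₁ lp + frameMat U₂ mp + zᴴ * z - frameMat U₃ np)) ≤ min (ε / 2) 1 ∧
      rtr ((frameMat V₁ lm + frameMat V₂ mm + z * zᴴ - frameMat V₃ nm)ᴴ *
        (frameMat V₁ lm + frameMat V₂ mm + z * zᴴ - frameMat V₃ nm)) ≤ min (ε / 2) 1 := by
  have hn1 := Finset.sum_nonneg fun i (_ : i ∈ Finset.univ) => hnp0 i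
  have hn2 := Finset.sum_nonneg fun i (_ : i ∈ Finset.univ) => hnm0 i
  obtain ⟨δ, hδ0, hδ⟩ : ∃ δ > 0, 4 * δ * (2 + 2 * (2 * ((∑ i, np i) + ∑ i, nm i))) ≤
      min (ε / 2) 1 := by
    refine ⟨min (ε / 2) 1 / (4 * (2 + 2 * (2 * ((∑ i, np i) + ∑ i, nm i)))), by positivity,
      le_of_eq ?_⟩
    field_simp
  have hδ1 : 4 * δ * (2 + 2 * (2 * ∑ i, np i)) ≤ min (ε / 2) 1 := by nlinarith
  have hδ2 : 4 * δ * (2 + 2 * (2 * ∑ i, nm i)) ≤ min (ε / 2) 1 := by nlinarith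
  obtain ⟨⟨α, γ⟩, ⟨hα, hγ⟩, hmin⟩ := exists_approx_min
    (fun x : Matrix (Fin p) (Fin p) ℂ × Matrix (Fin q) (Fin q) ℂ => x.1.PosDef ∧ x.2.PosDef)
    ⟨(1, 1), PosDef.one, PosDef.one⟩
    (fun x => triplePot lp mp np f₁ f₂ x.1 + triplePot lm mm nm f₁' f₂' x.2 +
      rtr (x.1 * (Y * x.2 * Yᴴ))) (C := C) (fun x hx => hC _ _ hx.1 hx.2) hδ0
  simp only at hα hγ hmin
  obtain ⟨s, hs, rfl⟩ := hα.exists_conjTranspose_mul_self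
  obtain ⟨t, ht, rfl⟩ := hγ.exists_conjTranspose_mul_self
  obtain ⟨U₁, U₂, U₃, hU₁, hU₂, hU₃, hU⟩ := exists_frames_of_approx_min hlp hmp hnp hlp0 hmp0 hnp0
    hf₁ hf₂ (Q := Y * (tᴴ * t) * Yᴴ) (isHermitian_mul_mul_conjTranspose Y hγ.isHermitian)
    (hδ1.trans (min_le_right _ _)) hs (fun α hα => by
      have := hmin (α, tᴴ * t) ⟨hα, hγ⟩
      simp only at this
      linarith)
  obtain ⟨V₁, V₂, V₃, hV₁, hV₂, hV₃, hV⟩ := exists_frames_of_approx_min hlm hmm hnm hlm0 hmm0 hnm0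
    hf₁' hf₂' (Q := Yᴴ * (sᴴ * s) * Y)
    (isHermitian_conjTranspose_mul_mul Y hα.isHermitian)
    (hδ2.trans (min_le_right _ _)) ht (fun γ hγ' => by
      have := hmin (sᴴ * s, γ) ⟨hα, hγ'⟩
      have e : ∀ γ, rtr (sᴴ * s * (Y * γ * Yᴴ)) = rtr (γ * (Yᴴ * (sᴴ * s) * Y)) := by
        intro γ
        rw [show sᴴ * s * (Y * γ * Yᴴ) = (sᴴ * s * Y) * (γ * Yᴴ) by
          simp only [Matrix.mul_assoc], rtr_mul_comm]
        simp only [Matrix.mul_assoc]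
      simp only [e] at this
      linarith)
  have e₁ : s * (Y * (tᴴ * t) * Yᴴ) * sᴴ = (t * Yᴴ * sᴴ)ᴴ * (t * Yᴴ * sᴴ) := by
    simp only [conjTranspose_mul, conjTranspose_conjTranspose, Matrix.mul_assoc]
  have e₂ : t * (Yᴴ * (sᴴ * s) * Y) * tᴴ = (t * Yᴴ * sᴴ) * (t * Yᴴ * sᴴ)ᴴ := by
    simp only [conjTranspose_mul, conjTranspose_conjTranspose, Matrix.mul_assoc]
  rw [e₁] at hU
  rw [e₂] at hV
  exact ⟨U₁, U₂, U₃, V₁, V₂, V₃, t * Yᴴ * sᴴ, hU₁, hU₂, hU₃, hV₁, hV₂, hV₃, hU.trans hδ1,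
    hV.trans hδ2⟩

theorem exists_compact_of_approx (hlp0 : ∀ i, 0 ≤ lp i) (hmp0 : ∀ i, 0 ≤ mp i)
    (h : ∀ ε : ℝ, 0 < ε → ∃ (U₁ U₂ U₃ : Matrix (Fin p) (Fin p) ℂ)
      (V₁ V₂ V₃ : Matrix (Fin q) (Fin q) ℂ) (z : Matrix (Fin q) (Fin p) ℂ),
      U₁ᴴ * U₁ = 1 ∧ U₂ᴴ * U₂ = 1 ∧ U₃ᴴ * U₃ = 1 ∧
      V₁ᴴ * V₁ = 1 ∧ V₂ᴴ * V₂ = 1 ∧ V₃ᴴ * V₃ = 1 ∧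
      rtr ((frameMat U₁ lp + frameMat U₂ mp + zᴴ * z - frameMat U₃ np)ᴴ *
        (frameMat U₁ lp + frameMat U₂ mp + zᴴ * z - frameMat U₃ np)) ≤ min (ε / 2) 1 ∧
      rtr ((frameMat V₁ lm + frameMat V₂ mm + z * zᴴ - frameMat V₃ nm)ᴴ *
        (frameMat V₁ lm + frameMat V₂ mm + z * zᴴ - frameMat V₃ nm)) ≤ min (ε / 2) 1) :
    ∃ (U₁ U₂ U₃ : Matrix (Fin p) (Fin p) ℂ)
      (V₁ V₂ V₃ : Matrix (Fin q) (Fin q) ℂ) (z : Matrix (Fin q) (Fin p) ℂ),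
      U₁ᴴ * U₁ = 1 ∧ U₂ᴴ * U₂ = 1 ∧ U₃ᴴ * U₃ = 1 ∧
      V₁ᴴ * V₁ = 1 ∧ V₂ᴴ * V₂ = 1 ∧ V₃ᴴ * V₃ = 1 ∧
      frameMat U₁ lp + frameMat U₂ mp + zᴴ * z = frameMat U₃ np ∧
      frameMat V₁ lm + frameMat V₂ mm + z * zᴴ = frameMat V₃ nm := by
  let r₁ : (Matrix (Fin p) (Fin p) ℂ × Matrix (Fin p) (Fin p) ℂ × Matrix (Fin p) (Fin p) ℂ) ×
      (Matrix (Fin q) (Fin q) ℂ × Matrix (Fin q) (Fin q) ℂ × Matrix (Fin q) (Fin q) ℂ) ×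
      Matrix (Fin q) (Fin p) ℂ → Matrix (Fin p) (Fin p) ℂ := fun x =>
    frameMat x.1.1 lp + frameMat x.1.2.1 mp + x.2.2ᴴ * x.2.2 - frameMat x.1.2.2 np
  let r₂ : (Matrix (Fin p) (Fin p) ℂ × Matrix (Fin p) (Fin p) ℂ × Matrix (Fin p) (Fin p) ℂ) ×
      (Matrix (Fin q) (Fin q) ℂ × Matrix (Fin q) (Fin q) ℂ × Matrix (Fin q) (Fin q) ℂ) ×
      Matrix (Fin q) (Fin p) ℂ → Matrix (Fin q) (Fin q) ℂ := fun x =>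
    frameMat x.2.1.1 lm + frameMat x.2.1.2.1 mm + x.2.2 * x.2.2ᴴ - frameMat x.2.1.2.2 nm
  have c₁ : Continuous r₁ := by
    have := continuous_frameMat (N := Fin p) lp
    have := continuous_frameMat (N := Fin p) mp
    have := continuous_frameMat (N := Fin p) np
    fun_prop
  have c₂ : Continuous r₂ := by
    have := continuous_frameMat (N := Fin q) lm
    have := continuous_frameMat (N := Fin q) mm
    have := continuous_frameMat (N := Fin q) nm
    fun_prop
  have hK := ((isCompact_isometry (n := Fin p) (N := Fin p)).prod
    (isCompact_isometry (n := Fin p) (N := Fin p) |>.prod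
      (isCompact_isometry (n := Fin p) (N := Fin p)))).prod
      (((isCompact_isometry (n := Fin q) (N := Fin q)).prod
        (isCompact_isometry (n := Fin q) (N := Fin q) |>.prod
          (isCompact_isometry (n := Fin q) (N := Fin q)))).prod
        (isCompact_rtr_le (n := Fin p) (N := Fin q) (p + 1 + ∑ i, np i)))
  obtain ⟨x, hxK, hx⟩ := hK.exists_le_zero (f := fun x => rtr ((r₁ x)ᴴ * r₁ x) +
      rtr ((r₂ x)ᴴ * r₂ x))
    ((continuous_rtr.comp (c₁.matrix_conjTranspose.matrix_mul c₁)).add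
      (continuous_rtr.comp (c₂.matrix_conjTranspose.matrix_mul c₂))) (by
    intro ε hε
    obtain ⟨U₁, U₂, U₃, V₁, V₂, V₃, z, hU₁, hU₂, hU₃, hV₁, hV₂, hV₃, hU, hV⟩ := h ε hε
    refine ⟨((U₁, U₂, U₃), (V₁, V₂, V₃), z), ⟨⟨hU₁, hU₂, hU₃⟩, ⟨hV₁, hV₂, hV₃⟩, ?_⟩, ?_⟩
    · have hM := (((frameMat_isHermitian U₁ lp).add (frameMat_isHermitian U₂ mp)).add
        (isHermitian_conjTranspose_mul_self z)).sub (frameMat_isHermitian U₃ np)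
      have h1 := rtr_le_of_isHermitian hM
      rw [hM.eq] at hU
      rw [rtr_sub, rtr_add, rtr_add, rtr_frameMat hU₁, rtr_frameMat hU₂, rtr_frameMat hU₃,
        Fintype.card_fin] at h1
      have := Finset.sum_nonneg fun i (_ : i ∈ Finset.univ) => hlp0 i
      have := Finset.sum_nonneg fun i (_ : i ∈ Finset.univ) => hmp0 i
      have := hU.trans (min_le_right _ _)
      simp only [Set.mem_ofPred_eq]
      linarith
    · have h1 := hU.trans (min_le_left _ _)
      have h2 := hV.trans (min_le_left _ _)
      simp only [r₁, r₂]
      linarith)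
  obtain ⟨⟨U₁, U₂, U₃⟩, ⟨V₁, V₂, V₃⟩, z⟩ := x
  obtain ⟨⟨hU₁, hU₂, hU₃⟩, ⟨hV₁, hV₂, hV₃⟩, -⟩ := hxK
  have n₁ := rtr_conjTranspose_mul_self_nonneg (r₁ ((U₁, U₂, U₃), (V₁, V₂, V₃), z))
  have n₂ := rtr_conjTranspose_mul_self_nonneg (r₂ ((U₁, U₂, U₃), (V₁, V₂, V₃), z))
  exact ⟨U₁, U₂, U₃, V₁, V₂, V₃, z, hU₁, hU₂, hU₃, hV₁, hV₂, hV₃,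
    sub_eq_zero.1 (eq_zero_of_rtr_nonpos (by linarith :
      rtr ((r₁ ((U₁, U₂, U₃), (V₁, V₂, V₃), z))ᴴ * r₁ ((U₁, U₂, U₃), (V₁, V₂, V₃), z)) ≤ 0)),
    sub_eq_zero.1 (eq_zero_of_rtr_nonpos (by linarith :
      rtr ((r₂ ((U₁, U₂, U₃), (V₁, V₂, V₃), z))ᴴ * r₂ ((U₁, U₂, U₃), (V₁, V₂, V₃), z)) ≤ 0))⟩

theorem diagonal_eq_conj_frameMat {n : Type*} [Fintype n] [DecidableEq n] {U : Matrix n n ℂ}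
    (hU : Uᴴ * U = 1) (w : n → ℝ) :
    diagonal (fun i => (w i : ℂ)) = Uᴴ * frameMat U w * U := by
  rw [frameMat, ← Matrix.mul_assoc, ← Matrix.mul_assoc, hU, Matrix.one_mul, Matrix.mul_assoc, hU,
    Matrix.mul_one]

theorem conj_frameMat {n N M : Type*} [Fintype n] [DecidableEq n] [Fintype N]
    (V : Matrix N M ℂ) (U : Matrix N n ℂ) (w : n → ℝ) :
    Vᴴ * frameMat U w * V = frameMat (Vᴴ * U) w := by
  simp only [frameMat, conjTranspose_mul, conjTranspose_conjTranspose, Matrix.mul_assoc]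

theorem exists_compact_of_bounded (hlp : Antitone lp) (hmp : Antitone mp)
    (hnp : Antitone np) (hlm : Antitone lm) (hmm : Antitone mm) (hnm : Antitone nm)
    (hlp0 : ∀ i, 0 ≤ lp i) (hmp0 : ∀ i, 0 ≤ mp i) (hnp0 : ∀ i, 0 ≤ np i)
    (hlm0 : ∀ i, 0 ≤ lm i) (hmm0 : ∀ i, 0 ≤ mm i) (hnm0 : ∀ i, 0 ≤ nm i)
    {f₁ f₂ : Matrix (Fin p) (Fin p) ℂ} {f₁' f₂' : Matrix (Fin q) (Fin q) ℂ}
    (hf₁ : IsUnit f₁.det) (hf₂ : IsUnit f₂.det) (hf₁' : IsUnit f₁'.det) (hf₂' : IsUnit f₂'.det)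
    (Y : Matrix (Fin p) (Fin q) ℂ) (C : ℝ)
    (hC : ∀ (α : Matrix (Fin p) (Fin p) ℂ) (γ : Matrix (Fin q) (Fin q) ℂ), α.PosDef → γ.PosDef →
      C ≤ triplePot lp mp np f₁ f₂ α + triplePot lm mm nm f₁' f₂' γ + rtr (α * (Y * γ * Yᴴ))) :
    ∃ (U₁ U₂ : Matrix (Fin p) (Fin p) ℂ) (V₁ V₂ : Matrix (Fin q) (Fin q) ℂ)
      (y : Matrix (Fin p) (Fin q) ℂ),
      U₁ᴴ * U₁ = 1 ∧ U₂ᴴ * U₂ = 1 ∧ V₁ᴴ * V₁ = 1 ∧ V₂ᴴ * V₂ = 1 ∧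
      diagonal (fun i => (np i : ℂ)) = frameMat U₁ lp + frameMat U₂ mp + y * yᴴ ∧
      diagonal (fun i => (nm i : ℂ)) = frameMat V₁ lm + frameMat V₂ mm + yᴴ * y := by
  obtain ⟨U₁, U₂, U₃, V₁, V₂, V₃, z, hU₁, hU₂, hU₃, hV₁, hV₂, hV₃, hU, hV⟩ :=
    exists_compact_of_approx hlp0 hmp0 fun ε hε => exists_approx_compact_of_bounded hlp hmp hnp hlm
      hmm hnm hlp0 hmp0 hnp0 hlm0 hmm0 hnm0 hf₁ hf₂ hf₁' hf₂' Y C hC hε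
  have hU₃' := mul_eq_one_comm.1 hU₃
  have hV₃' := mul_eq_one_comm.1 hV₃
  have iso : ∀ {m : ℕ} {U V : Matrix (Fin m) (Fin m) ℂ}, Uᴴ * U = 1 → V * Vᴴ = 1 →
      (Vᴴ * U)ᴴ * (Vᴴ * U) = 1 := by
    intro m U V hU hV
    rw [conjTranspose_mul, conjTranspose_conjTranspose, Matrix.mul_assoc, ← Matrix.mul_assoc V,
      hV, Matrix.one_mul, hU]
  refine ⟨U₃ᴴ * U₁, U₃ᴴ * U₂, V₃ᴴ * V₁, V₃ᴴ * V₂, U₃ᴴ * zᴴ * V₃, iso hU₁ hU₃', iso hU₂ hU₃',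
    iso hV₁ hV₃', iso hV₂ hV₃', ?_, ?_⟩
  · rw [diagonal_eq_conj_frameMat hU₃, ← hU, Matrix.mul_add, Matrix.mul_add, Matrix.add_mul,
      Matrix.add_mul, conj_frameMat, conj_frameMat]
    congr 1
    calc _ = U₃ᴴ * (zᴴ * (V₃ * V₃ᴴ) * z) * U₃ := by rw [hV₃', Matrix.mul_one]
      _ = _ := by
        simp only [conjTranspose_mul, conjTranspose_conjTranspose, Matrix.mul_assoc]
  · rw [diagonal_eq_conj_frameMat hV₃, ← hV, Matrix.mul_add, Matrix.mul_add, Matrix.add_mul,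
      Matrix.add_mul, conj_frameMat, conj_frameMat]
    congr 1
    calc _ = V₃ᴴ * (z * (U₃ * U₃ᴴ) * zᴴ) * V₃ := by rw [hU₃', Matrix.mul_one]
      _ = _ := by
        simp only [conjTranspose_mul, conjTranspose_conjTranspose, Matrix.mul_assoc]

end CompactEquation

section PeierlsFrames

variable {N : Type*} [Fintype N] [DecidableEq N] {m : ℕ}

theorem star_ofReal_comp {n : Type*} (w : n → ℝ) : (star fun i => (w i : ℂ)) = fun i => (w i : ℂ)
    := by
  ext i
  simp

theorem rtr_conj_comm {n M : Type*} [Fintype n] [Fintype M] (ℓ : Matrix n n ℂ) (X : Matrix n M ℂ) :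
    rtr (Xᴴ * ℓ * X) = rtr (ℓ * (X * Xᴴ)) := by
  rw [Matrix.mul_assoc, rtr_mul_comm, Matrix.mul_assoc]

theorem diagonal_sqrt_mul_self {n : Type*} [Fintype n] [DecidableEq n] {w : n → ℝ}
    (hw : ∀ i, 0 < w i) :
    diagonal (fun i => (Real.sqrt (w i) : ℂ)) * diagonal (fun i => (Real.sqrt (w i) : ℂ)) =
      diagonal (fun i => (w i : ℂ)) := by
  rw [diagonal_mul_diagonal]
  congr 1
  ext i
  rw [← Complex.ofReal_mul, Real.mul_self_sqrt (hw i).le]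

theorem diagonal_sqrt_mul_inv {n : Type*} [Fintype n] [DecidableEq n] {w : n → ℝ}
    (hw : ∀ i, 0 < w i) :
    diagonal (fun i => (Real.sqrt (w i) : ℂ)) * diagonal (fun i => (((Real.sqrt (w i))⁻¹ : ℝ) : ℂ))
      =
      1 := by
  rw [diagonal_mul_diagonal, ← diagonal_one]
  congr 1
  ext i
  rw [← Complex.ofReal_mul, mul_inv_cancel₀ (Real.sqrt_pos.2 (hw i)).ne', Complex.ofReal_one]

theorem isUnit_det_diagonal_sqrt {n : Type*} [Fintype n] [DecidableEq n] {w : n → ℝ}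
    (hw : ∀ i, 0 < w i) : IsUnit (diagonal (fun i => (Real.sqrt (w i) : ℂ))).det := by
  refine isUnit_of_mul_isUnit_left (y := (diagonal fun i => (((Real.sqrt (w i))⁻¹ : ℝ) : ℂ)).det) ?_
  rw [← det_mul, diagonal_sqrt_mul_inv hw, det_one]
  exact isUnit_one

theorem flagLog_conj_diagonal_sqrt {w : Fin m → ℝ} (hw : ∀ i, 0 < w i)
    {P : Matrix (Fin m) (Fin m) ℂ} (hP : P.PosDef) :
    flagLog w (diagonal (fun i => (Real.sqrt (w i) : ℂ)) * P *
      diagonal (fun i => (Real.sqrt (w i) : ℂ))) =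
      flagLog w P + flagLog w (diagonal (fun i => (w i : ℂ))) := by
  have := flagLog_conj w hP (R := diagonal (fun i => (Real.sqrt (w i) : ℂ)))
    (fun i j h => diagonal_apply_ne _ h.ne') (isUnit_det_diagonal_sqrt hw)
  rwa [diagonal_conjTranspose, star_ofReal_comp, diagonal_sqrt_mul_self hw] at this

theorem exists_isometry_of_gram {w : Fin m → ℝ} (hw : ∀ i, 0 < w i) {T : Matrix N (Fin m) ℂ}
    (hT : Tᴴ * T = diagonal (fun i => (w i : ℂ))) :
    ∃ S : Matrix N (Fin m) ℂ, Sᴴ * S = 1 ∧ T = S * diagonal (fun i => (Real.sqrt (w i) : ℂ)) := by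
  have h1 := diagonal_sqrt_mul_inv hw
  have h2 := mul_eq_one_comm.1 h1
  refine ⟨T * diagonal (fun i => (((Real.sqrt (w i))⁻¹ : ℝ) : ℂ)), ?_, ?_⟩
  · rw [conjTranspose_mul, diagonal_conjTranspose, star_ofReal_comp, Matrix.mul_assoc,
      ← Matrix.mul_assoc Tᴴ, hT, ← diagonal_sqrt_mul_self hw, Matrix.mul_assoc (diagonal _), h1,
      Matrix.mul_one, h2]
  · rw [Matrix.mul_assoc, h2, Matrix.mul_one]

theorem peierls_gram {w : Fin m → ℝ} (hw : Antitone w) (hw0 : ∀ i, 0 < w i)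
    {T : Matrix N (Fin m) ℂ} (hT : Tᴴ * T = diagonal (fun i => (w i : ℂ))) {W : Matrix N N ℂ}
    (hW' : Wᴴ * W = 1) (hW : W * Wᴴ = 1) {θ : N → ℝ} (hθ : ∀ j, 0 < θ j) :
    rtr (W * diagonal (fun j => (Real.log (θ j) : ℂ)) * Wᴴ * (T * Tᴴ)) +
        flagLog w (diagonal (fun i => (w i : ℂ))) ≤
      flagLog w (Tᴴ * (W * diagonal (fun j => (θ j : ℂ)) * Wᴴ) * T) ∧
    -rtr (W * diagonal (fun j => (Real.log (θ j) : ℂ)) * Wᴴ * (T * Tᴴ)) +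
        flagLog w (diagonal (fun i => (w i : ℂ))) ≤
      flagLog w (Tᴴ * (W * diagonal (fun j => (θ j : ℂ)) * Wᴴ)⁻¹ * T) := by
  obtain ⟨S, hS, rfl⟩ := exists_isometry_of_gram hw0 hT
  have e : ∀ X : Matrix N N ℂ, (S * diagonal (fun i => (Real.sqrt (w i) : ℂ)))ᴴ * X *
      (S * diagonal (fun i => (Real.sqrt (w i) : ℂ))) =
      diagonal (fun i => (Real.sqrt (w i) : ℂ)) * (Sᴴ * X * S) *
        diagonal (fun i => (Real.sqrt (w i) : ℂ)) := by
    intro X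
    rw [conjTranspose_mul, diagonal_conjTranspose, star_ofReal_comp]
    simp only [Matrix.mul_assoc]
  have e' : (S * diagonal (fun i => (Real.sqrt (w i) : ℂ))) *
      (S * diagonal (fun i => (Real.sqrt (w i) : ℂ)))ᴴ =
      S * diagonal (fun i => (w i : ℂ)) * Sᴴ := by
    rw [conjTranspose_mul, diagonal_conjTranspose, star_ofReal_comp, Matrix.mul_assoc,
      ← Matrix.mul_assoc (diagonal _) (diagonal _), diagonal_sqrt_mul_self hw0, Matrix.mul_assoc]
  have hpd : (W * diagonal (fun j => (θ j : ℂ)) * Wᴴ).PosDef := by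
    have := (posDef_diagonal_ofReal hθ).isometry_conj (U := Wᴴ) (by simpa using hW)
    simpa using this
  rw [e, e, e', flagLog_conj_diagonal_sqrt hw0 (hpd.isometry_conj hS),
    flagLog_conj_diagonal_sqrt hw0 (hpd.inv.isometry_conj hS)]
  exact ⟨add_le_add_left (peierls hw (fun i => (hw0 i).le) hS hW hθ) _,
    add_le_add_left (peierls_inv hw (fun i => (hw0 i).le) hS hW' hW hθ) _⟩

variable {p q : ℕ} {lp mp np : Fin p → ℝ} {lm mm nm : Fin q → ℝ}

theorem fromBlocks_diagonalization {W₁ W₂ : Matrix N N ℂ} (d₁ d₂ : N → ℝ) :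
    fromBlocks W₁ 0 0 W₂ * diagonal (fun j => ((Sum.elim d₁ d₂ j : ℝ) : ℂ)) * (fromBlocks W₁ 0 0
      W₂)ᴴ =
      fromBlocks (W₁ * diagonal (fun j => (d₁ j : ℂ)) * W₁ᴴ) 0 0
        (W₂ * diagonal (fun j => (d₂ j : ℂ)) * W₂ᴴ) := by
  have : diagonal (fun j => ((Sum.elim d₁ d₂ j : ℝ) : ℂ)) =
      fromBlocks (diagonal (fun j => (d₁ j : ℂ))) 0 0 (diagonal (fun j => (d₂ j : ℂ))) := by
    rw [fromBlocks_diagonal]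
    congr 1
    ext (i | i) <;> rfl
  rw [this, fromBlocks_conjTranspose, fromBlocks_multiply, fromBlocks_multiply]
  simp

theorem inv_fromBlocks_diag {k₁ k₂ : Matrix N N ℂ} (h₁ : IsUnit k₁.det) (h₂ : IsUnit k₂.det) :
    (fromBlocks k₁ 0 0 k₂)⁻¹ = fromBlocks k₁⁻¹ 0 0 k₂⁻¹ := by
  refine inv_eq_right_inv ?_
  rw [fromBlocks_multiply]
  simp [mul_nonsing_inv _ h₁, mul_nonsing_inv _ h₂]

theorem fromRows_gram {M : Type*} (X₁ X₂ : Matrix N M ℂ) (k₁ k₂ : Matrix N N ℂ) :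
    (fromRows X₁ X₂)ᴴ * fromBlocks k₁ 0 0 k₂ * fromRows X₁ X₂ =
      X₁ᴴ * k₁ * X₁ + X₂ᴴ * k₂ * X₂ := by
  rw [conjTranspose_fromRows_eq_fromCols_conjTranspose, Matrix.mul_assoc,
    fromBlocks_mul_fromRows, fromCols_mul_fromRows]
  simp [Matrix.mul_assoc]

theorem noncompact_potential_bounded (hlp : Antitone lp) (hmp : Antitone mp) (hnp : Antitone np)
    (hlm : Antitone lm) (hmm : Antitone mm) (hnm : Antitone nm)
    (hlp0 : ∀ i, 0 ≤ lp i) (hmp0 : ∀ i, 0 ≤ mp i) (hnp0 : ∀ i, 0 < np i)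
    (hlm0 : ∀ i, 0 ≤ lm i) (hmm0 : ∀ i, 0 ≤ mm i) (hnm0 : ∀ i, 0 < nm i)
    {E₁ E₂ P₁ P₂ : Matrix N (Fin p) ℂ} {E₁' E₂' Q₁ Q₂ : Matrix N (Fin q) ℂ}
    (hE₁ : E₁ᴴ * E₁ = 1) (hE₂ : E₂ᴴ * E₂ = 1) (hE₁' : E₁'ᴴ * E₁' = 1) (hE₂' : E₂'ᴴ * E₂' = 1)
    (h₁ : P₁ * P₁ᴴ - Q₁ * Q₁ᴴ = frameMat E₁ lp - frameMat E₁' lm)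
    (h₂ : P₂ * P₂ᴴ - Q₂ * Q₂ᴴ = frameMat E₂ mp - frameMat E₂' mm)
    (hP : P₁ᴴ * P₁ + P₂ᴴ * P₂ = diagonal (fun i => (np i : ℂ)))
    (hQ : Q₁ᴴ * Q₁ + Q₂ᴴ * Q₂ = diagonal (fun i => (nm i : ℂ)))
    {k₁ k₂ : Matrix N N ℂ} (hk₁ : k₁.PosDef) (hk₂ : k₂.PosDef) :
    flagLog np (diagonal (fun i => (np i : ℂ))) + flagLog nm (diagonal (fun i => (nm i : ℂ))) ≤
      flagLog lp (E₁ᴴ * k₁ * E₁) + flagLog lm (E₁'ᴴ * k₁⁻¹ * E₁') +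
      (flagLog mp (E₂ᴴ * k₂ * E₂) + flagLog mm (E₂'ᴴ * k₂⁻¹ * E₂')) +
      flagLog nm (Q₁ᴴ * k₁ * Q₁ + Q₂ᴴ * k₂ * Q₂) +
      flagLog np (P₁ᴴ * k₁⁻¹ * P₁ + P₂ᴴ * k₂⁻¹ * P₂) := by
  have hi₁ := hk₁.isUnit_det
  have hi₂ := hk₂.isUnit_det
  obtain ⟨W₁, θ₁, hW₁', hW₁, hθ₁, e₁⟩ := hk₁.exists_diagonalization
  obtain ⟨W₂, θ₂, hW₂', hW₂, hθ₂, e₂⟩ := hk₂.exists_diagonalization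
  have hW' : (fromBlocks W₁ 0 0 W₂)ᴴ * fromBlocks W₁ 0 0 W₂ = 1 := by
    rw [fromBlocks_conjTranspose, fromBlocks_multiply]; simp [hW₁', hW₂']
  have hW : fromBlocks W₁ 0 0 W₂ * (fromBlocks W₁ 0 0 W₂)ᴴ = 1 := by
    rw [fromBlocks_conjTranspose, fromBlocks_multiply]; simp [hW₁, hW₂]
  have hθ : ∀ j, 0 < Sum.elim θ₁ θ₂ j := by rintro (j | j); exacts [hθ₁ j, hθ₂ j]
  have gram : ∀ {m : ℕ} (X₁ X₂ : Matrix N (Fin m) ℂ), (fromRows X₁ X₂)ᴴ * fromRows X₁ X₂ =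
      X₁ᴴ * X₁ + X₂ᴴ * X₂ := by
    intro m X₁ X₂
    have := fromRows_gram X₁ X₂ 1 1
    simpa using this
  have gQ := (peierls_gram hnm hnm0 ((gram Q₁ Q₂).trans hQ) hW' hW hθ).1
  have gP := (peierls_gram hnp hnp0 ((gram P₁ P₂).trans hP) hW' hW hθ).2
  have hlog : (fun j => ((Real.log (Sum.elim θ₁ θ₂ j) : ℝ) : ℂ)) =
      fun j => ((Sum.elim (fun j => Real.log (θ₁ j)) (fun j => Real.log (θ₂ j)) j : ℝ) : ℂ) := by
    ext (j | j) <;> rfl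
  rw [hlog, fromBlocks_diagonalization, fromBlocks_diagonalization, ← e₁, ← e₂,
    fromRows_gram] at gQ
  rw [hlog, fromBlocks_diagonalization, fromBlocks_diagonalization, ← e₁, ← e₂,
    inv_fromBlocks_diag hi₁ hi₂, fromRows_gram] at gP
  have g₁ := peierls hlp hlp0 hE₁ hW₁ hθ₁
  have g₁' := peierls_inv hlm hlm0 hE₁' hW₁' hW₁ hθ₁
  have g₂ := peierls hmp hmp0 hE₂ hW₂ hθ₂
  have g₂' := peierls_inv hmm hmm0 hE₂' hW₂' hW₂ hθ₂
  rw [← e₁] at g₁ g₁'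
  rw [← e₂] at g₂ g₂'
  set ℓ₁ := W₁ * diagonal (fun j => (Real.log (θ₁ j) : ℂ)) * W₁ᴴ
  set ℓ₂ := W₂ * diagonal (fun j => (Real.log (θ₂ j) : ℂ)) * W₂ᴴ
  have tr : ∀ {m : ℕ} (X₁ X₂ : Matrix N (Fin m) ℂ), rtr (fromBlocks ℓ₁ 0 0 ℓ₂ *
      (fromRows X₁ X₂ * (fromRows X₁ X₂)ᴴ)) = rtr (ℓ₁ * (X₁ * X₁ᴴ)) + rtr (ℓ₂ * (X₂ * X₂ᴴ)) := by
    intro m X₁ X₂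
    rw [← Matrix.mul_assoc, rtr_mul_comm, ← Matrix.mul_assoc, fromRows_gram, rtr_add,
      rtr_conj_comm, rtr_conj_comm]
  rw [tr] at gQ gP
  have t₁ := congrArg (fun X => rtr (ℓ₁ * X)) h₁
  have t₂ := congrArg (fun X => rtr (ℓ₂ * X)) h₂
  simp only [frameMat, Matrix.mul_sub, rtr_sub] at t₁ t₂
  linarith

end PeierlsFrames

section Triangular

variable {n₁ n₂ : Type*} [Fintype n₁] [Fintype n₂] [DecidableEq n₁] [DecidableEq n₂]

theorem exists_posDef_of_blocks {A : Matrix n₁ n₁ ℂ} {B : Matrix n₁ n₂ ℂ} {C : Matrix n₂ n₁ ℂ}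
    {E : Matrix n₂ n₂ ℂ} (hA : IsUnit A.det) (hE : IsUnit E.det) {α : Matrix n₁ n₁ ℂ}
    {γ : Matrix n₂ n₂ ℂ} (hα : α.PosDef) (hγ : γ.PosDef) :
    ∃ k : Matrix (n₁ ⊕ n₂) (n₁ ⊕ n₂) ℂ, k.PosDef ∧
      (fromRows (1 : Matrix n₁ n₁ ℂ) (0 : Matrix n₂ n₁ ℂ))ᴴ * k *
        fromRows (1 : Matrix n₁ n₁ ℂ) (0 : Matrix n₂ n₁ ℂ) = A * α * Aᴴ ∧
      (fromRows (0 : Matrix n₁ n₂ ℂ) (1 : Matrix n₂ n₂ ℂ))ᴴ * k⁻¹ *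
        fromRows (0 : Matrix n₁ n₂ ℂ) (1 : Matrix n₂ n₂ ℂ) = E * γ * Eᴴ ∧
      (fromRows B E)ᴴ * k * fromRows B E = γ⁻¹ ∧
      (fromRows A C)ᴴ * k⁻¹ * fromRows A C =
        α⁻¹ + (Eᴴ * C + Bᴴ * A)ᴴ * γ * (Eᴴ * C + Bᴴ * A) := by
  have hAH : IsUnit (Aᴴ).det := by rw [det_conjTranspose]; exact hA.star
  have hEH : IsUnit (Eᴴ).det := by rw [det_conjTranspose]; exact hE.star
  have hα' : (A * α * Aᴴ).PosDef := by simpa using hα.conj hAH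
  have hγ' : (E * γ * Eᴴ).PosDef := by simpa using hγ.conj hEH
  obtain ⟨α', hα'd⟩ : ∃ α', α' = A * α * Aᴴ := ⟨_, rfl⟩
  obtain ⟨γ', hγ'd⟩ : ∃ γ', γ' = E * γ * Eᴴ := ⟨_, rfl⟩
  rw [← hα'd] at hα' ⊢
  rw [← hγ'd] at hγ' ⊢
  obtain ⟨c, hc⟩ : ∃ c, c = -(B * E⁻¹) := ⟨_, rfl⟩
  obtain ⟨R, hR⟩ : ∃ R : Matrix (n₁ ⊕ n₂) (n₁ ⊕ n₂) ℂ, R = fromBlocks 1 c 0 1 := ⟨_, rfl⟩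
  obtain ⟨R', hR'⟩ : ∃ R : Matrix (n₁ ⊕ n₂) (n₁ ⊕ n₂) ℂ, R = fromBlocks 1 (-c) 0 1 := ⟨_, rfl⟩
  obtain ⟨M, hM⟩ : ∃ M : Matrix (n₁ ⊕ n₂) (n₁ ⊕ n₂) ℂ, M = fromBlocks α' 0 0 γ'⁻¹ := ⟨_, rfl⟩
  obtain ⟨M', hM'⟩ : ∃ M : Matrix (n₁ ⊕ n₂) (n₁ ⊕ n₂) ℂ, M = fromBlocks α'⁻¹ 0 0 γ' := ⟨_, rfl⟩
  have hdet : IsUnit R.det := by rw [hR]; simp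
  have hdiag : M.PosDef := by
    obtain ⟨s, hs, e₁⟩ := hα'.exists_conjTranspose_mul_self
    obtain ⟨t, ht, e₂⟩ := hγ'.inv.exists_conjTranspose_mul_self
    have : M = (fromBlocks s 0 0 t)ᴴ * fromBlocks s 0 0 t := by
      rw [hM, fromBlocks_conjTranspose, fromBlocks_multiply, e₁, e₂]; simp
    rw [this]
    exact posDef_conjTranspose_mul_self (by rw [det_fromBlocks_zero₂₁]; exact hs.mul ht)
  have i1 : R * R' = 1 := by
    rw [hR, hR', fromBlocks_multiply]; simp
  have i2 : M * M' = 1 := by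
    rw [hM, hM', fromBlocks_multiply]
    simp [mul_nonsing_inv _ hα'.isUnit_det, nonsing_inv_mul _ hγ'.isUnit_det]
  have hinv : (Rᴴ * M * R)⁻¹ = R' * M' * R'ᴴ := by
    refine inv_eq_right_inv ?_
    calc _ = Rᴴ * (M * (R * R') * M') * R'ᴴ := by
          simp only [Matrix.mul_assoc]
      _ = (R' * R)ᴴ := by
          rw [i1, Matrix.mul_one, i2, Matrix.mul_one, conjTranspose_mul]
      _ = 1 := by rw [mul_eq_one_comm.1 i1, conjTranspose_one]
  refine ⟨Rᴴ * M * R, hdiag.conj hdet, ?_, ?_, ?_, ?_⟩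
  · rw [hR, hM, fromBlocks_conjTranspose, conjTranspose_fromRows_eq_fromCols_conjTranspose]
    simp only [fromBlocks_multiply, Matrix.mul_assoc, fromBlocks_mul_fromRows,
      fromCols_mul_fromRows]
    simp
  · rw [hinv, hR', hM', fromBlocks_conjTranspose, conjTranspose_fromRows_eq_fromCols_conjTranspose]
    simp only [fromBlocks_multiply, Matrix.mul_assoc, fromBlocks_mul_fromRows,
      fromCols_mul_fromRows]
    simp
  · have hT : R * fromRows B E = fromRows (0 : Matrix n₁ n₂ ℂ) E := by
      rw [hR, fromBlocks_mul_fromRows, hc, Matrix.neg_mul, Matrix.mul_assoc, nonsing_inv_mul _ hE]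
      simp
    calc _ = (R * fromRows B E)ᴴ * M * (R * fromRows B E) := by
          simp only [conjTranspose_mul, Matrix.mul_assoc]
      _ = Eᴴ * γ'⁻¹ * E := by
          rw [hT, hM, conjTranspose_fromRows_eq_fromCols_conjTranspose, Matrix.mul_assoc,
            fromBlocks_mul_fromRows, fromCols_mul_fromRows]
          simp [Matrix.mul_assoc]
      _ = γ⁻¹ := by
          rw [hγ'd, Matrix.mul_inv_rev, Matrix.mul_inv_rev, ← Matrix.mul_assoc,
            mul_nonsing_inv _ hEH, Matrix.one_mul, Matrix.mul_assoc, nonsing_inv_mul _ hE,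
            Matrix.mul_one]
  · obtain ⟨Z, hZ⟩ : ∃ Z, Z = Eᴴ * C + Bᴴ * A := ⟨_, rfl⟩
    rw [← hZ]
    have hT : R'ᴴ * fromRows A C = fromRows A ((E⁻¹)ᴴ * Z) := by
      rw [hR', hZ, fromBlocks_conjTranspose, fromBlocks_mul_fromRows, Matrix.mul_add,
        ← Matrix.mul_assoc, conjTranspose_nonsing_inv, nonsing_inv_mul _ hEH, hc]
      simp [conjTranspose_nonsing_inv, Matrix.mul_assoc, add_comm]
    rw [hinv]
    calc _ = (R'ᴴ * fromRows A C)ᴴ * M' * (R'ᴴ * fromRows A C) := by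
          simp only [conjTranspose_mul, conjTranspose_conjTranspose, Matrix.mul_assoc]
      _ = Aᴴ * α'⁻¹ * A + Zᴴ * (E⁻¹ * γ' * (E⁻¹)ᴴ) * Z := by
          rw [hT, hM', conjTranspose_fromRows_eq_fromCols_conjTranspose, Matrix.mul_assoc,
            fromBlocks_mul_fromRows, fromCols_mul_fromRows]
          simp [Matrix.mul_assoc, conjTranspose_mul]
      _ = _ := by
          rw [hα'd, Matrix.mul_inv_rev, Matrix.mul_inv_rev, ← Matrix.mul_assoc,
            mul_nonsing_inv _ hAH, Matrix.one_mul, Matrix.mul_assoc, nonsing_inv_mul _ hA,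
            Matrix.mul_one, hγ'd, ← Matrix.mul_assoc E⁻¹, ← Matrix.mul_assoc E⁻¹,
            nonsing_inv_mul _ hE, Matrix.one_mul, Matrix.mul_assoc γ, conjTranspose_nonsing_inv,
            mul_nonsing_inv _ hEH, Matrix.mul_one]

end Triangular

section Scaling

variable {m : ℕ} {a b c : Fin m → ℝ} {f₁ f₂ : Matrix (Fin m) (Fin m) ℂ}

theorem Matrix.PosDef.ofReal_smul {n : Type*} [Fintype n] {P : Matrix n n ℂ} (hP : P.PosDef)
    {t : ℝ} (ht : 0 < t) : ((t : ℂ) • P).PosDef :=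
  hP.smul (by exact_mod_cast ht)

theorem inv_ofReal_smul {n : Type*} [Fintype n] [DecidableEq n] {P : Matrix n n ℂ}
    (hP : IsUnit P.det) {t : ℝ} (ht : 0 < t) :
    ((t : ℂ) • P)⁻¹ = ((t⁻¹ : ℝ) : ℂ) • P⁻¹ := by
  refine inv_eq_right_inv ?_
  have ht' : (t : ℂ) ≠ 0 := by exact_mod_cast ht.ne'
  rw [smul_mul_smul_comm, mul_nonsing_inv _ hP, Complex.ofReal_inv, mul_inv_cancel₀ ht', one_smul]

theorem triplePot_smul (hf₁ : IsUnit f₁.det) (hf₂ : IsUnit f₂.det)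
    {α : Matrix (Fin m) (Fin m) ℂ} (hα : α.PosDef) {t : ℝ} (ht : 0 < t) :
    triplePot a b c f₁ f₂ ((t : ℂ) • α) =
      triplePot a b c f₁ f₂ α + (∑ i, a i + ∑ i, b i - ∑ i, c i) * Real.log t := by
  have e : ∀ f : Matrix (Fin m) (Fin m) ℂ, fᴴ * ((t : ℂ) • α) * f = (t : ℂ) • (fᴴ * α * f) := by
    intro f
    rw [Matrix.mul_smul, Matrix.smul_mul]
  rw [triplePot, triplePot, e, e, inv_ofReal_smul hα.isUnit_det ht, flagLog_smul a (hα.conj hf₁) ht,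
    flagLog_smul b (hα.conj hf₂) ht, flagLog_smul c hα.inv (inv_pos.2 ht), Real.log_inv]
  ring

theorem posSemidef_one_sub_of_rtr_le {n : Type*} [Fintype n] [DecidableEq n] {G : Matrix n n ℂ}
    (hG : G.PosSemidef) (h : rtr G ≤ 1) : (1 - G).PosSemidef := by
  obtain ⟨W, d, h1, h2, h3⟩ := hG.isHermitian.exists_diagonalization
  have hd : ∀ i, 0 ≤ d i := by
    intro i
    have h4 : diagonal (fun i => (d i : ℂ)) = Wᴴ * G * W := by
      rw [h3]
      calc _ = 1 * diagonal (fun i => (d i : ℂ)) * 1 := by simp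
        _ = (Wᴴ * W) * diagonal (fun i => (d i : ℂ)) * (Wᴴ * W) := by rw [h1]
        _ = _ := by simp only [Matrix.mul_assoc]
    have h5 := (hG.conjTranspose_mul_mul_same W).diag_nonneg (i := i)
    rw [← h4] at h5
    simpa using h5
  have hs : rtr G = ∑ i, d i := by
    rw [h3]
    exact rtr_frameMat h1 d
  have hd1 : ∀ i, d i ≤ 1 := fun i =>
    (Finset.single_le_sum (f := d) (fun j _ => hd j) (Finset.mem_univ i)).trans (hs ▸ h)
  have h6 : (diagonal fun i => ((1 - d i : ℝ) : ℂ)).PosSemidef :=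
    PosSemidef.diagonal fun i => by
      have := sub_nonneg.2 (hd1 i)
      simpa using (by exact_mod_cast this : (0 : ℂ) ≤ ((1 - d i : ℝ) : ℂ))
  have h7 : 1 - G = W * (diagonal fun i => ((1 - d i : ℝ) : ℂ)) * Wᴴ := by
    have : (diagonal fun i => ((1 - d i : ℝ) : ℂ)) = 1 - diagonal (fun i => (d i : ℂ)) := by
      rw [← diagonal_one, diagonal_sub]
      congr 1; ext i; simp
    rw [this, Matrix.mul_sub, Matrix.sub_mul, Matrix.mul_one, h2, ← h3]
  rw [h7]
  exact h6.mul_mul_conjTranspose_same W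

theorem posSemidef_inv_sub_of_rtr_le {n : Type*} [Fintype n] [DecidableEq n] {α G : Matrix n n ℂ}
    (hα : α.PosDef) (hG : G.PosSemidef) (h : rtr (α * G) ≤ 1) : (α⁻¹ - G).PosSemidef := by
  obtain ⟨s, hs, e⟩ := hα.exists_conjTranspose_mul_self
  have hsH : IsUnit (sᴴ).det := by rw [det_conjTranspose]; exact hs.star
  have h1 : rtr (s * G * sᴴ) ≤ 1 := by
    rw [rtr_mul_comm, ← Matrix.mul_assoc, ← e]
    exact h
  have h2 := (posSemidef_one_sub_of_rtr_le (hG.mul_mul_conjTranspose_same s) h1)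
    |>.mul_mul_conjTranspose_same s⁻¹
  have h3 : α⁻¹ - G = s⁻¹ * (1 - s * G * sᴴ) * (s⁻¹)ᴴ := by
    rw [Matrix.mul_sub, Matrix.sub_mul, Matrix.mul_one, conjTranspose_nonsing_inv, e,
      Matrix.mul_inv_rev]
    congr 1
    calc G = (s⁻¹ * s) * G * (sᴴ * (sᴴ)⁻¹) := by
          rw [nonsing_inv_mul _ hs, mul_nonsing_inv _ hsH, Matrix.one_mul, Matrix.mul_one]
      _ = _ := by simp only [Matrix.mul_assoc]
  rw [h3]
  exact h2

theorem mul_log_le_add {κ τ : ℝ} (hτ : 1 ≤ τ) :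
    κ * Real.log τ ≤ τ + |κ| * Real.log (|κ| + 1) := by
  have hκ : 0 ≤ |κ| := abs_nonneg κ
  have h0 : 0 ≤ Real.log τ := Real.log_nonneg hτ
  have h1 : κ * Real.log τ ≤ |κ| * Real.log τ := mul_le_mul_of_nonneg_right (le_abs_self κ) h0
  have h2 : Real.log τ = Real.log (τ / (|κ| + 1)) + Real.log (|κ| + 1) := by
    rw [← Real.log_mul (by positivity) (by positivity), div_mul_cancel₀]
    positivity
  have h3 := Real.log_le_sub_one_of_pos (x := τ / (|κ| + 1)) (by positivity)
  have h4 : |κ| * (τ / (|κ| + 1)) ≤ τ := by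
    rw [mul_div_assoc', div_le_iff₀ (by positivity)]
    nlinarith
  nlinarith

/-- A lower bound valid on a normalized region extends to the coercive potential. -/
theorem potential_bounded_of_normalized {p q : ℕ} {lp mp np : Fin p → ℝ} {f₁ f₂ : Matrix (Fin p)
    (Fin p) ℂ}
    (hf₁ : IsUnit f₁.det) (hf₂ : IsUnit f₂.det) (Y : Matrix (Fin p) (Fin q) ℂ)
    (pot : Matrix (Fin q) (Fin q) ℂ → ℝ) {C : ℝ}
    (h : ∀ (α : Matrix (Fin p) (Fin p) ℂ) (γ : Matrix (Fin q) (Fin q) ℂ), α.PosDef → γ.PosDef →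
      (α⁻¹ - Y * γ * Yᴴ).PosSemidef → C ≤ triplePot lp mp np f₁ f₂ α + pot γ) :
    ∃ C', ∀ (α : Matrix (Fin p) (Fin p) ℂ) (γ : Matrix (Fin q) (Fin q) ℂ), α.PosDef → γ.PosDef →
      C' ≤ triplePot lp mp np f₁ f₂ α + pot γ + rtr (α * (Y * γ * Yᴴ)) := by
  obtain ⟨κ, hκ⟩ : ∃ κ, κ = -(∑ i, lp i + ∑ i, mp i - ∑ i, np i) := ⟨_, rfl⟩
  refine ⟨C - |κ| * Real.log (|κ| + 1), fun α γ hα hγ => ?_⟩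
  have hG : (Y * γ * Yᴴ).PosSemidef := hγ.posSemidef.mul_mul_conjTranspose_same Y
  obtain ⟨τ, hτ⟩ : ∃ τ, τ = rtr (α * (Y * γ * Yᴴ)) := ⟨_, rfl⟩
  have hl : 0 ≤ |κ| * Real.log (|κ| + 1) :=
    mul_nonneg (abs_nonneg κ) (Real.log_nonneg (by linarith [abs_nonneg κ]))
  rw [← hτ]
  rcases le_or_gt τ 1 with h1 | h1
  · have h2 := h α γ hα hγ (posSemidef_inv_sub_of_rtr_le hα hG (hτ ▸ h1))
    have h3 : 0 ≤ τ := by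
      obtain ⟨s, -, e⟩ := hγ.exists_conjTranspose_mul_self
      obtain ⟨t, -, e'⟩ := hα.exists_conjTranspose_mul_self
      have : τ = rtr ((s * Yᴴ * tᴴ)ᴴ * (s * Yᴴ * tᴴ)) := by
        rw [hτ, e, e', Matrix.mul_assoc, rtr_mul_comm]
        simp only [conjTranspose_mul, conjTranspose_conjTranspose, Matrix.mul_assoc]
      rw [this]
      exact rtr_conjTranspose_mul_self_nonneg _
    linarith
  · have ht : 0 < τ⁻¹ := inv_pos.2 (by linarith)
    have h2 : rtr (((τ⁻¹ : ℝ) : ℂ) • α * (Y * γ * Yᴴ)) ≤ 1 := by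
      rw [Matrix.smul_mul, rtr_smul, ← hτ, inv_mul_cancel₀ (by linarith)]
    have h3 := h _ γ (hα.ofReal_smul ht) hγ
      (posSemidef_inv_sub_of_rtr_le (hα.ofReal_smul ht) hG h2)
    rw [triplePot_smul hf₁ hf₂ hα ht, Real.log_inv] at h3
    have h4 := mul_log_le_add (κ := κ) h1.le
    have h5 : (∑ i, lp i + ∑ i, mp i - ∑ i, np i) * -Real.log τ = κ * Real.log τ := by
      rw [hκ]; ring
    linarith

end Scaling

section Config

variable {p q : ℕ} {lp mp np : Fin p → ℝ} {lm mm nm : Fin q → ℝ}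

theorem potential_bounded_of_config (hlp : Antitone lp) (hmp : Antitone mp) (hnp : Antitone np)
    (hlm : Antitone lm) (hmm : Antitone mm) (hnm : Antitone nm)
    (hlp0 : ∀ i, 0 < lp i) (hmp0 : ∀ i, 0 < mp i) (hnp0 : ∀ i, 0 < np i)
    (hlm0 : ∀ i, 0 < lm i) (hmm0 : ∀ i, 0 < mm i) (hnm0 : ∀ i, 0 < nm i)
    {f₁ f₂ : Matrix (Fin p) (Fin p) ℂ} {f₁' f₂' : Matrix (Fin q) (Fin q) ℂ}
    (hf₁ : IsUnit f₁.det) (hf₂ : IsUnit f₂.det) (hf₁' : IsUnit f₁'.det) (hf₂' : IsUnit f₂'.det)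
    {A₁ A₂ : Matrix (Fin p) (Fin p) ℂ} {B₁ B₂ Y : Matrix (Fin p) (Fin q) ℂ}
    {C₁ C₂ : Matrix (Fin q) (Fin p) ℂ} {E₁ E₂ : Matrix (Fin q) (Fin q) ℂ}
    (hA₁ : A₁ = diagonal (fun i => (Real.sqrt (lp i) : ℂ)) * f₁ᴴ)
    (hA₂ : A₂ = diagonal (fun i => (Real.sqrt (mp i) : ℂ)) * f₂ᴴ)
    (hE₁ : E₁ = diagonal (fun i => (Real.sqrt (lm i) : ℂ)) * f₁'ᴴ)
    (hE₂ : E₂ = diagonal (fun i => (Real.sqrt (mm i) : ℂ)) * f₂'ᴴ)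
    (h₁ : fromRows A₁ C₁ * (fromRows A₁ C₁)ᴴ - fromRows B₁ E₁ * (fromRows B₁ E₁)ᴴ =
      frameMat (fromRows 1 0) lp - frameMat (fromRows 0 1) lm)
    (h₂ : fromRows A₂ C₂ * (fromRows A₂ C₂)ᴴ - fromRows B₂ E₂ * (fromRows B₂ E₂)ᴴ =
      frameMat (fromRows 1 0) mp - frameMat (fromRows 0 1) mm)
    (hP : (fromRows A₁ C₁)ᴴ * fromRows A₁ C₁ + (fromRows A₂ C₂)ᴴ * fromRows A₂ C₂ =
      diagonal (fun i => (np i : ℂ)))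
    (hQ : (fromRows B₁ E₁)ᴴ * fromRows B₁ E₁ + (fromRows B₂ E₂)ᴴ * fromRows B₂ E₂ =
      diagonal (fun i => (nm i : ℂ)))
    (hY₁ : E₁ᴴ * C₁ + B₁ᴴ * A₁ = Yᴴ) (hY₂ : E₂ᴴ * C₂ + B₂ᴴ * A₂ = -Yᴴ)
    {α : Matrix (Fin p) (Fin p) ℂ} {γ : Matrix (Fin q) (Fin q) ℂ} (hα : α.PosDef) (hγ : γ.PosDef)
    (hle : (α⁻¹ - Y * γ * Yᴴ).PosSemidef) :
    flagLog np (diagonal (fun i => (np i : ℂ))) + flagLog nm (diagonal (fun i => (nm i : ℂ))) -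
      flagLog lp (diagonal (fun i => (lp i : ℂ))) - flagLog lm (diagonal (fun i => (lm i : ℂ))) -
      flagLog mp (diagonal (fun i => (mp i : ℂ))) - flagLog mm (diagonal (fun i => (mm i : ℂ))) -
      (∑ i, nm i) * Real.log 2 - (∑ i, np i) * Real.log 4 ≤
      triplePot lp mp np f₁ f₂ α + triplePot lm mm nm f₁' f₂' γ := by
  have hu : ∀ {m : ℕ} {w : Fin m → ℝ} {f : Matrix (Fin m) (Fin m) ℂ}, (∀ i, 0 < w i) →
      IsUnit f.det → IsUnit (diagonal (fun i => (Real.sqrt (w i) : ℂ)) * fᴴ).det := by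
    intro m w f hw hf
    rw [det_mul, det_conjTranspose]
    exact (isUnit_det_diagonal_sqrt hw).mul hf.star
  have hF : ∀ {m : ℕ} {w : Fin m → ℝ} {f X : Matrix (Fin m) (Fin m) ℂ}, (∀ i, 0 < w i) →
      IsUnit f.det → X.PosDef →
      flagLog w (diagonal (fun i => (Real.sqrt (w i) : ℂ)) * fᴴ * X *
        (diagonal (fun i => (Real.sqrt (w i) : ℂ)) * fᴴ)ᴴ) =
        flagLog w (fᴴ * X * f) + flagLog w (diagonal (fun i => (w i : ℂ))) := by
    intro m w f X hw hf hX
    rw [← flagLog_conj_diagonal_sqrt hw (hX.conj hf), conjTranspose_mul, diagonal_conjTranspose,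
      star_ofReal_comp, conjTranspose_conjTranspose]
    simp only [Matrix.mul_assoc]
  obtain ⟨k₁, hk₁, a₁, b₁, c₁, d₁⟩ := exists_posDef_of_blocks (B := B₁) (C := C₁)
    (hA₁ ▸ hu hlp0 hf₁) (hE₁ ▸ hu hlm0 hf₁') hα hγ
  obtain ⟨k₂, hk₂, a₂, b₂, c₂, d₂⟩ := exists_posDef_of_blocks (B := B₂) (C := C₂)
    (hA₂ ▸ hu hmp0 hf₂) (hE₂ ▸ hu hmm0 hf₂') hα hγ
  have iso₁ : (fromRows (1 : Matrix (Fin p) (Fin p) ℂ) (0 : Matrix (Fin q) (Fin p) ℂ))ᴴ *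
      fromRows (1 : Matrix (Fin p) (Fin p) ℂ) (0 : Matrix (Fin q) (Fin p) ℂ) = 1 := by
    rw [conjTranspose_fromRows_eq_fromCols_conjTranspose, fromCols_mul_fromRows]; simp
  have iso₂ : (fromRows (0 : Matrix (Fin p) (Fin q) ℂ) (1 : Matrix (Fin q) (Fin q) ℂ))ᴴ *
      fromRows (0 : Matrix (Fin p) (Fin q) ℂ) (1 : Matrix (Fin q) (Fin q) ℂ) = 1 := by
    rw [conjTranspose_fromRows_eq_fromCols_conjTranspose, fromCols_mul_fromRows]; simp
  have key := noncompact_potential_bounded hlp hmp hnp hlm hmm hnm (fun i => (hlp0 i).le)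
    (fun i => (hmp0 i).le) hnp0 (fun i => (hlm0 i).le) (fun i => (hmm0 i).le) hnm0
    iso₁ iso₁ iso₂ iso₂ h₁ h₂ hP hQ hk₁ hk₂
  have hs : γ⁻¹ + γ⁻¹ = ((2 : ℝ) : ℂ) • γ⁻¹ := by push_cast; rw [two_smul]
  rw [a₁, a₂, b₁, b₂, c₁, c₂, d₁, d₂, hY₁, hY₂, hs, flagLog_smul nm hγ.inv two_pos] at key
  have hG : (Y * γ * Yᴴ).PosSemidef := hγ.posSemidef.mul_mul_conjTranspose_same Y
  have hb : flagLog np (α⁻¹ + (Yᴴ)ᴴ * γ * Yᴴ + (α⁻¹ + (-Yᴴ)ᴴ * γ * -Yᴴ)) ≤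
      flagLog np α⁻¹ + (∑ i, np i) * Real.log 4 := by
    rw [← flagLog_smul np hα.inv (by norm_num : (0 : ℝ) < 4)]
    have e : α⁻¹ + (Yᴴ)ᴴ * γ * Yᴴ + (α⁻¹ + (-Yᴴ)ᴴ * γ * -Yᴴ) =
        (α⁻¹ + α⁻¹) + (Y * γ * Yᴴ + Y * γ * Yᴴ) := by
      simp only [conjTranspose_neg, conjTranspose_conjTranspose, Matrix.neg_mul, Matrix.mul_neg,
        neg_neg]
      abel
    rw [e]
    refine flagLog_mono hnp (fun i => (hnp0 i).le)
      ((hα.inv.add hα.inv).add_posSemidef (hG.add hG)) (hα.inv.ofReal_smul (by norm_num)) ?_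
    have e' : ((4 : ℝ) : ℂ) • α⁻¹ - (α⁻¹ + α⁻¹ + (Y * γ * Yᴴ + Y * γ * Yᴴ)) =
        (α⁻¹ - Y * γ * Yᴴ) + (α⁻¹ - Y * γ * Yᴴ) := by
      push_cast
      module
    rw [e']
    exact hle.add hle
  subst hA₁ hA₂ hE₁ hE₂
  rw [hF hlp0 hf₁ hα, hF hmp0 hf₂ hα, hF hlm0 hf₁' hγ, hF hmm0 hf₂' hγ] at key
  unfold triplePot
  linarith

theorem compact_of_config (hlp : Antitone lp) (hmp : Antitone mp) (hnp : Antitone np)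
    (hlm : Antitone lm) (hmm : Antitone mm) (hnm : Antitone nm)
    (hlp0 : ∀ i, 0 < lp i) (hmp0 : ∀ i, 0 < mp i) (hnp0 : ∀ i, 0 < np i)
    (hlm0 : ∀ i, 0 < lm i) (hmm0 : ∀ i, 0 < mm i) (hnm0 : ∀ i, 0 < nm i)
    {f₁ f₂ : Matrix (Fin p) (Fin p) ℂ} {f₁' f₂' : Matrix (Fin q) (Fin q) ℂ}
    (hf₁ : IsUnit f₁.det) (hf₂ : IsUnit f₂.det) (hf₁' : IsUnit f₁'.det) (hf₂' : IsUnit f₂'.det)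
    {A₁ A₂ : Matrix (Fin p) (Fin p) ℂ} {B₁ B₂ : Matrix (Fin p) (Fin q) ℂ}
    {C₁ C₂ : Matrix (Fin q) (Fin p) ℂ} {E₁ E₂ : Matrix (Fin q) (Fin q) ℂ}
    (hA₁ : A₁ = diagonal (fun i => (Real.sqrt (lp i) : ℂ)) * f₁ᴴ)
    (hA₂ : A₂ = diagonal (fun i => (Real.sqrt (mp i) : ℂ)) * f₂ᴴ)
    (hE₁ : E₁ = diagonal (fun i => (Real.sqrt (lm i) : ℂ)) * f₁'ᴴ)
    (hE₂ : E₂ = diagonal (fun i => (Real.sqrt (mm i) : ℂ)) * f₂'ᴴ)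
    (h₁ : fromRows A₁ C₁ * (fromRows A₁ C₁)ᴴ - fromRows B₁ E₁ * (fromRows B₁ E₁)ᴴ =
      frameMat (fromRows 1 0) lp - frameMat (fromRows 0 1) lm)
    (h₂ : fromRows A₂ C₂ * (fromRows A₂ C₂)ᴴ - fromRows B₂ E₂ * (fromRows B₂ E₂)ᴴ =
      frameMat (fromRows 1 0) mp - frameMat (fromRows 0 1) mm)
    (hP : (fromRows A₁ C₁)ᴴ * fromRows A₁ C₁ + (fromRows A₂ C₂)ᴴ * fromRows A₂ C₂ =
      diagonal (fun i => (np i : ℂ)))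
    (hQ : (fromRows B₁ E₁)ᴴ * fromRows B₁ E₁ + (fromRows B₂ E₂)ᴴ * fromRows B₂ E₂ =
      diagonal (fun i => (nm i : ℂ)))
    (hPQ : (fromRows B₁ E₁)ᴴ * fromRows A₁ C₁ + (fromRows B₂ E₂)ᴴ * fromRows A₂ C₂ = 0) :
    ∃ (U₁ U₂ : Matrix (Fin p) (Fin p) ℂ) (V₁ V₂ : Matrix (Fin q) (Fin q) ℂ)
      (y : Matrix (Fin p) (Fin q) ℂ), U₁ᴴ * U₁ = 1 ∧ U₂ᴴ * U₂ = 1 ∧ V₁ᴴ * V₁ = 1 ∧ V₂ᴴ * V₂ = 1 ∧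
      diagonal (fun i => (np i : ℂ)) = frameMat U₁ lp + frameMat U₂ mp + y * yᴴ ∧
      diagonal (fun i => (nm i : ℂ)) = frameMat V₁ lm + frameMat V₂ mm + yᴴ * y := by
  have hZ : (E₁ᴴ * C₁ + B₁ᴴ * A₁) + (E₂ᴴ * C₂ + B₂ᴴ * A₂) = 0 := by
    rw [← hPQ]
    simp only [conjTranspose_fromRows_eq_fromCols_conjTranspose, fromCols_mul_fromRows]
    abel
  obtain ⟨C, hC⟩ := potential_bounded_of_normalized (lp := lp) (mp := mp) (np := np) hf₁ hf₂
    (E₁ᴴ * C₁ + B₁ᴴ * A₁)ᴴ (triplePot lm mm nm f₁' f₂') fun α γ hα hγ hle =>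
      potential_bounded_of_config hlp hmp hnp hlm hmm hnm hlp0 hmp0 hnp0 hlm0 hmm0 hnm0 hf₁ hf₂
        hf₁' hf₂' hA₁ hA₂ hE₁ hE₂ h₁ h₂ hP hQ (conjTranspose_conjTranspose _).symm
        (by rw [conjTranspose_conjTranspose]; exact eq_neg_of_add_eq_zero_right hZ) hα hγ hle
  exact exists_compact_of_bounded hlp hmp hnp hlm hmm hnm (fun i => (hlp0 i).le)
    (fun i => (hmp0 i).le) (fun i => (hnp0 i).le) (fun i => (hlm0 i).le) (fun i => (hmm0 i).le)
    (fun i => (hnm0 i).le) hf₁ hf₂ hf₁' hf₂' _ C hC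

end Config

section PseudoUnitary

variable {p q : ℕ}

/-- The signature matrix in block form. -/
def etaBlock (p q : ℕ) : Matrix (Fin p ⊕ Fin q) (Fin p ⊕ Fin q) ℂ := fromBlocks 1 0 0 (-1)

/-- The diagonal matrix with diagonal blocks `a` and `-b`. -/
def signedDiag (a : Fin p → ℝ) (b : Fin q → ℝ) : Matrix (Fin p ⊕ Fin q) (Fin p ⊕ Fin q) ℂ :=
  fromBlocks (diagonal fun i => (a i : ℂ)) 0 0 (-diagonal fun i => (b i : ℂ))

theorem etaBlock_mul_self : etaBlock p q * etaBlock p q = 1 := by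
  rw [etaBlock, fromBlocks_multiply]; simp

theorem etaBlock_conjTranspose : (etaBlock p q)ᴴ = etaBlock p q := by
  rw [etaBlock, fromBlocks_conjTranspose]; simp

theorem fromCols_mul_signedDiag {M : Type*} (U : Matrix M (Fin p) ℂ) (U' : Matrix M (Fin q) ℂ)
    (a : Fin p → ℝ) (b : Fin q → ℝ) :
    fromCols U U' * signedDiag a b * (fromCols U U')ᴴ = frameMat U a - frameMat U' b := by
  rw [signedDiag, fromCols_mul_fromBlocks, conjTranspose_fromCols_eq_fromRows_conjTranspose,
    fromCols_mul_fromRows, frameMat, frameMat]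
  simp [sub_eq_add_neg, -diagonal_neg]

theorem fromCols_mul_etaBlock {M : Type*} (U : Matrix M (Fin p) ℂ) (U' : Matrix M (Fin q) ℂ) :
    fromCols U U' * etaBlock p q * (fromCols U U')ᴴ = U * Uᴴ - U' * U'ᴴ := by
  rw [etaBlock, fromCols_mul_fromBlocks, conjTranspose_fromCols_eq_fromRows_conjTranspose,
    fromCols_mul_fromRows]
  simp [sub_eq_add_neg]

theorem fromCols_conjTranspose_mul_self {M : Type*} [Fintype M] (U : Matrix M (Fin p) ℂ)
    (U' : Matrix M (Fin q) ℂ) :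
    (fromCols U U')ᴴ * fromCols U U' = fromBlocks (Uᴴ * U) (Uᴴ * U') (U'ᴴ * U) (U'ᴴ * U') := by
  rw [conjTranspose_fromCols_eq_fromRows_conjTranspose, fromRows_mul_fromCols]

theorem fromCols_fromRows_one :
    fromCols (fromRows (1 : Matrix (Fin p) (Fin p) ℂ) (0 : Matrix (Fin q) (Fin p) ℂ))
      (fromRows (0 : Matrix (Fin p) (Fin q) ℂ) (1 : Matrix (Fin q) (Fin q) ℂ)) = 1 := by
  rw [fromCols_fromRows_eq_fromBlocks, fromBlocks_one]

theorem isUnit_det_of_gram_eq {n m : Type*} [Fintype n] [DecidableEq n] [Fintype m]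
    {X : Matrix n n ℂ} {Z : Matrix m n ℂ} (h : Xᴴ * X = 1 + Zᴴ * Z) : IsUnit X.det := by
  have h1 : (Xᴴ * X).PosDef := h ▸ PosDef.one.add_posSemidef (posSemidef_conjTranspose_mul_self Z)
  have h2 := h1.isUnit_det
  rw [det_mul] at h2
  exact isUnit_of_mul_isUnit_right h2

theorem config_of_pseudoUnitary {a : Fin p → ℝ} {b : Fin q → ℝ} (ha : ∀ i, 0 < a i)
    (hb : ∀ i, 0 < b i) {g : Matrix (Fin p ⊕ Fin q) (Fin p ⊕ Fin q) ℂ}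
    (hg : gᴴ * etaBlock p q * g = etaBlock p q) :
    ∃ (f A : Matrix (Fin p) (Fin p) ℂ) (f' E : Matrix (Fin q) (Fin q) ℂ)
      (B : Matrix (Fin p) (Fin q) ℂ) (C : Matrix (Fin q) (Fin p) ℂ), IsUnit f.det ∧
      IsUnit f'.det ∧ A = diagonal (fun i => (Real.sqrt (a i) : ℂ)) * fᴴ ∧
      E = diagonal (fun i => (Real.sqrt (b i) : ℂ)) * f'ᴴ ∧
      fromRows A C * (fromRows A C)ᴴ - fromRows B E * (fromRows B E)ᴴ =
        frameMat (fromRows 1 0) a - frameMat (fromRows 0 1) b ∧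
      fromBlocks ((fromRows A C)ᴴ * fromRows A C) ((fromRows A C)ᴴ * fromRows B E)
        ((fromRows B E)ᴴ * fromRows A C) ((fromRows B E)ᴴ * fromRows B E) =
        etaBlock p q * (g * signedDiag a b * g⁻¹) := by
  obtain ⟨Δ, hΔ⟩ : ∃ Δ : Matrix (Fin p ⊕ Fin q) (Fin p ⊕ Fin q) ℂ,
    Δ = fromBlocks (diagonal (fun i => (Real.sqrt (a i) : ℂ))) 0 0
      (diagonal (fun i => (Real.sqrt (b i) : ℂ))) := ⟨_, rfl⟩
  have hΔH : Δᴴ = Δ := by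
    rw [hΔ, fromBlocks_conjTranspose, diagonal_conjTranspose, diagonal_conjTranspose,
      star_ofReal_comp, star_ofReal_comp]
    simp
  have hΔη : Δ * etaBlock p q * Δ = signedDiag a b := by
    rw [hΔ, etaBlock, signedDiag, fromBlocks_multiply, fromBlocks_multiply]
    simp only [Matrix.mul_one, Matrix.mul_zero, Matrix.zero_mul, add_zero, zero_add, Matrix.mul_neg,
      Matrix.neg_mul, neg_zero, diagonal_sqrt_mul_self ha, diagonal_sqrt_mul_self hb]
  have hηΔ : etaBlock p q * Δ = Δ * etaBlock p q := by
    rw [hΔ, etaBlock, fromBlocks_multiply, fromBlocks_multiply]; simp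
  have hηH := etaBlock_conjTranspose (p := p) (q := q)
  have hinv : g⁻¹ = etaBlock p q * gᴴ * etaBlock p q := by
    refine inv_eq_left_inv ?_
    rw [Matrix.mul_assoc, Matrix.mul_assoc, ← Matrix.mul_assoc gᴴ, hg, etaBlock_mul_self]
  have hl : etaBlock p q * gᴴ * etaBlock p q * g = 1 := by
    rw [Matrix.mul_assoc, Matrix.mul_assoc, ← Matrix.mul_assoc gᴴ, hg, etaBlock_mul_self]
  obtain ⟨W, hW⟩ : ∃ W, W = Δ * (etaBlock p q * gᴴ * etaBlock p q) := ⟨_, rfl⟩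
  have hWη : W * etaBlock p q * Wᴴ = signedDiag a b := by
    rw [← hΔη, hW]
    simp only [conjTranspose_mul, conjTranspose_conjTranspose, hηH, hΔH]
    calc _ = Δ * ((etaBlock p q * gᴴ * etaBlock p q) * (etaBlock p q * etaBlock p q) * g *
          etaBlock p q) * Δ := by simp only [Matrix.mul_assoc]
      _ = _ := by rw [etaBlock_mul_self, Matrix.mul_one, hl, Matrix.one_mul]
  have hWW : Wᴴ * W = etaBlock p q * (g * signedDiag a b * g⁻¹) := by
    rw [hinv, ← hΔη, hW]
    simp only [conjTranspose_mul, conjTranspose_conjTranspose, hηH, hΔH]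
    calc _ = etaBlock p q * (g * (etaBlock p q * Δ * Δ) *
          (etaBlock p q * gᴴ * etaBlock p q)) := by simp only [Matrix.mul_assoc]
      _ = _ := by rw [hηΔ]
  have hgb := fromBlocks_toBlocks g
  obtain ⟨g11, hg11⟩ : ∃ x, x = g.toBlocks₁₁ := ⟨_, rfl⟩
  obtain ⟨g12, hg12⟩ : ∃ x, x = g.toBlocks₁₂ := ⟨_, rfl⟩
  obtain ⟨g21, hg21⟩ : ∃ x, x = g.toBlocks₂₁ := ⟨_, rfl⟩
  obtain ⟨g22, hg22⟩ : ∃ x, x = g.toBlocks₂₂ := ⟨_, rfl⟩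
  rw [← hg11, ← hg12, ← hg21, ← hg22] at hgb
  rw [← hgb, etaBlock, fromBlocks_conjTranspose, fromBlocks_multiply, fromBlocks_multiply,
    fromBlocks_inj] at hg
  simp only [Matrix.mul_one, Matrix.mul_zero, add_zero, zero_add, Matrix.mul_neg,
    Matrix.neg_mul] at hg
  obtain ⟨e₁, -, -, e₂⟩ := hg
  have hWb : W = fromBlocks (diagonal (fun i => (Real.sqrt (a i) : ℂ)) * g11ᴴ)
      (-(diagonal (fun i => (Real.sqrt (a i) : ℂ)) * g21ᴴ))
      (-(diagonal (fun i => (Real.sqrt (b i) : ℂ)) * g12ᴴ))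
      (diagonal (fun i => (Real.sqrt (b i) : ℂ)) * g22ᴴ) := by
    rw [hW, ← hgb, hΔ, etaBlock, fromBlocks_conjTranspose, fromBlocks_multiply,
      fromBlocks_multiply, fromBlocks_multiply]
    simp
  rw [← fromCols_fromRows_eq_fromBlocks] at hWb
  refine ⟨g11, _, g22, _, -(diagonal (fun i => (Real.sqrt (a i) : ℂ)) * g21ᴴ),
    -(diagonal (fun i => (Real.sqrt (b i) : ℂ)) * g12ᴴ), isUnit_det_of_gram_eq (Z := g21) ?_,
    isUnit_det_of_gram_eq (Z := g12) ?_, rfl, rfl, ?_, ?_⟩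
  · exact eq_add_of_add_neg_eq e₁
  · rw [← sub_eq_zero] at e₂ ⊢
    rw [← neg_eq_zero, ← e₂]
    abel
  · rw [← fromCols_mul_etaBlock, ← hWb, hWη, ← fromCols_mul_signedDiag, fromCols_fromRows_one,
      conjTranspose_one, Matrix.one_mul, Matrix.mul_one]
  · rw [← fromCols_conjTranspose_mul_self, ← hWb, hWW]

theorem compact_of_pseudoUnitary {lp mp np : Fin p → ℝ} {lm mm nm : Fin q → ℝ}
    (hlp : Antitone lp) (hmp : Antitone mp) (hnp : Antitone np)
    (hlm : Antitone lm) (hmm : Antitone mm) (hnm : Antitone nm)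
    (hlp0 : ∀ i, 0 < lp i) (hmp0 : ∀ i, 0 < mp i) (hlm0 : ∀ i, 0 < lm i) (hmm0 : ∀ i, 0 < mm i)
    {g h : Matrix (Fin p ⊕ Fin q) (Fin p ⊕ Fin q) ℂ}
    (hg : gᴴ * etaBlock p q * g = etaBlock p q) (hh : hᴴ * etaBlock p q * h = etaBlock p q)
    (hν : signedDiag np nm = g * signedDiag lp lm * g⁻¹ + h * signedDiag mp mm * h⁻¹) :
    ∃ (U₁ U₂ : Matrix (Fin p) (Fin p) ℂ) (V₁ V₂ : Matrix (Fin q) (Fin q) ℂ)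
      (y : Matrix (Fin p) (Fin q) ℂ), U₁ᴴ * U₁ = 1 ∧ U₂ᴴ * U₂ = 1 ∧ V₁ᴴ * V₁ = 1 ∧ V₂ᴴ * V₂ = 1 ∧
      diagonal (fun i => (np i : ℂ)) = frameMat U₁ lp + frameMat U₂ mp + y * yᴴ ∧
      diagonal (fun i => (nm i : ℂ)) = frameMat V₁ lm + frameMat V₂ mm + yᴴ * y := by
  obtain ⟨f₁, A₁, f₁', E₁, B₁, C₁, hf₁, hf₁', hA₁, hE₁, h₁, k₁⟩ :=
    config_of_pseudoUnitary hlp0 hlm0 hg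
  obtain ⟨f₂, A₂, f₂', E₂, B₂, C₂, hf₂, hf₂', hA₂, hE₂, h₂, k₂⟩ :=
    config_of_pseudoUnitary hmp0 hmm0 hh
  have hs := congrArg (etaBlock p q * ·) hν
  simp only [Matrix.mul_add] at hs
  rw [← k₁, ← k₂, fromBlocks_add, signedDiag, etaBlock, fromBlocks_multiply, fromBlocks_inj] at hs
  simp only [Matrix.one_mul, Matrix.mul_zero, Matrix.zero_mul, add_zero, zero_add, neg_zero,
    Matrix.neg_mul, Matrix.mul_neg, neg_neg] at hs
  obtain ⟨hP, -, hPQ, hQ⟩ := hs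
  have hpos : ∀ {m k : ℕ} {w : Fin m → ℝ} {A : Matrix (Fin m) (Fin m) ℂ}
      {X : Matrix (Fin k) (Fin m) ℂ} {Z : Matrix (Fin p ⊕ Fin q) (Fin m) ℂ}, IsUnit A.det →
      diagonal (fun i => (w i : ℂ)) = Aᴴ * A + (Xᴴ * X + Zᴴ * Z) → ∀ i, 0 < w i := by
    intro m k w A X Z hA e i
    have h1 : (diagonal (fun i => (w i : ℂ))).PosDef := e ▸ (posDef_conjTranspose_mul_self
      hA).add_posSemidef
      ((posSemidef_conjTranspose_mul_self X).add (posSemidef_conjTranspose_mul_self Z))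
    simpa using h1.diag_pos (i := i)
  have hu : ∀ {m : ℕ} {w : Fin m → ℝ} {f : Matrix (Fin m) (Fin m) ℂ}, (∀ i, 0 < w i) →
      IsUnit f.det → IsUnit (diagonal (fun i => (Real.sqrt (w i) : ℂ)) * fᴴ).det := by
    intro m w f hw hf
    rw [det_mul, det_conjTranspose]
    exact (isUnit_det_diagonal_sqrt hw).mul hf.star
  have hnp0 : ∀ i, 0 < np i := by
    refine hpos (hA₁ ▸ hu hlp0 hf₁) (hP.trans ?_) (X := C₁) (Z := fromRows A₂ C₂)
    rw [conjTranspose_fromRows_eq_fromCols_conjTranspose A₁, fromCols_mul_fromRows, add_assoc]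
  have hnm0 : ∀ i, 0 < nm i := by
    refine hpos (hE₁ ▸ hu hlm0 hf₁') (hQ.trans ?_) (X := B₁) (Z := fromRows B₂ E₂)
    rw [conjTranspose_fromRows_eq_fromCols_conjTranspose B₁, fromCols_mul_fromRows,
      add_comm (B₁ᴴ * B₁), add_assoc]
  exact compact_of_config hlp hmp hnp hlm hmm hnm hlp0 hmp0 hnp0 hlm0 hmm0 hnm0 hf₁ hf₂ hf₁' hf₂'
    hA₁ hA₂ hE₁ hE₂ h₁ h₂ hP.symm hQ.symm hPQ.symm

end PseudoUnitary

section CompactLowerBound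

theorem rtr_diagonal_mul_conj {n m : Type*} [Fintype n] [DecidableEq n] [Fintype m] [DecidableEq m]
    (a : n → ℝ) (b : m → ℝ) (X : Matrix n m ℂ) :
    rtr (diagonal (fun i => (a i : ℂ)) * (X * diagonal (fun j => (b j : ℂ)) * Xᴴ)) =
      ∑ i, ∑ j, a i * b j * Complex.normSq (X i j) := by
  rw [rtr_eq_sum]
  refine Finset.sum_congr rfl fun i _ => ?_
  rw [diagonal_mul, mul_apply, Complex.re_ofReal_mul, Complex.re_sum, Finset.mul_sum]
  refine Finset.sum_congr rfl fun j _ => ?_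
  rw [mul_diagonal, conjTranspose_apply, Complex.star_def, mul_right_comm, Complex.mul_conj,
    ← Complex.ofReal_mul, Complex.ofReal_re]
  ring

variable {p q : ℕ} {lp mp np : Fin p → ℝ} {lm mm nm : Fin q → ℝ}

theorem flagLog_add_ge_of_frames {m : ℕ} {a b c : Fin m → ℝ} (ha : Antitone a) (hb : Antitone b)
    (hc : Antitone c) (ha0 : ∀ i, 0 ≤ a i) (hb0 : ∀ i, 0 ≤ b i) (hc0 : ∀ i, 0 ≤ c i)
    {U₁ U₂ H : Matrix (Fin m) (Fin m) ℂ} (hU₁ : U₁ᴴ * U₁ = 1) (hU₂ : U₂ᴴ * U₂ = 1)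
    (h : diagonal (fun i => (c i : ℂ)) = frameMat U₁ a + frameMat U₂ b + H)
    {W : Matrix (Fin m) (Fin m) ℂ} (hW' : Wᴴ * W = 1) (hW : W * Wᴴ = 1) {θ : Fin m → ℝ}
    (hθ : ∀ j, 0 < θ j) :
    -rtr (diagonal (fun j => (Real.log (θ j) : ℂ)) * (Wᴴ * H * W)) ≤
      triplePot a b c U₁ U₂ (W * diagonal (fun j => (θ j : ℂ)) * Wᴴ) := by
  have h₁ := peierls ha ha0 hU₁ hW hθ
  have h₂ := peierls hb hb0 hU₂ hW hθ
  have h₃ := peierls_inv hc hc0 (S := 1) (by simp) hW' hW hθ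
  simp only [Matrix.one_mul, Matrix.mul_one, conjTranspose_one, h] at h₃
  have e : rtr (diagonal (fun j => (Real.log (θ j) : ℂ)) * (Wᴴ * H * W)) =
      rtr (W * diagonal (fun j => (Real.log (θ j) : ℂ)) * Wᴴ * H) := by
    rw [← Matrix.mul_assoc, rtr_mul_comm]
    simp only [Matrix.mul_assoc]
  rw [Matrix.mul_add, Matrix.mul_add, rtr_add, rtr_add, ← e] at h₃
  unfold triplePot
  simp only [frameMat] at h₃
  linarith

/-- The compact potential attached to a solution of the compact equation is bounded below by the
coupling term. -/
theorem neg_rtr_le_triplePot_add (hlp : Antitone lp) (hmp : Antitone mp) (hnp : Antitone np)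
    (hlm : Antitone lm) (hmm : Antitone mm) (hnm : Antitone nm)
    (hlp0 : ∀ i, 0 ≤ lp i) (hmp0 : ∀ i, 0 ≤ mp i) (hnp0 : ∀ i, 0 ≤ np i)
    (hlm0 : ∀ i, 0 ≤ lm i) (hmm0 : ∀ i, 0 ≤ mm i) (hnm0 : ∀ i, 0 ≤ nm i)
    {U₁ U₂ : Matrix (Fin p) (Fin p) ℂ} {V₁ V₂ : Matrix (Fin q) (Fin q) ℂ}
    {Y : Matrix (Fin p) (Fin q) ℂ} (hU₁ : U₁ᴴ * U₁ = 1) (hU₂ : U₂ᴴ * U₂ = 1)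
    (hV₁ : V₁ᴴ * V₁ = 1) (hV₂ : V₂ᴴ * V₂ = 1)
    (hnpeq : diagonal (fun i => (np i : ℂ)) = frameMat U₁ lp + frameMat U₂ mp + Y * Yᴴ)
    (hnmeq : diagonal (fun i => (nm i : ℂ)) = frameMat V₁ lm + frameMat V₂ mm + Yᴴ * Y)
    {α : Matrix (Fin p) (Fin p) ℂ} {γ : Matrix (Fin q) (Fin q) ℂ} (hα : α.PosDef) (hγ : γ.PosDef) :
    -rtr (α * (Y * γ * Yᴴ)) ≤ triplePot lp mp np U₁ U₂ α + triplePot lm mm nm V₁ V₂ γ := by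
  obtain ⟨W, θ, hW', hW, hθ, rfl⟩ := hα.exists_diagonalization
  obtain ⟨Z, φ, hZ', hZ, hφ, rfl⟩ := hγ.exists_diagonalization
  have h₁ := flagLog_add_ge_of_frames hlp hmp hnp hlp0 hmp0 hnp0 hU₁ hU₂ hnpeq hW' hW hθ
  have h₂ := flagLog_add_ge_of_frames hlm hmm hnm hlm0 hmm0 hnm0 hV₁ hV₂ hnmeq hZ' hZ hφ
  obtain ⟨X, hX⟩ : ∃ X, X = Wᴴ * Y * Z := ⟨_, rfl⟩
  have e₁ : Wᴴ * (Y * Yᴴ) * W = X * diagonal (fun _ : Fin q => ((1 : ℝ) : ℂ)) * Xᴴ := by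
    rw [Complex.ofReal_one, diagonal_one, Matrix.mul_one, hX]
    simp only [conjTranspose_mul, conjTranspose_conjTranspose]
    calc _ = Wᴴ * Y * (Z * Zᴴ) * Yᴴ * W := by rw [hZ, Matrix.mul_one]; simp only [Matrix.mul_assoc]
      _ = _ := by simp only [Matrix.mul_assoc]
  have e₂ : Zᴴ * (Yᴴ * Y) * Z = Xᴴ * diagonal (fun _ : Fin p => ((1 : ℝ) : ℂ)) * (Xᴴ)ᴴ := by
    rw [Complex.ofReal_one, diagonal_one, Matrix.mul_one, hX]
    simp only [conjTranspose_mul, conjTranspose_conjTranspose]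
    calc _ = Zᴴ * Yᴴ * (W * Wᴴ) * Y * Z := by rw [hW, Matrix.mul_one]; simp only [Matrix.mul_assoc]
      _ = _ := by simp only [Matrix.mul_assoc]
  have e₃ : rtr (W * diagonal (fun j => (θ j : ℂ)) * Wᴴ *
      (Y * (Z * diagonal (fun j => (φ j : ℂ)) * Zᴴ) * Yᴴ)) =
      rtr (diagonal (fun j => (θ j : ℂ)) * (X * diagonal (fun j => (φ j : ℂ)) * Xᴴ)) := by
    rw [Matrix.mul_assoc W, Matrix.mul_assoc W, rtr_mul_comm, hX]
    simp only [conjTranspose_mul, conjTranspose_conjTranspose, Matrix.mul_assoc]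
  rw [e₁, rtr_diagonal_mul_conj] at h₁
  rw [e₂, rtr_diagonal_mul_conj, Finset.sum_comm] at h₂
  rw [e₃, rtr_diagonal_mul_conj]
  refine le_trans ?_ (add_le_add h₁ h₂)
  rw [← neg_add, neg_le_neg_iff, ← Finset.sum_add_distrib]
  refine Finset.sum_le_sum fun i _ => ?_
  rw [← Finset.sum_add_distrib]
  refine Finset.sum_le_sum fun j _ => ?_
  have hl : Real.log (θ i) + Real.log (φ j) ≤ θ i * φ j := by
    rw [← Real.log_mul (hθ i).ne' (hφ j).ne']
    exact Real.log_le_self (mul_pos (hθ i) (hφ j)).le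
  rw [conjTranspose_apply, Complex.star_def, Complex.normSq_conj, mul_one, mul_one, ← add_mul]
  exact mul_le_mul_of_nonneg_right hl (Complex.normSq_nonneg _)

end CompactLowerBound

section NoncompactLowerBound

theorem posSemidef_sub_of_gram {N m r : Type*} [Fintype N] [DecidableEq N] [Fintype m]
    [DecidableEq m] [Fintype r] {k : Matrix N N ℂ} (hk : k.PosDef) {S γ : Matrix m m ℂ}
    (hS : S.PosSemidef) (hγ : γ.PosDef) {T : Matrix N m ℂ} (hG : γ⁻¹ = Tᴴ * k * T + S)
    (X : Matrix N r ℂ) : (Xᴴ * k⁻¹ * X - (Tᴴ * X)ᴴ * γ * (Tᴴ * X)).PosSemidef := by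
  have hku := hk.isUnit_det
  have hγu := hγ.isUnit_det
  have h1 := (hk.inv.posSemidef.conjTranspose_mul_mul_same (X - k * T * γ * (Tᴴ * X)))
  have h2 := hS.conjTranspose_mul_mul_same (γ * (Tᴴ * X))
  have e : Xᴴ * k⁻¹ * X - (Tᴴ * X)ᴴ * γ * (Tᴴ * X) =
      (X - k * T * γ * (Tᴴ * X))ᴴ * k⁻¹ * (X - k * T * γ * (Tᴴ * X)) +
        (γ * (Tᴴ * X))ᴴ * S * (γ * (Tᴴ * X)) := by
    have hSe : S = γ⁻¹ - Tᴴ * k * T := eq_sub_of_add_eq' hG.symm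
    have h3 : ∀ A : Matrix N r ℂ, k⁻¹ * (k * A) = A := fun A => by
      rw [← Matrix.mul_assoc, nonsing_inv_mul _ hku, Matrix.one_mul]
    have h3' : ∀ A : Matrix N r ℂ, k * (k⁻¹ * A) = A := fun A => by
      rw [← Matrix.mul_assoc, mul_nonsing_inv _ hku, Matrix.one_mul]
    have h4 : ∀ A : Matrix m r ℂ, γ⁻¹ * (γ * A) = A := fun A => by
      rw [← Matrix.mul_assoc, nonsing_inv_mul _ hγu, Matrix.one_mul]
    rw [hSe]
    simp only [conjTranspose_sub, conjTranspose_mul, conjTranspose_conjTranspose,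
      hk.isHermitian.eq, hγ.isHermitian.eq, Matrix.sub_mul, Matrix.mul_sub, Matrix.mul_assoc, h3,
      h3', h4]
    abel
  rw [e]
  exact h1.add h2

theorem Matrix.PosDef.conj_of_leftInverse {N m : Type*} [Fintype N] [DecidableEq N] [Fintype m]
    [DecidableEq m] {k : Matrix N N ℂ} (hk : k.PosDef) {T : Matrix N m ℂ} {L : Matrix m N ℂ}
    (hL : L * T = 1) : (Tᴴ * k * T).PosDef :=
  hk.conjTranspose_mul_mul_same
    (Function.LeftInverse.injective (g := L.mulVec) fun x => by simp [hL])

variable {N : Type*} [Fintype N] [DecidableEq N] {p q : ℕ} {lp mp np : Fin p → ℝ}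
  {lm mm nm : Fin q → ℝ}

/-- The logarithmic potential on pairs of positive matrices governing the equation for
pseudo-unitary orbits. -/
def pairPot (lp mp np : Fin p → ℝ) (lm mm nm : Fin q → ℝ) (E₁ E₂ P₁ P₂ : Matrix N (Fin p) ℂ)
    (E₁' E₂' Q₁ Q₂ : Matrix N (Fin q) ℂ) (k₁ k₂ : Matrix N N ℂ) : ℝ :=
  flagLog lp (E₁ᴴ * k₁ * E₁) + flagLog lm (E₁'ᴴ * k₁⁻¹ * E₁') +
    (flagLog mp (E₂ᴴ * k₂ * E₂) + flagLog mm (E₂'ᴴ * k₂⁻¹ * E₂')) +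
    flagLog nm (Q₁ᴴ * k₁ * Q₁ + Q₂ᴴ * k₂ * Q₂) +
    flagLog np (P₁ᴴ * k₁⁻¹ * P₁ + P₂ᴴ * k₂⁻¹ * P₂)

theorem neg_card_le_pairPot (hlp : Antitone lp) (hmp : Antitone mp) (hnp : Antitone np)
    (hlm : Antitone lm) (hmm : Antitone mm) (hnm : Antitone nm)
    (hlp0 : ∀ i, 0 ≤ lp i) (hmp0 : ∀ i, 0 ≤ mp i) (hnp0 : ∀ i, 0 ≤ np i)
    (hlm0 : ∀ i, 0 ≤ lm i) (hmm0 : ∀ i, 0 ≤ mm i) (hnm0 : ∀ i, 0 ≤ nm i)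
    {U₁ U₂ : Matrix (Fin p) (Fin p) ℂ} {V₁ V₂ : Matrix (Fin q) (Fin q) ℂ}
    {Y : Matrix (Fin p) (Fin q) ℂ} (hU₁ : U₁ᴴ * U₁ = 1) (hU₂ : U₂ᴴ * U₂ = 1)
    (hV₁ : V₁ᴴ * V₁ = 1) (hV₂ : V₂ᴴ * V₂ = 1)
    (hnpeq : diagonal (fun i => (np i : ℂ)) = frameMat U₁ lp + frameMat U₂ mp + Y * Yᴴ)
    (hnmeq : diagonal (fun i => (nm i : ℂ)) = frameMat V₁ lm + frameMat V₂ mm + Yᴴ * Y)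
    {E T₁ T₂ : Matrix N (Fin p) ℂ} {E' : Matrix N (Fin q) ℂ} (hE : Eᴴ * E = 1) (hE' : E'ᴴ * E' = 1)
    (hT₁ : Eᴴ * T₁ = 1) (hT₂ : Eᴴ * T₂ = 1) (hY : E'ᴴ * T₁ = Yᴴ)
    {k₁ k₂ : Matrix N N ℂ} (hk₁ : k₁.PosDef) (hk₂ : k₂.PosDef) :
    -(p : ℝ) ≤ pairPot lp mp np lm mm nm (E * U₁) (E * U₂) T₁ T₂ (E' * V₁) (E' * V₂) E' E'
      k₁ k₂ := by
  have hG : (E'ᴴ * k₁ * E' + E'ᴴ * k₂ * E').PosDef :=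
    (hk₁.isometry_conj hE').add (hk₂.isometry_conj hE')
  have hA : (T₁ᴴ * k₁⁻¹ * T₁ + T₂ᴴ * k₂⁻¹ * T₂).PosDef :=
    (hk₁.inv.conj_of_leftInverse hT₁).add (hk₂.inv.conj_of_leftInverse hT₂)
  have uU : ∀ {m : ℕ} {U : Matrix (Fin m) (Fin m) ℂ}, Uᴴ * U = 1 → IsUnit U.det := by
    intro m U hU
    exact isUnit_det_of_left_inverse hU
  obtain ⟨γ, hγ⟩ : ∃ γ, γ = (E'ᴴ * k₁ * E' + E'ᴴ * k₂ * E')⁻¹ := ⟨_, rfl⟩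
  obtain ⟨α, hα⟩ : ∃ α, α = (T₁ᴴ * k₁⁻¹ * T₁ + T₂ᴴ * k₂⁻¹ * T₂)⁻¹ := ⟨_, rfl⟩
  have hγp : γ.PosDef := hγ ▸ hG.inv
  have hαp : α.PosDef := hα ▸ hA.inv
  have hγi : γ⁻¹ = E'ᴴ * k₁ * E' + E'ᴴ * k₂ * E' := by
    rw [hγ, nonsing_inv_nonsing_inv _ hG.isUnit_det]
  have hαi : α⁻¹ = T₁ᴴ * k₁⁻¹ * T₁ + T₂ᴴ * k₂⁻¹ * T₂ := by
    rw [hα, nonsing_inv_nonsing_inv _ hA.isUnit_det]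
  have hT : ∀ {T : Matrix N (Fin p) ℂ}, Eᴴ * T = 1 → Tᴴ * E = 1 := by
    intro T h
    rw [← conjTranspose_conjTranspose E, ← conjTranspose_mul, h, conjTranspose_one]
  have a₁ := posSemidef_sub_of_gram hk₁.inv
    (hk₂.inv.conj_of_leftInverse hT₂).posSemidef hαp hαi E
  have a₂ := posSemidef_sub_of_gram hk₂.inv
    (hk₁.inv.conj_of_leftInverse hT₁).posSemidef hαp (hαi.trans (add_comm _ _)) E
  have c₁ := posSemidef_sub_of_gram hk₁ (hk₂.isometry_conj hE').posSemidef hγp hγi E'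
  have c₂ := posSemidef_sub_of_gram hk₂ (hk₁.isometry_conj hE').posSemidef hγp
    (hγi.trans (add_comm _ _)) E'
  have t := posSemidef_sub_of_gram hk₁ (hk₂.isometry_conj hE').posSemidef hγp hγi T₁
  rw [hT hT₁, nonsing_inv_nonsing_inv _ hk₁.isUnit_det, conjTranspose_one, Matrix.one_mul,
    Matrix.mul_one] at a₁
  rw [hT hT₂, nonsing_inv_nonsing_inv _ hk₂.isUnit_det, conjTranspose_one, Matrix.one_mul,
    Matrix.mul_one] at a₂
  rw [hE', conjTranspose_one, Matrix.one_mul, Matrix.mul_one] at c₁ c₂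
  rw [hY, conjTranspose_conjTranspose] at t
  have mono : ∀ {m : ℕ} {w : Fin m → ℝ} {D : Matrix N (Fin m) ℂ} {U x : Matrix (Fin m) (Fin m) ℂ}
      {k : Matrix N N ℂ}, Antitone w → (∀ i, 0 ≤ w i) → Dᴴ * D = 1 → Uᴴ * U = 1 → k.PosDef →
      x.PosDef → (Dᴴ * k * D - x).PosSemidef →
      flagLog w (Uᴴ * x * U) ≤ flagLog w ((D * U)ᴴ * k * (D * U)) := by
    intro m w D U x k hw hw0 hD hU hk hx hle
    have e : (D * U)ᴴ * k * (D * U) = Uᴴ * (Dᴴ * k * D) * U := by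
      simp only [conjTranspose_mul, Matrix.mul_assoc]
    rw [e]
    refine flagLog_mono hw hw0 (hx.conj (uU hU)) ((hk.isometry_conj hD).conj (uU hU)) ?_
    rw [← Matrix.sub_mul, ← Matrix.mul_sub]
    exact hle.conjTranspose_mul_mul_same U
  have m₁ := mono hlp hlp0 hE hU₁ hk₁ hαp a₁
  have m₂ := mono hmp hmp0 hE hU₂ hk₂ hαp a₂
  have m₁' := mono hlm hlm0 hE' hV₁ hk₁.inv hγp c₁
  have m₂' := mono hmm hmm0 hE' hV₂ hk₂.inv hγp c₂
  have key := neg_rtr_le_triplePot_add hlp hmp hnp hlm hmm hnm hlp0 hmp0 hnp0 hlm0 hmm0 hnm0 hU₁ hU₂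
    hV₁ hV₂ hnpeq hnmeq hαp hγp
  have hτ : rtr (α * (Y * γ * Yᴴ)) ≤ p := by
    have h1 : (α⁻¹ - Y * γ * Yᴴ).PosSemidef := by
      have := t.add (hk₂.inv.conj_of_leftInverse hT₂).posSemidef
      rwa [sub_add_eq_add_sub, ← hαi] at this
    obtain ⟨s, -, e⟩ := hαp.exists_conjTranspose_mul_self
    have h2 : 0 ≤ rtr (α * (α⁻¹ - Y * γ * Yᴴ)) := by
      have h3 := (h1.mul_mul_conjTranspose_same s).trace_nonneg
      rw [e, Matrix.mul_assoc, rtr_mul_comm, ← e]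
      exact (Complex.le_def.1 h3).1
    have h4 : rtr (1 : Matrix (Fin p) (Fin p) ℂ) = p := by simp [rtr]
    rw [Matrix.mul_sub, mul_nonsing_inv _ hαp.isUnit_det, rtr_sub, h4] at h2
    linarith
  unfold triplePot at key
  rw [hαi, hγi] at key
  unfold pairPot
  linarith

end NoncompactLowerBound

section PairMinimizer

variable {N : Type*} [Fintype N] [DecidableEq N]

theorem exists_frame_perturb {m : ℕ} {w : Fin m → ℝ} (hw : Antitone w) (hw0 : ∀ i, 0 ≤ w i)
    {A : Matrix N (Fin m) ℂ} (hA : (Aᴴ * A).PosDef) :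
    ∃ (U : Matrix N (Fin m) ℂ) (R : Matrix (Fin m) (Fin m) ℂ), IsUnit R.det ∧ Uᴴ * U = 1 ∧
      A = U * R ∧ ∀ ξ : Matrix N N ℂ, ξ.IsHermitian → rtr (ξ * ξ) ≤ 1 / 4 →
        flagLog w (Aᴴ * (1 + ξ) * A) ≤ flagLog w (Aᴴ * A) + rtr (ξ * frameMat U w) ∧
        flagLog w (Aᴴ * (1 + ξ)⁻¹ * A) ≤ flagLog w (Aᴴ * A) - rtr (ξ * frameMat U w) +
          2 * (∑ i, w i) * rtr (ξ * ξ) := by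
  obtain ⟨U, R, hR, hu, hU, rfl⟩ := exists_isometry_mul_upper hA
  exact ⟨U, R, hu, hU, rfl, fun ξ hξ ht => ⟨flagLog_perturb hw hw0 hR hu hU hξ ht,
    flagLog_perturb_inv hw hw0 hR hu hU hξ ht⟩⟩

theorem frames_orthogonal {m m' : Type*} [Fintype m] [DecidableEq m] [Fintype m'] [DecidableEq m']
    {U : Matrix N m ℂ} {U' : Matrix N m' ℂ} {R : Matrix m m ℂ} {R' : Matrix m' m' ℂ}
    (hR : IsUnit R.det) (hR' : IsUnit R'.det) (h : (U * R)ᴴ * (U' * R') = 0) : Uᴴ * U' = 0 := by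
  have hRH : IsUnit (Rᴴ).det := by rw [det_conjTranspose]; exact hR.star
  calc Uᴴ * U' = (Rᴴ)⁻¹ * (Rᴴ * Uᴴ) * (U' * R' * R'⁻¹) := by
        rw [← Matrix.mul_assoc (Rᴴ)⁻¹, nonsing_inv_mul _ hRH, Matrix.one_mul,
          Matrix.mul_assoc U', mul_nonsing_inv _ hR', Matrix.mul_one]
    _ = (Rᴴ)⁻¹ * ((U * R)ᴴ * (U' * R')) * R'⁻¹ := by
        simp only [conjTranspose_mul, Matrix.mul_assoc]
    _ = 0 := by rw [h, Matrix.mul_zero, Matrix.zero_mul]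

theorem fromCols_isometry {p q : ℕ} {U : Matrix N (Fin p) ℂ} {U' : Matrix N (Fin q) ℂ}
    (hU : Uᴴ * U = 1) (hU' : U'ᴴ * U' = 1) (h : Uᴴ * U' = 0) :
    (fromCols U U')ᴴ * fromCols U U' = 1 := by
  have h' : U'ᴴ * U = 0 := by
    rw [← conjTranspose_conjTranspose U, ← conjTranspose_mul, h, conjTranspose_zero]
  rw [fromCols_conjTranspose_mul_self, hU, hU', h, h', fromBlocks_one]

theorem trace_fromBlocks_eq (A B C D : Matrix N N ℂ) :
    (fromBlocks A B C D).trace = A.trace + D.trace := by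
  simp [trace]

theorem rtr_fromBlocks_mul_frameMat {m : Type*} [Fintype m] [DecidableEq m]
    (ξ₁ ξ₂ : Matrix N N ℂ) (S : Matrix (N ⊕ N) m ℂ) (w : m → ℝ) :
    rtr (fromBlocks ξ₁ 0 0 ξ₂ * frameMat S w) =
      rtr (ξ₁ * frameMat S.toRows₁ w) + rtr (ξ₂ * frameMat S.toRows₂ w) := by
  conv_lhs => rw [← fromRows_toRows S]
  rw [frameMat, fromRows_mul, conjTranspose_fromRows_eq_fromCols_conjTranspose,
    fromRows_mul_fromCols, fromBlocks_multiply, rtr, trace_fromBlocks_eq]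
  simp [rtr, frameMat]

theorem rtr_fromBlocks_mul_self (ξ₁ ξ₂ : Matrix N N ℂ) :
    rtr (fromBlocks ξ₁ 0 0 ξ₂ * fromBlocks ξ₁ 0 0 ξ₂) = rtr (ξ₁ * ξ₁) + rtr (ξ₂ * ξ₂) := by
  rw [fromBlocks_multiply, rtr, trace_fromBlocks_eq]
  simp [rtr]

theorem one_add_fromBlocks (ξ₁ ξ₂ : Matrix N N ℂ) :
    1 + fromBlocks ξ₁ 0 0 ξ₂ = fromBlocks (1 + ξ₁) 0 0 (1 + ξ₂) := by
  rw [← fromBlocks_one, fromBlocks_add, add_zero]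

theorem toRows_mul_signedDiag {p q : ℕ} (S' : Matrix (N ⊕ N) (Fin p) ℂ)
    (S : Matrix (N ⊕ N) (Fin q) ℂ) (a : Fin p → ℝ) (b : Fin q → ℝ) :
    (fromCols S' S).toRows₁ * signedDiag a b * (fromCols S' S).toRows₁ᴴ =
        frameMat S'.toRows₁ a - frameMat S.toRows₁ b ∧
      (fromCols S' S).toRows₂ * signedDiag a b * (fromCols S' S).toRows₂ᴴ =
        frameMat S'.toRows₂ a - frameMat S.toRows₂ b := by
  have h1 : (fromCols S' S).toRows₁ = fromCols S'.toRows₁ S.toRows₁ := by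
    ext i (j | j) <;> rfl
  have h2 : (fromCols S' S).toRows₂ = fromCols S'.toRows₂ S.toRows₂ := by
    ext i (j | j) <;> rfl
  rw [h1, h2]
  exact ⟨fromCols_mul_signedDiag _ _ a b, fromCols_mul_signedDiag _ _ a b⟩

variable {p q : ℕ} {lp mp np : Fin p → ℝ} {lm mm nm : Fin q → ℝ}

theorem signedDiag_isHermitian (a : Fin p → ℝ) (b : Fin q → ℝ) :
    (signedDiag a b).IsHermitian := by
  rw [IsHermitian, signedDiag, fromBlocks_conjTranspose, conjTranspose_neg, diagonal_conjTranspose,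
    diagonal_conjTranspose, star_ofReal_comp, star_ofReal_comp, conjTranspose_zero,
    conjTranspose_zero]

/-- The first variation of the pair potential, expressed through orthonormal frames. -/
theorem exists_pairPot_perturb (hlp : Antitone lp) (hmp : Antitone mp) (hnp : Antitone np)
    (hlm : Antitone lm) (hmm : Antitone mm) (hnm : Antitone nm)
    (hlp0 : ∀ i, 0 ≤ lp i) (hmp0 : ∀ i, 0 ≤ mp i) (hnp0 : ∀ i, 0 ≤ np i)
    (hlm0 : ∀ i, 0 ≤ lm i) (hmm0 : ∀ i, 0 ≤ mm i) (hnm0 : ∀ i, 0 ≤ nm i)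
    {E₁ E₂ P₁ P₂ : Matrix N (Fin p) ℂ} {E₁' E₂' Q₁ Q₂ : Matrix N (Fin q) ℂ}
    {L₁ L₂ : Matrix (Fin p) N ℂ}
    (hE₁ : E₁ᴴ * E₁ = 1) (hE₂ : E₂ᴴ * E₂ = 1) (hE₁' : E₁'ᴴ * E₁' = 1) (hE₂' : E₂'ᴴ * E₂' = 1)
    (hQ₁ : Q₁ᴴ * Q₁ = 1) (hQ₂ : Q₂ᴴ * Q₂ = 1) (hP₁ : L₁ * P₁ = 1) (hP₂ : L₂ * P₂ = 1)
    (hEE₁ : E₁ᴴ * E₁' = 0) (hEE₂ : E₂ᴴ * E₂' = 0) (hPQ : P₁ᴴ * Q₁ + P₂ᴴ * Q₂ = 0)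
    {g₁ g₂ : Matrix N N ℂ} (hg₁ : IsUnit g₁.det) (hg₂ : IsUnit g₂.det) :
    ∃ (V₁ V₂ : Matrix N (Fin p ⊕ Fin q) ℂ) (T : Matrix (N ⊕ N) (Fin p ⊕ Fin q) ℂ),
      V₁ᴴ * V₁ = 1 ∧ V₂ᴴ * V₂ = 1 ∧ Tᴴ * T = 1 ∧
      ∀ ξ₁ ξ₂ : Matrix N N ℂ, ξ₁.IsHermitian → ξ₂.IsHermitian →
        rtr (ξ₁ * ξ₁) + rtr (ξ₂ * ξ₂) ≤ 1 / 4 →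
        pairPot lp mp np lm mm nm E₁ E₂ P₁ P₂ E₁' E₂' Q₁ Q₂
            (g₁ᴴ * (1 + ξ₁) * g₁) (g₂ᴴ * (1 + ξ₂) * g₂) ≤
          pairPot lp mp np lm mm nm E₁ E₂ P₁ P₂ E₁' E₂' Q₁ Q₂ (g₁ᴴ * g₁) (g₂ᴴ * g₂) +
          rtr (ξ₁ * (V₁ * signedDiag lp lm * V₁ᴴ - T.toRows₁ * signedDiag np nm * T.toRows₁ᴴ)) +
          rtr (ξ₂ * (V₂ * signedDiag mp mm * V₂ᴴ - T.toRows₂ * signedDiag np nm * T.toRows₂ᴴ)) +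
          2 * ((∑ i, lm i) + (∑ i, mm i) + ∑ i, np i) * (rtr (ξ₁ * ξ₁) + rtr (ξ₂ * ξ₂)) := by
  have hk₁ := posDef_conjTranspose_mul_self hg₁
  have hk₂ := posDef_conjTranspose_mul_self hg₂
  have gram : ∀ {m : ℕ} (g : Matrix N N ℂ) (X : Matrix N (Fin m) ℂ) (M : Matrix N N ℂ),
      Xᴴ * (gᴴ * M * g) * X = (g * X)ᴴ * M * (g * X) := fun g X M => by
    simp only [conjTranspose_mul, Matrix.mul_assoc]
  have gram1 : ∀ {m : ℕ} (g : Matrix N N ℂ) (X : Matrix N (Fin m) ℂ),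
      Xᴴ * (gᴴ * g) * X = (g * X)ᴴ * (g * X) := fun g X => by
    simp only [conjTranspose_mul, Matrix.mul_assoc]
  have ginv : ∀ g M : Matrix N N ℂ, (gᴴ * M * g)⁻¹ = ((g⁻¹)ᴴ)ᴴ * M⁻¹ * (g⁻¹)ᴴ := by
    intro g M
    rw [Matrix.mul_inv_rev, Matrix.mul_inv_rev, conjTranspose_conjTranspose,
      conjTranspose_nonsing_inv, Matrix.mul_assoc]
  have ginv1 : ∀ g : Matrix N N ℂ, (gᴴ * g)⁻¹ = ((g⁻¹)ᴴ)ᴴ * (g⁻¹)ᴴ := fun g => by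
    simpa using ginv g 1
  have rows : ∀ {m : ℕ} (A B : Matrix N (Fin m) ℂ),
      (fromRows A B)ᴴ * fromRows A B = Aᴴ * A + Bᴴ * B := fun A B => by
    rw [conjTranspose_fromRows_eq_fromCols_conjTranspose, fromCols_mul_fromRows]
  have cross : ∀ {g : Matrix N N ℂ}, IsUnit g.det → gᴴ * (g⁻¹)ᴴ = 1 := fun hg => by
    rw [← conjTranspose_mul, nonsing_inv_mul _ hg, conjTranspose_one]
  have cross' : ∀ {g : Matrix N N ℂ}, IsUnit g.det → g⁻¹ * g = 1 := fun hg => nonsing_inv_mul _ hg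
  obtain ⟨U₁, R₁, hR₁, hU₁, e₁, k₁⟩ := exists_frame_perturb hlp hlp0 (A := g₁ * E₁)
    (by rw [← gram1]; exact hk₁.isometry_conj hE₁)
  obtain ⟨U₂, R₂, hR₂, hU₂, e₂, k₂⟩ := exists_frame_perturb hmp hmp0 (A := g₂ * E₂)
    (by rw [← gram1]; exact hk₂.isometry_conj hE₂)
  obtain ⟨U₁', R₁', hR₁', hU₁', e₁', k₁'⟩ := exists_frame_perturb hlm hlm0 (A := (g₁⁻¹)ᴴ * E₁')
    (by rw [← gram1, ← ginv1]; exact hk₁.inv.isometry_conj hE₁')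
  obtain ⟨U₂', R₂', hR₂', hU₂', e₂', k₂'⟩ := exists_frame_perturb hmm hmm0 (A := (g₂⁻¹)ᴴ * E₂')
    (by rw [← gram1, ← ginv1]; exact hk₂.inv.isometry_conj hE₂')
  obtain ⟨S, R, hR, hS, e, k⟩ := exists_frame_perturb hnm hnm0
    (A := fromRows (g₁ * Q₁) (g₂ * Q₂))
    (by rw [rows, ← gram1, ← gram1]; exact (hk₁.isometry_conj hQ₁).add (hk₂.isometry_conj hQ₂))
  obtain ⟨S', R', hR', hS', e', k'⟩ := exists_frame_perturb hnp hnp0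
    (A := fromRows ((g₁⁻¹)ᴴ * P₁) ((g₂⁻¹)ᴴ * P₂))
    (by rw [rows, ← gram1, ← gram1, ← ginv1, ← ginv1]
        exact (hk₁.inv.conj_of_leftInverse hP₁).add (hk₂.inv.conj_of_leftInverse hP₂))
  refine ⟨fromCols U₁ U₁', fromCols U₂ U₂', fromCols S' S, fromCols_isometry hU₁ hU₁' ?_,
    fromCols_isometry hU₂ hU₂' ?_, fromCols_isometry hS' hS ?_, fun ξ₁ ξ₂ hξ₁ hξ₂ ht => ?_⟩
  · refine frames_orthogonal hR₁ hR₁' ?_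
    rw [← e₁, ← e₁', conjTranspose_mul, Matrix.mul_assoc, ← Matrix.mul_assoc g₁ᴴ, cross hg₁,
      Matrix.one_mul, hEE₁]
  · refine frames_orthogonal hR₂ hR₂' ?_
    rw [← e₂, ← e₂', conjTranspose_mul, Matrix.mul_assoc, ← Matrix.mul_assoc g₂ᴴ, cross hg₂,
      Matrix.one_mul, hEE₂]
  · refine frames_orthogonal hR' hR ?_
    rw [← e, ← e', conjTranspose_fromRows_eq_fromCols_conjTranspose, fromCols_mul_fromRows, ← hPQ]
    simp only [conjTranspose_mul, conjTranspose_conjTranspose]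
    rw [Matrix.mul_assoc, ← Matrix.mul_assoc g₁⁻¹, cross' hg₁, Matrix.one_mul, Matrix.mul_assoc,
      ← Matrix.mul_assoc g₂⁻¹, cross' hg₂, Matrix.one_mul]
  · have n₁ := rtr_sq_nonneg hξ₁
    have n₂ := rtr_sq_nonneg hξ₂
    have t₁ : rtr (ξ₁ * ξ₁) ≤ 1 / 4 := by linarith
    have t₂ : rtr (ξ₂ * ξ₂) ≤ 1 / 4 := by linarith
    have i₁ := (one_add_perturbation hξ₁ t₁).1.isUnit_det
    have i₂ := (one_add_perturbation hξ₂ t₂).1.isUnit_det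
    have hξ : (fromBlocks ξ₁ 0 0 ξ₂).IsHermitian := by
      rw [IsHermitian, fromBlocks_conjTranspose, hξ₁.eq, hξ₂.eq, conjTranspose_zero]
    have ht' : rtr (fromBlocks ξ₁ 0 0 ξ₂ * fromBlocks ξ₁ 0 0 ξ₂) ≤ 1 / 4 := by
      rwa [rtr_fromBlocks_mul_self]
    have a₁ := (k₁ ξ₁ hξ₁ t₁).1
    have a₂ := (k₂ ξ₂ hξ₂ t₂).1
    have a₁' := (k₁' ξ₁ hξ₁ t₁).2
    have a₂' := (k₂' ξ₂ hξ₂ t₂).2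
    have a := (k _ hξ ht').1
    have a' := (k' _ hξ ht').2
    rw [one_add_fromBlocks, fromRows_gram, rows, rtr_fromBlocks_mul_frameMat] at a
    rw [one_add_fromBlocks, inv_fromBlocks_diag i₁ i₂, fromRows_gram, rows,
      rtr_fromBlocks_mul_frameMat, rtr_fromBlocks_mul_self] at a'
    rw [(toRows_mul_signedDiag S' S np nm).1, (toRows_mul_signedDiag S' S np nm).2,
      fromCols_mul_signedDiag, fromCols_mul_signedDiag]
    simp only [pairPot, ginv, ginv1, gram, gram1, Matrix.mul_sub, rtr_sub]
    have s₁ := mul_nonneg (Finset.sum_nonneg fun i (_ : i ∈ Finset.univ) => hlm0 i) n₂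
    have s₂ := mul_nonneg (Finset.sum_nonneg fun i (_ : i ∈ Finset.univ) => hmm0 i) n₁
    linarith

theorem exists_approx_pair_of_bounded (hlp : Antitone lp) (hmp : Antitone mp) (hnp : Antitone np)
    (hlm : Antitone lm) (hmm : Antitone mm) (hnm : Antitone nm)
    (hlp0 : ∀ i, 0 ≤ lp i) (hmp0 : ∀ i, 0 ≤ mp i) (hnp0 : ∀ i, 0 ≤ np i)
    (hlm0 : ∀ i, 0 ≤ lm i) (hmm0 : ∀ i, 0 ≤ mm i) (hnm0 : ∀ i, 0 ≤ nm i)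
    {E₁ E₂ P₁ P₂ : Matrix N (Fin p) ℂ} {E₁' E₂' Q₁ Q₂ : Matrix N (Fin q) ℂ}
    {L₁ L₂ : Matrix (Fin p) N ℂ}
    (hE₁ : E₁ᴴ * E₁ = 1) (hE₂ : E₂ᴴ * E₂ = 1) (hE₁' : E₁'ᴴ * E₁' = 1) (hE₂' : E₂'ᴴ * E₂' = 1)
    (hQ₁ : Q₁ᴴ * Q₁ = 1) (hQ₂ : Q₂ᴴ * Q₂ = 1) (hP₁ : L₁ * P₁ = 1) (hP₂ : L₂ * P₂ = 1)
    (hEE₁ : E₁ᴴ * E₁' = 0) (hEE₂ : E₂ᴴ * E₂' = 0) (hPQ : P₁ᴴ * Q₁ + P₂ᴴ * Q₂ = 0) {C : ℝ}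
    (hC : ∀ k₁ k₂ : Matrix N N ℂ, k₁.PosDef → k₂.PosDef →
      C ≤ pairPot lp mp np lm mm nm E₁ E₂ P₁ P₂ E₁' E₂' Q₁ Q₂ k₁ k₂) {ε : ℝ} (hε : 0 < ε) :
    ∃ (V₁ V₂ : Matrix N (Fin p ⊕ Fin q) ℂ) (T : Matrix (N ⊕ N) (Fin p ⊕ Fin q) ℂ),
      V₁ᴴ * V₁ = 1 ∧ V₂ᴴ * V₂ = 1 ∧ Tᴴ * T = 1 ∧
      rtr ((V₁ * signedDiag lp lm * V₁ᴴ - T.toRows₁ * signedDiag np nm * T.toRows₁ᴴ)ᴴ *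
        (V₁ * signedDiag lp lm * V₁ᴴ - T.toRows₁ * signedDiag np nm * T.toRows₁ᴴ)) ≤ ε ∧
      rtr ((V₂ * signedDiag mp mm * V₂ᴴ - T.toRows₂ * signedDiag np nm * T.toRows₂ᴴ)ᴴ *
        (V₂ * signedDiag mp mm * V₂ᴴ - T.toRows₂ * signedDiag np nm * T.toRows₂ᴴ)) ≤ ε := by
  obtain ⟨K, hK⟩ : ∃ K, K = 2 * ((∑ i, lm i) + (∑ i, mm i) + ∑ i, np i) := ⟨_, rfl⟩
  have hK0 : 0 ≤ K := by
    have n₁ := Finset.sum_nonneg fun i (_ : i ∈ Finset.univ) => hlm0 i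
    have n₂ := Finset.sum_nonneg fun i (_ : i ∈ Finset.univ) => hmm0 i
    have n₃ := Finset.sum_nonneg fun i (_ : i ∈ Finset.univ) => hnp0 i
    rw [hK]; positivity
  obtain ⟨δ, hδ0, hδ⟩ : ∃ δ > 0, 4 * δ * (2 + 2 * K) ≤ min ε 1 := by
    refine ⟨min ε 1 / (4 * (2 + 2 * K)), by positivity, le_of_eq ?_⟩
    field_simp
  obtain ⟨⟨k₁, k₂⟩, ⟨hk₁, hk₂⟩, hmin⟩ := exists_approx_min
    (fun x : Matrix N N ℂ × Matrix N N ℂ => x.1.PosDef ∧ x.2.PosDef)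
    ⟨(1, 1), PosDef.one, PosDef.one⟩
    (fun x => pairPot lp mp np lm mm nm E₁ E₂ P₁ P₂ E₁' E₂' Q₁ Q₂ x.1 x.2) (C := C)
    (fun x hx => hC _ _ hx.1 hx.2) hδ0
  simp only at hk₁ hk₂ hmin
  obtain ⟨g₁, hg₁, rfl⟩ := hk₁.exists_conjTranspose_mul_self
  obtain ⟨g₂, hg₂, rfl⟩ := hk₂.exists_conjTranspose_mul_self
  obtain ⟨V₁, V₂, T, hV₁, hV₂, hT, h⟩ := exists_pairPot_perturb hlp hmp hnp hlm hmm hnm hlp0 hmp0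
    hnp0 hlm0 hmm0 hnm0 hE₁ hE₂ hE₁' hE₂' hQ₁ hQ₂ hP₁ hP₂ hEE₁ hEE₂ hPQ hg₁ hg₂
  rw [← hK] at h
  have hM₁ := (isHermitian_mul_mul_conjTranspose V₁ (signedDiag_isHermitian lp lm)).sub
    (isHermitian_mul_mul_conjTranspose T.toRows₁ (signedDiag_isHermitian np nm))
  have hM₂ := (isHermitian_mul_mul_conjTranspose V₂ (signedDiag_isHermitian mp mm)).sub
    (isHermitian_mul_mul_conjTranspose T.toRows₂ (signedDiag_isHermitian np nm))
  have z : rtr (0 : Matrix N N ℂ) = 0 := by simp [rtr]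
  refine ⟨V₁, V₂, T, hV₁, hV₂, hT, ?_, ?_⟩
  · rw [hM₁.eq]
    refine (descent hM₁ hK0 (hδ.trans (min_le_right _ _)) fun ξ hξ ht => ?_).trans
      (hδ.trans (min_le_left _ _))
    have h1 := h ξ 0 hξ isHermitian_zero (by simpa [z] using ht)
    have h2 := hmin (g₁ᴴ * (1 + ξ) * g₁, g₂ᴴ * (1 + 0) * g₂)
      ⟨(one_add_perturbation hξ ht).1.conj hg₁, by simpa using hk₂⟩
    simp only [Matrix.zero_mul, z] at h1 h2
    linarith
  · rw [hM₂.eq]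
    refine (descent hM₂ hK0 (hδ.trans (min_le_right _ _)) fun ξ hξ ht => ?_).trans
      (hδ.trans (min_le_left _ _))
    have h1 := h 0 ξ isHermitian_zero hξ (by simpa [z] using ht)
    have h2 := hmin (g₁ᴴ * (1 + 0) * g₁, g₂ᴴ * (1 + ξ) * g₂)
      ⟨by simpa using hk₁, (one_add_perturbation hξ ht).1.conj hg₂⟩
    simp only [Matrix.zero_mul, z] at h1 h2
    linarith

theorem exists_pair_of_bounded (hlp : Antitone lp) (hmp : Antitone mp) (hnp : Antitone np)
    (hlm : Antitone lm) (hmm : Antitone mm) (hnm : Antitone nm)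
    (hlp0 : ∀ i, 0 ≤ lp i) (hmp0 : ∀ i, 0 ≤ mp i) (hnp0 : ∀ i, 0 ≤ np i)
    (hlm0 : ∀ i, 0 ≤ lm i) (hmm0 : ∀ i, 0 ≤ mm i) (hnm0 : ∀ i, 0 ≤ nm i)
    {E₁ E₂ P₁ P₂ : Matrix N (Fin p) ℂ} {E₁' E₂' Q₁ Q₂ : Matrix N (Fin q) ℂ}
    {L₁ L₂ : Matrix (Fin p) N ℂ}
    (hE₁ : E₁ᴴ * E₁ = 1) (hE₂ : E₂ᴴ * E₂ = 1) (hE₁' : E₁'ᴴ * E₁' = 1) (hE₂' : E₂'ᴴ * E₂' = 1)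
    (hQ₁ : Q₁ᴴ * Q₁ = 1) (hQ₂ : Q₂ᴴ * Q₂ = 1) (hP₁ : L₁ * P₁ = 1) (hP₂ : L₂ * P₂ = 1)
    (hEE₁ : E₁ᴴ * E₁' = 0) (hEE₂ : E₂ᴴ * E₂' = 0) (hPQ : P₁ᴴ * Q₁ + P₂ᴴ * Q₂ = 0) {C : ℝ}
    (hC : ∀ k₁ k₂ : Matrix N N ℂ, k₁.PosDef → k₂.PosDef →
      C ≤ pairPot lp mp np lm mm nm E₁ E₂ P₁ P₂ E₁' E₂' Q₁ Q₂ k₁ k₂) :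
    ∃ (V₁ V₂ : Matrix N (Fin p ⊕ Fin q) ℂ) (T : Matrix (N ⊕ N) (Fin p ⊕ Fin q) ℂ),
      V₁ᴴ * V₁ = 1 ∧ V₂ᴴ * V₂ = 1 ∧ Tᴴ * T = 1 ∧
      V₁ * signedDiag lp lm * V₁ᴴ = T.toRows₁ * signedDiag np nm * T.toRows₁ᴴ ∧
      V₂ * signedDiag mp mm * V₂ᴴ = T.toRows₂ * signedDiag np nm * T.toRows₂ᴴ := by
  let r₁ : Matrix N (Fin p ⊕ Fin q) ℂ × Matrix N (Fin p ⊕ Fin q) ℂ ×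
      Matrix (N ⊕ N) (Fin p ⊕ Fin q) ℂ → Matrix N N ℂ := fun x =>
    x.1 * signedDiag lp lm * x.1ᴴ - x.2.2.toRows₁ * signedDiag np nm * x.2.2.toRows₁ᴴ
  let r₂ : Matrix N (Fin p ⊕ Fin q) ℂ × Matrix N (Fin p ⊕ Fin q) ℂ ×
      Matrix (N ⊕ N) (Fin p ⊕ Fin q) ℂ → Matrix N N ℂ := fun x =>
    x.2.1 * signedDiag mp mm * x.2.1ᴴ - x.2.2.toRows₂ * signedDiag np nm * x.2.2.toRows₂ᴴ
  have hq : ∀ {X : Type _} [TopologicalSpace X] {f : X → Matrix N (Fin p ⊕ Fin q) ℂ}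
      (D : Matrix (Fin p ⊕ Fin q) (Fin p ⊕ Fin q) ℂ), Continuous f →
      Continuous fun x => f x * D * (f x)ᴴ := fun D hf =>
    (hf.matrix_mul continuous_const).matrix_mul hf.matrix_conjTranspose
  have hr₁ : Continuous fun T : Matrix (N ⊕ N) (Fin p ⊕ Fin q) ℂ => T.toRows₁ :=
    continuous_id.matrix_submatrix Sum.inl id
  have hr₂ : Continuous fun T : Matrix (N ⊕ N) (Fin p ⊕ Fin q) ℂ => T.toRows₂ :=
    continuous_id.matrix_submatrix Sum.inr id
  have c₁ : Continuous r₁ := (hq _ continuous_fst).sub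
    (hq _ (hr₁.comp (continuous_snd.comp continuous_snd)))
  have c₂ : Continuous r₂ := (hq _ (continuous_fst.comp continuous_snd)).sub
    (hq _ (hr₂.comp (continuous_snd.comp continuous_snd)))
  obtain ⟨⟨V₁, V₂, T⟩, ⟨hV₁, hV₂, hT⟩, hx⟩ := ((isCompact_isometry (n := Fin p ⊕ Fin q)
    (N := N)).prod ((isCompact_isometry (n := Fin p ⊕ Fin q) (N := N)).prod
      (isCompact_isometry (n := Fin p ⊕ Fin q) (N := N ⊕ N)))).exists_le_zero
    (f := fun x => rtr ((r₁ x)ᴴ * r₁ x) + rtr ((r₂ x)ᴴ * r₂ x))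
    ((continuous_rtr.comp (c₁.matrix_conjTranspose.matrix_mul c₁)).add
      (continuous_rtr.comp (c₂.matrix_conjTranspose.matrix_mul c₂))) (by
    intro ε hε
    obtain ⟨V₁, V₂, T, hV₁, hV₂, hT, h₁, h₂⟩ := exists_approx_pair_of_bounded hlp hmp hnp hlm hmm
      hnm hlp0 hmp0 hnp0 hlm0 hmm0 hnm0 hE₁ hE₂ hE₁' hE₂' hQ₁ hQ₂ hP₁ hP₂ hEE₁ hEE₂ hPQ hC
      (half_pos hε)
    exact ⟨(V₁, V₂, T), ⟨hV₁, hV₂, hT⟩, by simp only [r₁, r₂]; linarith⟩)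
  have n₁ := rtr_conjTranspose_mul_self_nonneg (r₁ (V₁, V₂, T))
  have n₂ := rtr_conjTranspose_mul_self_nonneg (r₂ (V₁, V₂, T))
  exact ⟨V₁, V₂, T, hV₁, hV₂, hT,
    sub_eq_zero.1 (eq_zero_of_rtr_nonpos
      (by linarith : rtr ((r₁ (V₁, V₂, T))ᴴ * r₁ (V₁, V₂, T)) ≤ 0)),
    sub_eq_zero.1 (eq_zero_of_rtr_nonpos
      (by linarith : rtr ((r₂ (V₁, V₂, T))ᴴ * r₂ (V₁, V₂, T)) ≤ 0))⟩

end PairMinimizer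

section CompactToPseudoUnitary

variable {p q : ℕ}

theorem exists_sqrt_signedDiag {a : Fin p → ℝ} {b : Fin q → ℝ} (ha : ∀ i, 0 < a i)
    (hb : ∀ i, 0 < b i) :
    ∃ Δ : Matrix (Fin p ⊕ Fin q) (Fin p ⊕ Fin q) ℂ, Δᴴ = Δ ∧ IsUnit Δ.det ∧
      Δ * etaBlock p q * Δ = signedDiag a b ∧ etaBlock p q * Δ = Δ * etaBlock p q := by
  refine ⟨fromBlocks (diagonal (fun i => (Real.sqrt (a i) : ℂ))) 0 0
    (diagonal (fun i => (Real.sqrt (b i) : ℂ))), ?_, ?_, ?_, ?_⟩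
  · rw [fromBlocks_conjTranspose, diagonal_conjTranspose, diagonal_conjTranspose,
      star_ofReal_comp, star_ofReal_comp]
    simp
  · rw [det_fromBlocks_zero₂₁]
    exact (isUnit_det_diagonal_sqrt ha).mul (isUnit_det_diagonal_sqrt hb)
  · rw [etaBlock, signedDiag, fromBlocks_multiply, fromBlocks_multiply]
    simp only [Matrix.mul_one, Matrix.mul_zero, Matrix.zero_mul, add_zero, zero_add, Matrix.mul_neg,
      Matrix.neg_mul, neg_zero, diagonal_sqrt_mul_self ha, diagonal_sqrt_mul_self hb]
  · rw [etaBlock, fromBlocks_multiply, fromBlocks_multiply]; simp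

theorem exists_pseudoUnitary_of_congr {a : Fin p → ℝ} {b : Fin q → ℝ} (ha : ∀ i, 0 < a i)
    (hb : ∀ i, 0 < b i) {V W : Matrix (Fin p ⊕ Fin q) (Fin p ⊕ Fin q) ℂ} (hV : Vᴴ * V = 1)
    (h : V * signedDiag a b * Vᴴ = W * etaBlock p q * Wᴴ) :
    ∃ g, gᴴ * etaBlock p q * g = etaBlock p q ∧
      g * signedDiag a b * g⁻¹ = etaBlock p q * (Wᴴ * W) := by
  obtain ⟨Δ, hΔH, hΔu, hΔ, hΔc⟩ := exists_sqrt_signedDiag ha hb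
  have hη := etaBlock_mul_self (p := p) (q := q)
  have hηu : IsUnit (etaBlock p q).det := isUnit_det_of_left_inverse hη
  have hVu : IsUnit V.det := isUnit_det_of_left_inverse hV
  have hVHu : IsUnit (Vᴴ).det := by rw [det_conjTranspose]; exact hVu.star
  have hWu : IsUnit W.det := by
    have h1 : IsUnit (V * signedDiag a b * Vᴴ).det := by
      rw [← hΔ]
      simp only [det_mul]
      exact (hVu.mul ((hΔu.mul hηu).mul hΔu)).mul hVHu
    rw [h, Matrix.mul_assoc, det_mul] at h1
    exact isUnit_of_mul_isUnit_left h1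
  have hWHu : IsUnit (Wᴴ).det := by rw [det_conjTranspose]; exact hWu.star
  have hW := nonsing_inv_mul W hWu
  have hWH := mul_nonsing_inv Wᴴ hWHu
  obtain ⟨g, hg⟩ : ∃ g, g = W⁻¹ * V * Δ := ⟨_, rfl⟩
  have hgH : gᴴ = Δ * Vᴴ * (Wᴴ)⁻¹ := by
    rw [hg, conjTranspose_mul, conjTranspose_mul, hΔH, conjTranspose_nonsing_inv, Matrix.mul_assoc]
  have h1 : g * etaBlock p q * gᴴ = etaBlock p q := by
    calc g * etaBlock p q * gᴴ = W⁻¹ * (V * (Δ * etaBlock p q * Δ) * Vᴴ) * (Wᴴ)⁻¹ := by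
          rw [hgH, hg]; simp only [Matrix.mul_assoc]
      _ = (W⁻¹ * W) * etaBlock p q * (Wᴴ * (Wᴴ)⁻¹) := by
          rw [hΔ, h]; simp only [Matrix.mul_assoc]
      _ = etaBlock p q := by rw [hW, hWH, Matrix.one_mul, Matrix.mul_one]
  have h2 : g * (etaBlock p q * gᴴ * etaBlock p q) = 1 := by
    rw [← Matrix.mul_assoc, ← Matrix.mul_assoc, h1, hη]
  have h3 := mul_eq_one_comm.1 h2
  refine ⟨g, ?_, ?_⟩
  · calc gᴴ * etaBlock p q * g = etaBlock p q * (etaBlock p q * gᴴ * etaBlock p q * g) := by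
          simp only [← Matrix.mul_assoc]; rw [hη, Matrix.one_mul]
      _ = etaBlock p q := by rw [h3, Matrix.mul_one]
  · rw [inv_eq_right_inv h2]
    calc g * signedDiag a b * (etaBlock p q * gᴴ * etaBlock p q)
        = W⁻¹ * (V * (Δ * (Δ * etaBlock p q) * Δ) * (etaBlock p q * Δ) * Vᴴ) * (Wᴴ)⁻¹ *
            etaBlock p q := by
          rw [hgH, hg, ← hΔ]; simp only [Matrix.mul_assoc]
      _ = W⁻¹ * ((V * (Δ * etaBlock p q * Δ) * Vᴴ) * (V * (Δ * etaBlock p q * Δ) * Vᴴ)) *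
            (Wᴴ)⁻¹ * etaBlock p q := by
          have : (V * (Δ * etaBlock p q * Δ) * Vᴴ) * (V * (Δ * etaBlock p q * Δ) * Vᴴ) =
              V * (Δ * etaBlock p q * Δ) * (Vᴴ * V) * (Δ * etaBlock p q * Δ) * Vᴴ := by
            simp only [Matrix.mul_assoc]
          have hc : ∀ X, etaBlock p q * (Δ * X) = Δ * (etaBlock p q * X) := fun X => by
            rw [← Matrix.mul_assoc, hΔc, Matrix.mul_assoc]
          rw [this, hV]
          simp only [Matrix.mul_assoc, Matrix.one_mul, hc]
      _ = (W⁻¹ * W) * etaBlock p q * (Wᴴ * W) * etaBlock p q * (Wᴴ * (Wᴴ)⁻¹) *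
            etaBlock p q := by
          rw [hΔ, h]; simp only [Matrix.mul_assoc]
      _ = etaBlock p q * (Wᴴ * W) := by
          rw [hW, hWH, Matrix.one_mul, Matrix.mul_one, Matrix.mul_assoc _ (etaBlock p q), hη,
            Matrix.mul_one]

theorem pos_of_diagonal_eq_frameMat_add {m : Type*} [Fintype m] [DecidableEq m] {a b : m → ℝ}
    {c : m → ℝ} (ha : ∀ i, 0 < a i) (hb : ∀ i, 0 < b i) {U₁ U₂ H : Matrix m m ℂ}
    (hU₁ : U₁ᴴ * U₁ = 1) (hH : H.PosSemidef)
    (h : diagonal (fun i => (c i : ℂ)) = frameMat U₁ a + frameMat U₂ b + H) (i : m) : 0 < c i := by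
  have hu : IsUnit (U₁ᴴ).det := isUnit_det_of_right_inverse hU₁
  have h1 : (frameMat U₁ a).PosDef := by
    have := (posDef_diagonal_ofReal ha).conj hu
    rwa [conjTranspose_conjTranspose] at this
  have h2 : (frameMat U₂ b).PosSemidef :=
    (posDef_diagonal_ofReal hb).posSemidef.mul_mul_conjTranspose_same U₂
  have h3 := (h1.add_posSemidef h2).add_posSemidef hH
  rw [← h] at h3
  simpa using h3.diag_pos (i := i)

variable {lp mp np : Fin p → ℝ} {lm mm nm : Fin q → ℝ}

/-- Solutions of the compact equation give solutions of the equation for pseudo-unitary orbits. -/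
theorem pseudoUnitary_of_compact (hlp : Antitone lp) (hmp : Antitone mp) (hnp : Antitone np)
    (hlm : Antitone lm) (hmm : Antitone mm) (hnm : Antitone nm)
    (hlp0 : ∀ i, 0 < lp i) (hmp0 : ∀ i, 0 < mp i)
    (hlm0 : ∀ i, 0 < lm i) (hmm0 : ∀ i, 0 < mm i)
    {U₁ U₂ : Matrix (Fin p) (Fin p) ℂ} {V₁ V₂ : Matrix (Fin q) (Fin q) ℂ}
    {Y : Matrix (Fin p) (Fin q) ℂ} (hU₁ : U₁ᴴ * U₁ = 1) (hU₂ : U₂ᴴ * U₂ = 1)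
    (hV₁ : V₁ᴴ * V₁ = 1) (hV₂ : V₂ᴴ * V₂ = 1)
    (hnpeq : diagonal (fun i => (np i : ℂ)) = frameMat U₁ lp + frameMat U₂ mp + Y * Yᴴ)
    (hnmeq : diagonal (fun i => (nm i : ℂ)) = frameMat V₁ lm + frameMat V₂ mm + Yᴴ * Y) :
    ∃ g h : Matrix (Fin p ⊕ Fin q) (Fin p ⊕ Fin q) ℂ, gᴴ * etaBlock p q * g = etaBlock p q ∧
      hᴴ * etaBlock p q * h = etaBlock p q ∧
      signedDiag np nm = g * signedDiag lp lm * g⁻¹ + h * signedDiag mp mm * h⁻¹ := by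
  have hnp0 := pos_of_diagonal_eq_frameMat_add hlp0 hmp0 hU₁ (posSemidef_self_mul_conjTranspose Y)
    hnpeq
  have hnm0 := pos_of_diagonal_eq_frameMat_add hlm0 hmm0 hV₁ (posSemidef_conjTranspose_mul_self Y)
    hnmeq
  obtain ⟨E, hEd⟩ : ∃ E : Matrix (Fin p ⊕ Fin q) (Fin p) ℂ, E = fromRows 1 0 := ⟨_, rfl⟩
  obtain ⟨E', hEd'⟩ : ∃ E : Matrix (Fin p ⊕ Fin q) (Fin q) ℂ, E = fromRows 0 1 := ⟨_, rfl⟩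
  obtain ⟨T₁, hTd₁⟩ : ∃ T : Matrix (Fin p ⊕ Fin q) (Fin p) ℂ, T = fromRows 1 Yᴴ := ⟨_, rfl⟩
  obtain ⟨T₂, hTd₂⟩ : ∃ T : Matrix (Fin p ⊕ Fin q) (Fin p) ℂ, T = fromRows 1 (-Yᴴ) := ⟨_, rfl⟩
  have hE : Eᴴ * E = 1 := by
    rw [hEd, conjTranspose_fromRows_eq_fromCols_conjTranspose, fromCols_mul_fromRows]; simp
  have hE' : E'ᴴ * E' = 1 := by
    rw [hEd', conjTranspose_fromRows_eq_fromCols_conjTranspose, fromCols_mul_fromRows]; simp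
  have hEE' : Eᴴ * E' = 0 := by
    rw [hEd, hEd', conjTranspose_fromRows_eq_fromCols_conjTranspose, fromCols_mul_fromRows]; simp
  have hT₁ : Eᴴ * T₁ = 1 := by
    rw [hEd, hTd₁, conjTranspose_fromRows_eq_fromCols_conjTranspose, fromCols_mul_fromRows]; simp
  have hT₂ : Eᴴ * T₂ = 1 := by
    rw [hEd, hTd₂, conjTranspose_fromRows_eq_fromCols_conjTranspose, fromCols_mul_fromRows]; simp
  have hY : E'ᴴ * T₁ = Yᴴ := by
    rw [hEd', hTd₁, conjTranspose_fromRows_eq_fromCols_conjTranspose, fromCols_mul_fromRows]; simp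
  have hPQ : T₁ᴴ * E' + T₂ᴴ * E' = 0 := by
    rw [hEd', hTd₁, hTd₂, conjTranspose_fromRows_eq_fromCols_conjTranspose,
      conjTranspose_fromRows_eq_fromCols_conjTranspose, fromCols_mul_fromRows,
      fromCols_mul_fromRows]
    simp
  have iso : ∀ {m : ℕ} {D : Matrix (Fin p ⊕ Fin q) (Fin m) ℂ} {U : Matrix (Fin m) (Fin m) ℂ},
      Dᴴ * D = 1 → Uᴴ * U = 1 → (D * U)ᴴ * (D * U) = 1 := by
    intro m D U hD hU
    rw [conjTranspose_mul, Matrix.mul_assoc, ← Matrix.mul_assoc Dᴴ, hD, Matrix.one_mul, hU]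
  have orth : ∀ (U : Matrix (Fin p) (Fin p) ℂ) (V : Matrix (Fin q) (Fin q) ℂ),
      (E * U)ᴴ * (E' * V) = 0 := by
    intro U V
    rw [conjTranspose_mul, Matrix.mul_assoc, ← Matrix.mul_assoc Eᴴ, hEE', Matrix.zero_mul,
      Matrix.mul_zero]
  obtain ⟨X₁, X₂, T, hX₁, hX₂, hT, e₁, e₂⟩ := exists_pair_of_bounded hlp hmp hnp hlm hmm hnm
    (fun i => (hlp0 i).le) (fun i => (hmp0 i).le) (fun i => (hnp0 i).le)
    (fun i => (hlm0 i).le) (fun i => (hmm0 i).le) (fun i => (hnm0 i).le)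
    (iso hE hU₁) (iso hE hU₂) (iso hE' hV₁) (iso hE' hV₂) hE' hE' hT₁ hT₂ (orth U₁ V₁) (orth U₂ V₂)
    hPQ (fun k₁ k₂ hk₁ hk₂ => neg_card_le_pairPot hlp hmp hnp hlm hmm hnm
      (fun i => (hlp0 i).le) (fun i => (hmp0 i).le) (fun i => (hnp0 i).le)
      (fun i => (hlm0 i).le) (fun i => (hmm0 i).le) (fun i => (hnm0 i).le)
      hU₁ hU₂ hV₁ hV₂ hnpeq hnmeq hE hE' hT₁ hT₂ hY hk₁ hk₂)
  obtain ⟨Δ, hΔH, -, hΔ, hΔc⟩ := exists_sqrt_signedDiag hnp0 hnm0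
  have conj : ∀ S : Matrix (Fin p ⊕ Fin q) (Fin p ⊕ Fin q) ℂ,
      S * signedDiag np nm * Sᴴ = (S * Δ) * etaBlock p q * (S * Δ)ᴴ := by
    intro S
    rw [← hΔ, conjTranspose_mul, hΔH]
    simp only [Matrix.mul_assoc]
  obtain ⟨g, hg, eg⟩ := exists_pseudoUnitary_of_congr hlp0 hlm0 hX₁ (e₁.trans (conj _))
  obtain ⟨h, hh, eh⟩ := exists_pseudoUnitary_of_congr hmp0 hmm0 hX₂ (e₂.trans (conj _))
  refine ⟨g, h, hg, hh, ?_⟩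
  have hsum : T.toRows₁ᴴ * T.toRows₁ + T.toRows₂ᴴ * T.toRows₂ = 1 := by
    rw [← hT, ← fromCols_mul_fromRows, ← conjTranspose_fromRows_eq_fromCols_conjTranspose,
      fromRows_toRows]
  rw [eg, eh, ← Matrix.mul_add, conjTranspose_mul, conjTranspose_mul, hΔH]
  calc signedDiag np nm = etaBlock p q * (Δ * 1 * Δ) := by
        rw [← hΔ, ← hΔc, Matrix.mul_one, Matrix.mul_assoc]
    _ = _ := by
        rw [← hsum]; simp only [Matrix.mul_add, Matrix.add_mul, Matrix.mul_assoc]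

end CompactToPseudoUnitary

section BlockReindexing

variable {p q : ℕ}

/-- The identification of `Fin p ⊕ Fin q` with `Fin (p + q)` which reverses the second block. -/
def revSumEquiv (p q : ℕ) : Fin p ⊕ Fin q ≃ Fin (p + q) :=
  (Equiv.sumCongr (Equiv.refl _) Fin.revPerm).trans finSumFinEquiv

/-- The first block of a sequence, shifted down by `c`. -/
def upperPart (c : ℝ) (A : Fin (p + q) → ℝ) : Fin p → ℝ := fun i => A (Fin.castAdd q i) - c

/-- The reversed second block of a sequence, subtracted from `c`. -/
def lowerPart (c : ℝ) (A : Fin (p + q) → ℝ) : Fin q → ℝ := fun j => c - A (Fin.natAdd p j.rev)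

theorem revSumEquiv_inl (i : Fin p) : revSumEquiv p q (Sum.inl i) = Fin.castAdd q i := by
  simp [revSumEquiv]

theorem revSumEquiv_inr (j : Fin q) : revSumEquiv p q (Sum.inr j) = Fin.natAdd p j.rev := by
  simp [revSumEquiv]

theorem submatrix_revSumEquiv_mul (A B : Matrix (Fin (p + q)) (Fin (p + q)) ℂ) :
    (A * B).submatrix (revSumEquiv p q) (revSumEquiv p q) =
      A.submatrix (revSumEquiv p q) (revSumEquiv p q) *
        B.submatrix (revSumEquiv p q) (revSumEquiv p q) :=
  (submatrix_mul_equiv A B _ _ _).symm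

theorem submatrix_revSumEquiv_inj {A B : Matrix (Fin (p + q)) (Fin (p + q)) ℂ} :
    A.submatrix (revSumEquiv p q) (revSumEquiv p q) =
      B.submatrix (revSumEquiv p q) (revSumEquiv p q) ↔ A = B :=
  (reindex (revSumEquiv p q).symm (revSumEquiv p q).symm).injective.eq_iff

theorem etaMat_submatrix :
    (etaMat p q).submatrix (revSumEquiv p q) (revSumEquiv p q) = etaBlock p q := by
  rw [etaMat, submatrix_diagonal_equiv, etaBlock, ← diagonal_one, ← diagonal_one, diagonal_neg,
    fromBlocks_diagonal]
  congr 1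
  ext (i | j)
  · simp [revSumEquiv_inl]
  · simp [revSumEquiv_inr]

theorem Dmat_submatrix (c : ℝ) (A : Fin (p + q) → ℝ) :
    (Dmat A).submatrix (revSumEquiv p q) (revSumEquiv p q) =
      signedDiag (upperPart c A) (lowerPart c A) + (c : ℂ) • 1 := by
  rw [Dmat, submatrix_diagonal_equiv, signedDiag, smul_one_eq_diagonal, diagonal_neg,
    fromBlocks_diagonal, diagonal_add]
  congr 1
  ext (i | j)
  · simp [revSumEquiv_inl, upperPart]
  · simp [revSumEquiv_inr, lowerPart]

theorem blockDiag_submatrix (u : Matrix (Fin p) (Fin p) ℂ) (v : Matrix (Fin q) (Fin q) ℂ) :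
    (blockDiag u v).submatrix (revSumEquiv p q) (revSumEquiv p q) =
      fromBlocks u 0 0 (v.submatrix Fin.rev Fin.rev) := by
  ext (i | i) (j | j) <;> simp [_root_.blockDiag, revSumEquiv]

theorem inUpq_iff {g : Matrix (Fin (p + q)) (Fin (p + q)) ℂ} :
    InUpq p q g ↔ (g.submatrix (revSumEquiv p q) (revSumEquiv p q))ᴴ * etaBlock p q *
      g.submatrix (revSumEquiv p q) (revSumEquiv p q) = etaBlock p q := by
  rw [InUpq, ← submatrix_revSumEquiv_inj, submatrix_revSumEquiv_mul, submatrix_revSumEquiv_mul,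
    etaMat_submatrix, conjTranspose_submatrix]

theorem isUnit_det_of_pseudoUnitary {g : Matrix (Fin p ⊕ Fin q) (Fin p ⊕ Fin q) ℂ}
    (hg : gᴴ * etaBlock p q * g = etaBlock p q) : IsUnit g.det :=
  isUnit_det_of_left_inverse (B := etaBlock p q * (gᴴ * etaBlock p q)) (by
    rw [Matrix.mul_assoc, hg, etaBlock_mul_self])

theorem conj_add_smul_one {n : Type*} [Fintype n] [DecidableEq n] {g : Matrix n n ℂ}
    (hg : IsUnit g.det) (D : Matrix n n ℂ) (c : ℂ) :
    g * (D + c • 1) * g⁻¹ = g * D * g⁻¹ + c • 1 := by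
  rw [Matrix.mul_add, Matrix.add_mul, Matrix.mul_smul, Matrix.smul_mul, Matrix.mul_one,
    mul_nonsing_inv _ hg]

/-- The equation for pseudo-unitary orbits in block form, with the eigenvalues shifted. -/
theorem Dmat_eq_iff_signedDiag_eq (s t : ℝ) {lam mu nu : Fin (p + q) → ℝ}
    {g h : Matrix (Fin (p + q)) (Fin (p + q)) ℂ} (hg : InUpq p q g) (hh : InUpq p q h) :
    Dmat nu = g * Dmat lam * g⁻¹ + h * Dmat mu * h⁻¹ ↔
      signedDiag (upperPart (s + t) nu) (lowerPart (s + t) nu) =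
        g.submatrix (revSumEquiv p q) (revSumEquiv p q) *
            signedDiag (upperPart s lam) (lowerPart s lam) *
            (g.submatrix (revSumEquiv p q) (revSumEquiv p q))⁻¹ +
          h.submatrix (revSumEquiv p q) (revSumEquiv p q) *
            signedDiag (upperPart t mu) (lowerPart t mu) *
            (h.submatrix (revSumEquiv p q) (revSumEquiv p q))⁻¹ := by
  have ug := isUnit_det_of_pseudoUnitary (inUpq_iff.1 hg)
  have uh := isUnit_det_of_pseudoUnitary (inUpq_iff.1 hh)
  rw [← submatrix_revSumEquiv_inj, submatrix_add, Pi.add_apply, Pi.add_apply]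
  simp only [submatrix_revSumEquiv_mul]
  rw [Dmat_submatrix (s + t), Dmat_submatrix s, Dmat_submatrix t, ← inv_submatrix_equiv,
    ← inv_submatrix_equiv, conj_add_smul_one ug, conj_add_smul_one uh, add_add_add_comm, ← add_smul,
    Complex.ofReal_add, add_left_inj]

theorem fromBlocks_conj_signedDiag {u : Matrix (Fin p) (Fin p) ℂ} {v : Matrix (Fin q) (Fin q) ℂ}
    (hu : uᴴ * u = 1) (hv : vᴴ * v = 1) (a : Fin p → ℝ) (b : Fin q → ℝ) (c : ℂ) :
    fromBlocks u 0 0 v * (signedDiag a b + c • 1) * (fromBlocks u 0 0 v)ᴴ =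
      fromBlocks (frameMat u a) 0 0 (-frameMat v b) + c • 1 := by
  have h : fromBlocks u 0 0 v * (fromBlocks u 0 0 v)ᴴ = 1 := by
    rw [fromBlocks_conjTranspose, fromBlocks_multiply]
    simp [mul_eq_one_comm.1 hu, mul_eq_one_comm.1 hv]
  rw [Matrix.mul_add, Matrix.add_mul, Matrix.mul_smul, Matrix.smul_mul, Matrix.mul_one, h,
    signedDiag, fromBlocks_conjTranspose, fromBlocks_multiply, fromBlocks_multiply]
  simp [frameMat, -diagonal_neg]

/-- The equation for the compact group in block form, with the eigenvalues shifted. -/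
theorem Dmat_eq_iff_blocks_eq (s t : ℝ) {lam mu nu : Fin (p + q) → ℝ}
    {u₁ u₂ : Matrix (Fin p) (Fin p) ℂ} {v₁ v₂ : Matrix (Fin q) (Fin q) ℂ}
    (Y : Matrix (Fin p) (Fin q) ℂ) (hu₁ : u₁ᴴ * u₁ = 1) (hu₂ : u₂ᴴ * u₂ = 1)
    (hv₁ : (v₁.submatrix Fin.rev Fin.rev)ᴴ * v₁.submatrix Fin.rev Fin.rev = 1)
    (hv₂ : (v₂.submatrix Fin.rev Fin.rev)ᴴ * v₂.submatrix Fin.rev Fin.rev = 1) :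
    Dmat nu = blockDiag u₁ v₁ * Dmat lam * (blockDiag u₁ v₁)ᴴ +
          blockDiag u₂ v₂ * Dmat mu * (blockDiag u₂ v₂)ᴴ + blockDiag (Y * Yᴴ) (-(Yᴴ * Y)) ↔
      diagonal (fun i => (upperPart (s + t) nu i : ℂ)) = frameMat u₁ (upperPart s lam) +
          frameMat u₂ (upperPart t mu) + Y.submatrix id Fin.rev * (Y.submatrix id Fin.rev)ᴴ ∧
        diagonal (fun i => (lowerPart (s + t) nu i : ℂ)) =
          frameMat (v₁.submatrix Fin.rev Fin.rev) (lowerPart s lam) +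
          frameMat (v₂.submatrix Fin.rev Fin.rev) (lowerPart t mu) +
          (Y.submatrix id Fin.rev)ᴴ * Y.submatrix id Fin.rev := by
  have hY : Y.submatrix id Fin.rev * (Y.submatrix id Fin.rev)ᴴ = Y * Yᴴ := by
    rw [conjTranspose_submatrix]
    exact submatrix_mul_equiv Y Yᴴ id Fin.revPerm id
  have hY' : (Y.submatrix id Fin.rev)ᴴ * Y.submatrix id Fin.rev =
      (Yᴴ * Y).submatrix Fin.rev Fin.rev := by
    rw [conjTranspose_submatrix]
    exact submatrix_mul_equiv Yᴴ Y Fin.rev (Equiv.refl _) Fin.rev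
  rw [← submatrix_revSumEquiv_inj]
  simp only [submatrix_add, Pi.add_apply, submatrix_revSumEquiv_mul, ← conjTranspose_submatrix,
    blockDiag_submatrix]
  rw [Dmat_submatrix (s + t), Dmat_submatrix s, Dmat_submatrix t,
    fromBlocks_conj_signedDiag hu₁ hv₁, fromBlocks_conj_signedDiag hu₂ hv₂, add_add_add_comm,
    ← add_smul, ← Complex.ofReal_add, add_right_comm, add_left_inj, signedDiag, fromBlocks_add,
    fromBlocks_add, fromBlocks_inj, hY, hY', submatrix_neg, Pi.neg_apply, Pi.neg_apply, ← neg_add,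
    ← neg_add, neg_inj]
  simp

theorem submatrix_rev_isometry {v : Matrix (Fin q) (Fin q) ℂ} (hv : vᴴ * v = 1) :
    (v.submatrix Fin.rev Fin.rev)ᴴ * v.submatrix Fin.rev Fin.rev = 1 := by
  rw [conjTranspose_submatrix]
  refine (submatrix_mul_equiv vᴴ v Fin.rev Fin.revPerm Fin.rev).trans ?_
  rw [hv]
  exact submatrix_one_equiv Fin.revPerm

theorem upperPart_antitone {A : Fin (p + q) → ℝ}
    (hA : ∀ i j : Fin (p + q), i ≤ j → (j : ℕ) < p → A j ≤ A i) (c : ℝ) :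
    Antitone (upperPart c A) := fun i j hij =>
  sub_le_sub_right (hA _ _ (show Fin.castAdd q i ≤ Fin.castAdd q j from hij) (by simp)) c

theorem lowerPart_antitone {A : Fin (p + q) → ℝ}
    (hA : ∀ i j : Fin (p + q), i ≤ j → p ≤ (i : ℕ) → A j ≤ A i) (c : ℝ) :
    Antitone (lowerPart c A) := fun i j hij =>
  sub_le_sub_left (hA _ _ (by simpa using hij) (by simp)) c

/-- A sequence with a gap at `p` can be shifted so that both of its parts are positive. -/
theorem exists_shift_pos {A : Fin (p + q) → ℝ} (hA : Antitone A) {k l : Fin (p + q)}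
    (hk : (k : ℕ) = p) (hl : (l : ℕ) = p - 1) (hreg : A k < A l) :
    ∃ c, (∀ i, 0 < upperPart c A i) ∧ ∀ j, 0 < lowerPart c A j := by
  obtain ⟨c, h1, h2⟩ := exists_between hreg
  refine ⟨c, fun i => sub_pos.2 (h2.trans_le (hA ?_)), fun j => sub_pos.2 (lt_of_le_of_lt (hA ?_)
    h1)⟩
  · rw [Fin.le_def, Fin.val_castAdd]
    omega
  · rw [Fin.le_def, Fin.val_natAdd]
    omega

theorem pos_of_diagonal_eq_frameMat_add_mul_conjTranspose {m k : Type*} [Fintype m] [DecidableEq m]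
    [Fintype k] {a b c : m → ℝ} {U V : Matrix m m ℂ} {Z : Matrix m k ℂ} (ha : ∀ i, 0 < a i)
    (hb : ∀ i, 0 < b i) (hU : Uᴴ * U = 1)
    (h : diagonal (fun i => (c i : ℂ)) = frameMat U a + frameMat V b + Z * Zᴴ) (i : m) :
    0 < c i :=
  pos_of_diagonal_eq_frameMat_add ha hb hU (posSemidef_self_mul_conjTranspose Z) h i

theorem antitone_of_parts {A : Fin (p + q) → ℝ} {c : ℝ}
    (h₁ : ∀ i j : Fin (p + q), i ≤ j → (j : ℕ) < p → A j ≤ A i)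
    (h₂ : ∀ i j : Fin (p + q), i ≤ j → p ≤ (i : ℕ) → A j ≤ A i)
    (hu : ∀ i, 0 < upperPart c A i) (hl : ∀ j, 0 < lowerPart c A j) : Antitone A := by
  intro i j hij
  by_cases hj : (j : ℕ) < p
  · exact h₁ i j hij hj
  by_cases hi : p ≤ (i : ℕ)
  · exact h₂ i j hij hi
  push Not at hi hj
  have a := sub_pos.1 (hu ⟨i, hi⟩)
  have b := sub_pos.1 (hl (Fin.rev ⟨j - p, by omega⟩))
  have ei : Fin.castAdd q ⟨i, hi⟩ = i := rfl
  have ej : Fin.natAdd p (Fin.rev (Fin.rev (⟨j - p, by omega⟩ : Fin q))) = j := by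
    rw [Fin.rev_rev, Fin.ext_iff, Fin.val_natAdd]
    change p + ((j : ℕ) - p) = j
    omega
  rw [ei] at a
  rw [ej] at b
  exact (b.trans a).le

end BlockReindexing

end

/-- P-E Paradan: `P(λ,μ) = Kir(O_λ × O_μ × p⁺)`. For regular `λ, μ`, a
weakly decreasing `ν` is such that `D_ν ∈ O^{nc}_λ + O^{nc}_μ` iff `ν` (decreasing on each
block) is in the Kirwan set of the `U(p)×U(q)`-Hamiltonian space `O_λ × O_μ × p⁺`. -/
theorem Plm_eq_Kirwan (p q : ℕ) (hp : 1 ≤ p) (hq : 1 ≤ q)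
    (lam mu : Fin (p + q) → ℝ) (hlam : Antitone lam) (hmu : Antitone mu)
    (hlamreg : lam ⟨p, by omega⟩ < lam ⟨p - 1, by omega⟩)
    (hmureg : mu ⟨p, by omega⟩ < mu ⟨p - 1, by omega⟩) :
    {nu : Fin (p + q) → ℝ | Antitone nu ∧
      ∃ g h : Matrix (Fin (p + q)) (Fin (p + q)) ℂ, InUpq p q g ∧ InUpq p q h ∧
        Dmat nu = g * Dmat lam * g⁻¹ + h * Dmat mu * h⁻¹} =
    {nu : Fin (p + q) → ℝ |
      (∀ i j : Fin (p + q), i ≤ j → (j : ℕ) < p → nu j ≤ nu i) ∧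
      (∀ i j : Fin (p + q), i ≤ j → p ≤ (i : ℕ) → nu j ≤ nu i) ∧
      ∃ (u₁ u₂ : Matrix (Fin p) (Fin p) ℂ) (v₁ v₂ : Matrix (Fin q) (Fin q) ℂ)
        (Y : Matrix (Fin p) (Fin q) ℂ),
        u₁ᴴ * u₁ = 1 ∧ u₂ᴴ * u₂ = 1 ∧ v₁ᴴ * v₁ = 1 ∧ v₂ᴴ * v₂ = 1 ∧
        Dmat nu = blockDiag u₁ v₁ * Dmat lam * (blockDiag u₁ v₁)ᴴ +
          blockDiag u₂ v₂ * Dmat mu * (blockDiag u₂ v₂)ᴴ +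
          blockDiag (Y * Yᴴ) (-(Yᴴ * Y))} := by
  obtain ⟨s, hs, hs'⟩ := exists_shift_pos hlam rfl rfl hlamreg
  obtain ⟨t, ht, ht'⟩ := exists_shift_pos hmu rfl rfl hmureg
  have up : ∀ {A : Fin (p + q) → ℝ} (c : ℝ), Antitone A → Antitone (upperPart c A) :=
    fun c hA => upperPart_antitone (fun i j hij _ => hA hij) c
  have low : ∀ {A : Fin (p + q) → ℝ} (c : ℝ), Antitone A → Antitone (lowerPart c A) :=
    fun c hA => lowerPart_antitone (fun i j hij _ => hA hij) c
  have rr : ∀ {m : ℕ} (Z : Matrix (Fin m) (Fin q) ℂ),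
      (Z.submatrix id Fin.rev).submatrix id Fin.rev = Z := fun Z => by ext; simp
  have rr' : ∀ V : Matrix (Fin q) (Fin q) ℂ,
      (V.submatrix Fin.rev Fin.rev).submatrix Fin.rev Fin.rev = V := fun V => by ext; simp
  ext nu
  constructor
  · rintro ⟨hnu, g, h, hg, hh, heq⟩
    rw [Dmat_eq_iff_signedDiag_eq s t hg hh] at heq
    obtain ⟨U₁, U₂, V₁, V₂, y, hU₁, hU₂, hV₁, hV₂, e₁, e₂⟩ := compact_of_pseudoUnitary
      (up s hlam) (up t hmu) (up _ hnu) (low s hlam) (low t hmu) (low _ hnu) hs ht hs' ht'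
      (inUpq_iff.1 hg) (inUpq_iff.1 hh) heq
    refine ⟨fun i j hij _ => hnu hij, fun i j hij _ => hnu hij, U₁, U₂,
      V₁.submatrix Fin.rev Fin.rev, V₂.submatrix Fin.rev Fin.rev, y.submatrix id Fin.rev, hU₁, hU₂,
      submatrix_rev_isometry hV₁, submatrix_rev_isometry hV₂, ?_⟩
    rw [Dmat_eq_iff_blocks_eq s t _ hU₁ hU₂ (by rwa [rr']) (by rwa [rr']), rr, rr', rr']
    exact ⟨e₁, e₂⟩
  · rintro ⟨h₁, h₂, u₁, u₂, v₁, v₂, Y, hu₁, hu₂, hv₁, hv₂, heq⟩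
    have hw₁ := submatrix_rev_isometry hv₁
    have hw₂ := submatrix_rev_isometry hv₂
    rw [Dmat_eq_iff_blocks_eq s t _ hu₁ hu₂ hw₁ hw₂] at heq
    obtain ⟨e₁, e₂⟩ := heq
    obtain ⟨g, h, hg, hh, e⟩ := pseudoUnitary_of_compact (up s hlam) (up t hmu)
      (upperPart_antitone h₁ _) (low s hlam) (low t hmu) (lowerPart_antitone h₂ _) hs ht hs' ht'
      hu₁ hu₂ hw₁ hw₂ e₁ e₂
    have back : ∀ g : Matrix (Fin p ⊕ Fin q) (Fin p ⊕ Fin q) ℂ,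
        (g.submatrix (revSumEquiv p q).symm (revSumEquiv p q).symm).submatrix (revSumEquiv p q)
          (revSumEquiv p q) = g := fun g => by ext; simp
    have hg' : InUpq p q (g.submatrix (revSumEquiv p q).symm (revSumEquiv p q).symm) :=
      inUpq_iff.2 (by rwa [back])
    have hh' : InUpq p q (h.submatrix (revSumEquiv p q).symm (revSumEquiv p q).symm) :=
      inUpq_iff.2 (by rwa [back])
    refine ⟨antitone_of_parts h₁ h₂
      (pos_of_diagonal_eq_frameMat_add_mul_conjTranspose hs ht hu₁ e₁)
      (pos_of_diagonal_eq_frameMat_add_mul_conjTranspose hs' ht' hw₁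
        (by rw [conjTranspose_conjTranspose]; exact e₂)),
      _, _, hg', hh', ?_⟩
    rw [Dmat_eq_iff_signedDiag_eq s t hg' hh', back, back]
    exact e
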